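/- arXiv:2206.01128 — 7 statements merged into one kernel-verified Lean document; each statement's English description precedes it below -/
import Mathlib

section
/- Let X be a metric space and L > 0. For every L-Lipschitz function f : X → ℝ and every Borel function g : X → [0,∞], one has ∫_ℝ ( ∫_{f⁻¹(t)} g dH¹ ) dt ≤ (4L/π) ∫_X g dH². -/
open MeasureTheory
open scoped ENNReal NNReal

/-- The Hausdorff 2-measure on a metric space, normalized so that the Hausdorff
`n`-measure coincides with Lebesgue measure on Euclidean `ℝⁿ`.  (Mathlib's
`μH[2]` uses the unnormalized Carathéodory construction with `diam ^ 2`; the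
normalization constant in dimension `2` is `π / 4`.) -/
noncomputable def mu2 (X : Type*) [EMetricSpace X] [MeasurableSpace X] [BorelSpace X] :
    Measure X :=
  ENNReal.ofReal (Real.pi / 4) • μH[2]

open Filter Topology in
theorem coarea_set {X : Type*} [MetricSpace X] [MeasurableSpace X] [BorelSpace X]
    (K : ℝ≥0) (f : X → ℝ) (hf : LipschitzWith K f) (A : Set X) :
    ∃ h : ℝ → ℝ≥0∞, Measurable h ∧ (∀ t, (μH[1] : Measure X) (A ∩ f ⁻¹' {t}) ≤ h t) ∧
      ∫⁻ t, h t ≤ K * (μH[2] : Measure X) A := by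
  by_cases hK : (K : ℝ≥0∞) * (μH[2] : Measure X) A = ⊤
  · exact ⟨fun _ => ⊤, measurable_const, fun _ => le_top, by rw [hK]; exact le_top⟩
  by_cases hA : (μH[2] : Measure X) A = ⊤
  · have hK0 : K = 0 := by
      by_contra h
      apply hK
      rw [hA]
      exact ENNReal.mul_top (by exact_mod_cast h)
    subst hK0
    -- `f` is constant
    refine ⟨(toMeasurable volume (f '' Set.univ)).indicator (fun _ => ⊤),
      measurable_const.indicator (measurableSet_toMeasurable _ _), ?_, ?_⟩
    · intro t
      by_cases ht : t ∈ f '' Set.univ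
      · rw [Set.indicator_of_mem (subset_toMeasurable _ _ ht)]
        exact le_top
      · have : A ∩ f ⁻¹' {t} = ∅ := by
          ext x
          simp only [Set.mem_inter_iff, Set.mem_preimage, Set.mem_singleton_iff,
            Set.mem_empty_iff_false, iff_false, not_and]
          intro _ hx
          exact ht ⟨x, trivial, hx⟩
        rw [this]; simp
    · rw [lintegral_indicator_const (measurableSet_toMeasurable _ _), measure_toMeasurable]
      have : volume (f '' Set.univ) = 0 := by
        refine le_antisymm ((Real.volume_le_diam _).trans ?_) (zero_le)
        rw [Metric.ediam_image_le_iff]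
        intro x _ y _
        simpa using hf x y
      rw [this]; simp
  set r : ℕ → ℝ≥0∞ := fun n => ((n : ℝ≥0∞) + 1)⁻¹ with hr
  have hr0 : ∀ n, 0 < r n := fun n => by
    simp [hr, ENNReal.inv_pos]
  have hrt : Tendsto r atTop (𝓝 0) := by
    have := (tendsto_add_atTop_iff_nat 1).2 ENNReal.tendsto_inv_nat_nhds_zero
    simpa [hr] using this
  have key : ∀ n, ∃ T : ℕ → Set X, A ⊆ ⋃ i, T i ∧ (∀ i, Metric.ediam (T i) ≤ r n) ∧
      ∑' i, Metric.ediam (T i) * Metric.ediam (T i) ≤ (μH[2] : Measure X) A + r n := by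
    intro n
    have h1 : (⨅ (t : ℕ → Set X) (_ : A ⊆ ⋃ n, t n) (_ : ∀ i, Metric.ediam (t i) ≤ r n),
          ∑' i, ⨆ _ : (t i).Nonempty, Metric.ediam (t i) ^ (2 : ℝ)) <
          (μH[2] : Measure X) A + r n := by
      refine lt_of_le_of_lt ?_ (ENNReal.lt_add_right hA (hr0 n).ne')
      rw [Measure.hausdorffMeasure_apply]
      exact le_iSup₂_of_le (r n) (hr0 n) le_rfl
    simp only [iInf_lt_iff] at h1
    obtain ⟨T, hT1, hT2, hT3⟩ := h1
    refine ⟨T, hT1, hT2, le_trans (ENNReal.tsum_le_tsum fun i => ?_) hT3.le⟩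
    rcases (T i).eq_empty_or_nonempty with he | he
    · simp [he]
    · refine le_iSup_of_le he ?_
      rw [ENNReal.rpow_two, sq]
  choose T hT1 hT2 hT3 using key
  set F : ℕ → ℝ → ℝ≥0∞ := fun n t =>
    ∑' i, (toMeasurable volume (f '' T n i)).indicator (fun _ => Metric.ediam (T n i)) t with hF
  have hFi : ∀ n i, Measurable
      ((toMeasurable volume (f '' T n i)).indicator (fun _ : ℝ => Metric.ediam (T n i))) :=
    fun n i => measurable_const.indicator (measurableSet_toMeasurable _ _)
  have hFm : ∀ n, Measurable (F n) := fun n => Measurable.tsum (hFi n)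
  refine ⟨fun t => liminf (fun n => F n t) atTop, Measurable.liminf hFm, ?_, ?_⟩
  · intro t
    refine (Measure.hausdorffMeasure_le_liminf_tsum 1 (A ∩ f ⁻¹' {t}) r hrt
      (fun n i => T n i ∩ f ⁻¹' {t}) (Eventually.of_forall fun n i =>
        (Metric.ediam_mono Set.inter_subset_left).trans (hT2 n i))
      (Eventually.of_forall fun n => ?_)).trans
      (liminf_le_liminf (Eventually.of_forall fun n => ?_))
    · rw [← Set.iUnion_inter]
      exact Set.inter_subset_inter_left _ (hT1 n)
    · refine ENNReal.tsum_le_tsum fun i => ?_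
      rw [ENNReal.rpow_one]
      rcases (T n i ∩ f ⁻¹' {t}).eq_empty_or_nonempty with he | ⟨x, hx1, hx2⟩
      · simp [he]
      · have hx3 : t ∈ f '' T n i := ⟨x, hx1, hx2⟩
        rw [Set.indicator_of_mem (subset_toMeasurable _ _ hx3)]
        exact Metric.ediam_mono Set.inter_subset_left
  · refine (lintegral_liminf_le hFm).trans ?_
    have hb : ∀ n, ∫⁻ t, F n t ≤ K * ((μH[2] : Measure X) A + r n) := by
      intro n
      rw [hF]
      simp only
      rw [lintegral_tsum fun i => (hFi n i).aemeasurable]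
      refine le_trans ?_ (mul_le_mul_right (hT3 n) _)
      rw [← ENNReal.tsum_mul_left]
      refine ENNReal.tsum_le_tsum fun i => ?_
      rw [lintegral_indicator_const (measurableSet_toMeasurable _ _), measure_toMeasurable]
      calc _ ≤ Metric.ediam (T n i) * (K * Metric.ediam (T n i)) := by
            gcongr
            exact (Real.volume_le_diam _).trans (hf.ediam_image_le _)
        _ = _ := by ring
    have hlim : Tendsto (fun n => (K : ℝ≥0∞) * ((μH[2] : Measure X) A + r n)) atTop
        (𝓝 (K * ((μH[2] : Measure X) A + 0))) :=
      ENNReal.Tendsto.const_mul (tendsto_const_nhds.add hrt) (Or.inr ENNReal.coe_ne_top)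
    rw [add_zero] at hlim
    rw [← hlim.liminf_eq]
    exact liminf_le_liminf (Eventually.of_forall hb)

open Filter Topology in
theorem coarea_fun {X : Type*} [MetricSpace X] [MeasurableSpace X] [BorelSpace X]
    (K : ℝ≥0) (f : X → ℝ) (hf : LipschitzWith K f) (g : X → ℝ≥0∞) (hg : Measurable g) :
    ∃ h : ℝ → ℝ≥0∞, Measurable h ∧
      (∀ t, ∫⁻ x in f ⁻¹' {t}, g x ∂(μH[1] : Measure X) ≤ h t) ∧
      ∫⁻ t, h t ≤ K * ∫⁻ x, g x ∂(μH[2] : Measure X) := by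
  refine Measurable.ennreal_induction (motive := fun g => ∃ h : ℝ → ℝ≥0∞, Measurable h ∧
      (∀ t, ∫⁻ x in f ⁻¹' {t}, g x ∂(μH[1] : Measure X) ≤ h t) ∧
      ∫⁻ t, h t ≤ K * ∫⁻ x, g x ∂(μH[2] : Measure X)) ?_ ?_ ?_ hg
  · intro c s hs
    obtain ⟨h, hm, h1, h2⟩ := coarea_set K f hf s
    refine ⟨fun t => c * h t, hm.const_mul c, fun t => ?_, ?_⟩
    · rw [lintegral_indicator_const hs, Measure.restrict_apply hs]
      exact mul_le_mul_right (h1 t) c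
    · rw [lintegral_const_mul c hm, lintegral_indicator_const hs, mul_left_comm]
      exact mul_le_mul_right h2 c
  · intro g₁ g₂ _ m₁ m₂ ih₁ ih₂
    obtain ⟨h, hm, h1, h2⟩ := ih₁
    obtain ⟨k, km, k1, k2⟩ := ih₂
    refine ⟨fun t => h t + k t, hm.add km, fun t => ?_, ?_⟩
    · simp only [Pi.add_apply]
      rw [lintegral_add_left m₁]
      exact add_le_add (h1 t) (k1 t)
    · simp only [Pi.add_apply]
      rw [lintegral_add_left m₁, lintegral_add_left hm, mul_add]
      exact add_le_add h2 k2
  · intro u um umono ih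
    choose h hm h1 h2 using ih
    refine ⟨fun t => liminf (fun n => h n t) atTop, Measurable.liminf hm, fun t => ?_, ?_⟩
    · rw [lintegral_iSup um umono]
      refine iSup_le fun m => le_liminf_of_le (h := ?_)
      filter_upwards [eventually_ge_atTop m] with n hn
      exact (lintegral_mono (umono hn)).trans (h1 n t)
    · refine (lintegral_liminf_le hm).trans ?_
      refine (liminf_le_liminf (v := fun _ => K * ∫⁻ x, ⨆ n, u n x ∂(μH[2] : Measure X))
        (Eventually.of_forall fun n => (h2 n).trans ?_)).trans (by simp)
      refine mul_le_mul_right (lintegral_mono fun x => ?_) _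
      exact le_iSup (fun n => u n x) n

/-- **Co-area inequality.** Let `X` be a metric space and `L > 0`.  For every
`L`-Lipschitz function `f : X → ℝ` and every Borel function `g : X → [0,∞]`,
`∫_ℝ ( ∫_{f⁻¹(t)} g dH¹ ) dt ≤ (4L/π) ∫_X g dH²`. -/
theorem coarea_inequality {X : Type*} [MetricSpace X] [MeasurableSpace X] [BorelSpace X]
    (L : ℝ) (hL : 0 < L) (f : X → ℝ) (hf : LipschitzWith (Real.toNNReal L) f)
    (g : X → ℝ≥0∞) (hg : Measurable g) :
    (∫⁻ t : ℝ, ∫⁻ x in f ⁻¹' {t}, g x ∂(μH[1] : Measure X) ∂(volume : Measure ℝ)) ≤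
      ENNReal.ofReal (4 * L / Real.pi) * ∫⁻ x, g x ∂(mu2 X) := by
  obtain ⟨h, _, h1, h2⟩ := coarea_fun _ f hf g hg
  refine (lintegral_mono h1).trans (h2.trans (le_of_eq ?_))
  rw [mu2, lintegral_smul_measure, smul_eq_mul, ← mul_assoc,
    ← ENNReal.ofReal_mul (by positivity)]
  have : 4 * L / Real.pi * (Real.pi / 4) = L := by
    field_simp [Real.pi_ne_zero]
  rw [this]
  rfl
end

section
/- Let (X,d) be a metric surface with locally finite Hausdorff 2-measure and let x₀ ∈ X. Then the function u : X → [0,∞] defined by u(x) = d̄(x,x₀) is lower semicontinuous (with respect to the topology induced by d). Moreover, for each r > 0 the set B_{d̄}(x₀,r) = {x ∈ X : d̄(x,x₀) < r} is connected, and the set {x ∈ X : d̄(x,x₀) ≤ r} equals the closure of B_{d̄}(x₀,r); in particular {x ∈ X : d̄(x,x₀) ≤ r} is connected. -/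
open Set Metric MeasureTheory
open scoped ENNReal NNReal unitInterval

/-- The length of a curve `γ : [0,1] → X` in a metric space: the supremum of
`Σᵢ d(γ(t_{i-1}), γ(tᵢ))` over all finite increasing sequences in `[0,1]`. -/
noncomputable def curveLength {X : Type*} [MetricSpace X] (γ : I → X) : ℝ≥0∞ :=
  eVariationOn γ Set.univ

/-- The extended length metric `d̄` associated to a metric space `(X,d)`:
`d̄(x,y)` is the infimum of the lengths of continuous curves joining `x` and `y`
(`∞` if there is no rectifiable such curve). -/
noncomputable def extDist {X : Type*} [MetricSpace X] (x y : X) : ℝ≥0∞ :=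
  ⨅ (γ : I → X) (_ : Continuous γ) (_ : γ 0 = x) (_ : γ 1 = y), curveLength γ

/-- A metric surface: a metric space that is (homeomorphic to) a 2-manifold,
possibly with boundary, i.e. it carries an atlas of charts modelled on the
Euclidean half-plane. -/
def IsMetricSurface (X : Type*) [TopologicalSpace X] : Prop :=
  Nonempty (ChartedSpace (EuclideanHalfSpace 2) X)

open Filter Topology

inductive Chn {X : Type*} [MetricSpace X] (M : Set X) (δ : ℝ) (a : X) : X → ℝ → Prop
  | refl : a ∈ M → Chn M δ a a 0
  | step {b c : X} {L : ℝ} : Chn M δ a b L → c ∈ M → dist b c ≤ δ → Chn M δ a c (L + dist b c)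

namespace Chn
variable {X : Type*} [MetricSpace X] {M : Set X} {δ : ℝ} {a b c : X} {L L' : ℝ}

lemma nonneg (h : Chn M δ a b L) : 0 ≤ L := by
  induction h with
  | refl => exact le_rfl
  | step _ _ _ ih => positivity

lemma mem_left (h : Chn M δ a b L) : a ∈ M := by
  induction h with
  | refl h => exact h
  | step _ _ _ ih => exact ih

lemma mem_right (h : Chn M δ a b L) : b ∈ M := by
  cases h with
  | refl h => exact h
  | step _ h _ => exact h

lemma single (ha : a ∈ M) (hb : b ∈ M) (h : dist a b ≤ δ) : Chn M δ a b (dist a b) := by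
  simpa using Chn.step (Chn.refl (δ := δ) ha) hb h

lemma trans (h : Chn M δ a b L) (h' : Chn M δ b c L') : Chn M δ a c (L + L') := by
  induction h' with
  | refl => simpa using h
  | step _ h1 h2 ih =>
    rw [← add_assoc]
    exact Chn.step ih h1 h2

lemma symm (h : Chn M δ a b L) : Chn M δ b a L := by
  induction h with
  | refl h => exact Chn.refl h
  | @step b c L h1 h2 h3 ih =>
    have := (single h2 h1.mem_right (by rwa [dist_comm])).trans ih
    rwa [dist_comm, add_comm] at this

lemma func (hδ : 0 ≤ δ) (h : Chn M δ a b L) : ∃ f : ℝ → X, (∀ s, f s ∈ M) ∧ f 0 = a ∧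
    (∀ s, L ≤ s → f s = b) ∧ ∀ s t, 0 ≤ s → s ≤ t → dist (f s) (f t) ≤ t - s + δ := by
  induction h with
  | refl h =>
    refine ⟨fun _ => a, fun _ => h, rfl, fun _ _ => rfl, fun s t _ h => ?_⟩
    simp; linarith
  | @step b c L h1 h2 h3 ih =>
    obtain ⟨f, f1, f2, f3, f4⟩ := ih
    have hL := h1.nonneg
    have hd := dist_nonneg (x := b) (y := c)
    refine ⟨fun s => if s < L + dist b c then f s else c, ?_, ?_, ?_, ?_⟩
    · intro s
      dsimp only
      split_ifs
      · exact f1 s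
      · exact h2
    · dsimp only
      split_ifs with h
      · exact f2
      · have e1 : L = 0 := by linarith
        have e2 : dist b c = 0 := by linarith
        rw [← f2, f3 0 e1.le, dist_eq_zero.1 e2]
    · intro s hs
      simp [not_lt.2 hs]
    · intro s t hs hst
      dsimp only
      split_ifs with i1 i2 i2
      · exact f4 s t hs hst
      · by_cases hsL : L ≤ s
        · rw [f3 s hsL]; linarith
        · have := f4 s L hs (by linarith)
          rw [f3 L le_rfl] at this
          have := dist_triangle (f s) b c
          linarith
      · linarith
      · simp; linarith

end Chn

lemma extDist_le_of_chains {X : Type*} [MetricSpace X] {M : Set X} (hM : IsCompact M)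
    {a b : X} {L : ℝ} (hL : 0 ≤ L)
    (h : ∀ δ > 0, ∃ l ≤ L + δ, Chn M δ a b l) : extDist a b ≤ ENNReal.ofReal L := by
  have h0 : ∀ n : ℕ, (0 : ℝ) < 1 / ((n : ℝ) + 1) := fun n => by positivity
  have h1 : ∀ n : ℕ, ∃ g : ℝ → X, (∀ s, g s ∈ M) ∧ g 0 = a ∧ g 1 = b ∧ ∀ s t, 0 ≤ s → s ≤ t →
      dist (g s) (g t) ≤ (L + 1 / ((n : ℝ) + 1)) * (t - s) + 1 / ((n : ℝ) + 1) := by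
    intro n
    obtain ⟨l, hl, hc⟩ := h _ (h0 n)
    obtain ⟨f, f1, f2, f3, f4⟩ := hc.func (h0 n).le
    have hp := h0 n
    refine ⟨fun s => f ((L + 1 / ((n : ℝ) + 1)) * s), fun s => f1 _, by simpa using f2, ?_, ?_⟩
    · exact f3 _ (by simpa using hl)
    · intro s t hs hst
      refine (f4 _ _ (by positivity) (by gcongr)).trans (le_of_eq ?_)
      ring
  choose g g1 g2 g3 g4 using h1
  have hlim : ∀ t : ℝ, ∃ y ∈ M, Tendsto (fun n => g n t) (hyperfilter ℕ : Filter ℕ) (𝓝 y) := by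
    intro t
    obtain ⟨y, hy, hy'⟩ := hM.ultrafilter_le_nhds ((hyperfilter ℕ).map (fun n => g n t))
      (by
        rw [le_principal_iff]
        exact Filter.Eventually.of_forall (f := (hyperfilter ℕ : Filter ℕ)) (fun n => g1 n t))
    exact ⟨y, hy, hy'⟩
  choose f f1 f2 using hlim
  have hle : (hyperfilter ℕ : Filter ℕ) ≤ atTop := by
    rw [← Nat.cofinite_eq_atTop]; exact hyperfilter_le_cofinite
  have hz : Tendsto (fun n : ℕ => 1 / ((n : ℝ) + 1)) (hyperfilter ℕ : Filter ℕ) (𝓝 0) :=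
    tendsto_one_div_add_atTop_nhds_zero_nat.mono_left hle
  have hd : ∀ s t, 0 ≤ s → s ≤ t → dist (f s) (f t) ≤ L * (t - s) := by
    intro s t hs hst
    have e1 := (f2 s).dist (f2 t)
    have e2 : Tendsto (fun n : ℕ => (L + 1 / ((n : ℝ) + 1)) * (t - s) + 1 / ((n : ℝ) + 1))
        (hyperfilter ℕ : Filter ℕ) (𝓝 ((L + 0) * (t - s) + 0)) :=
      ((tendsto_const_nhds.add hz).mul_const _).add hz
    simp only [add_zero] at e2
    exact le_of_tendsto_of_tendsto' e1 e2 (fun n => g4 n s t hs hst)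
  have hf0 : f 0 = a := tendsto_nhds_unique (f2 0) (by simp [g2])
  have hf1 : f 1 = b := tendsto_nhds_unique (f2 1) (by simp [g3])
  have hlip : LipschitzWith (Real.toNNReal L) (fun t : I => f t) := by
    refine LipschitzWith.of_dist_le_mul fun s t => ?_
    rw [Real.coe_toNNReal _ hL]
    rcases le_total s t with hst | hst
    · refine (hd s t s.2.1 hst).trans (mul_le_mul_of_nonneg_left ?_ hL)
      rw [dist_comm, Subtype.dist_eq, Real.dist_eq]; exact le_abs_self _
    · rw [dist_comm]
      refine (hd t s t.2.1 hst).trans (mul_le_mul_of_nonneg_left ?_ hL)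
      rw [Subtype.dist_eq, Real.dist_eq]; exact le_abs_self _
  have key : extDist a b ≤ curveLength (fun t : I => f t) := by
    unfold extDist
    exact iInf_le_of_le _ (iInf_le_of_le hlip.continuous (iInf_le_of_le (by simp [hf0])
      (iInf_le_of_le (by simp [hf1]) le_rfl)))
  refine key.trans ?_
  unfold curveLength
  have e := (hlip.lipschitzOnWith (s := univ)).comp_eVariationOn_le (g := (id : I → I)) (s := univ) (by intro x _; trivial)
  refine e.trans ?_
  have e3 : eVariationOn (id : I → I) univ ≤ 1 := by
    have : eVariationOn (id : I → I) univ = eVariationOn (fun t : I => (t : ℝ)) univ := by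
      simp only [eVariationOn]; rfl
    rw [this]
    have := MonotoneOn.eVariationOn_le (f := fun t : I => (t : ℝ)) (s := univ) (a := 0) (b := 1)
      (fun x _ y _ h => h) trivial trivial
    have h2 : (univ ∩ Icc 0 1 : Set I) = univ := by
      ext x; simp [x.2.1, unitInterval.le_one']
    rw [h2] at this
    simpa using this
  calc _ ≤ (Real.toNNReal L : ℝ≥0∞) * 1 := by gcongr
    _ = _ := by simp [ENNReal.ofReal]

noncomputable def cdist {X : Type*} [MetricSpace X] (M : Set X) (δ η : ℝ) (a z : X) : ℝ :=
  sInf (insert η {L | Chn M δ a z L})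

section cdist
variable {X : Type*} [MetricSpace X] {M : Set X} {δ η : ℝ} {a z w : X}

lemma cdist_bdd (hη : 0 ≤ η) : BddBelow (insert η {L | Chn M δ a z L}) :=
  ⟨0, by rintro x (rfl | hx); exacts [hη, Chn.nonneg hx]⟩

lemma cdist_le_eta (hη : 0 ≤ η) : cdist M δ η a z ≤ η :=
  csInf_le (cdist_bdd hη) (mem_insert _ _)

lemma cdist_nonneg (hη : 0 ≤ η) : 0 ≤ cdist M δ η a z :=
  le_csInf (insert_nonempty _ _) (by rintro x (rfl | hx); exacts [hη, Chn.nonneg hx])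

lemma cdist_le (hη : 0 ≤ η) {L : ℝ} (h : Chn M δ a z L) : cdist M δ η a z ≤ L :=
  csInf_le (cdist_bdd hη) (mem_insert_of_mem _ h)

lemma exists_of_cdist_lt (h : cdist M δ η a z < η) : ∃ L < η, Chn M δ a z L := by
  obtain ⟨L, hL, hlt⟩ := exists_lt_of_csInf_lt (insert_nonempty _ _) h
  rcases hL with rfl | hL
  · exact absurd hlt (lt_irrefl _)
  · exact ⟨L, hlt, hL⟩

lemma cdist_step (hη : 0 ≤ η) (hz : z ∈ M) (hw : w ∈ M) (h : dist z w ≤ δ) :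
    cdist M δ η a w ≤ cdist M δ η a z + dist z w := by
  rw [← sub_le_iff_le_add]
  refine le_csInf (insert_nonempty _ _) ?_
  rintro x (rfl | hx)
  · have := cdist_le_eta (M := M) (δ := δ) (a := a) (z := w) hη
    have := dist_nonneg (x := z) (y := w)
    linarith
  · have := cdist_le hη (Chn.trans hx (Chn.single hz hw h))
    linarith

lemma cdist_lip (hη : 0 ≤ η) (hz : z ∈ M) (hw : w ∈ M) (h : dist z w ≤ δ) :
    dist (cdist M δ η a z) (cdist M δ η a w) ≤ dist z w := by
  have h1 := cdist_step (a := a) hη hz hw h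
  have h2 := cdist_step (δ := δ) (a := a) hη hw hz (by rwa [dist_comm])
  rw [dist_comm w z] at h2
  rw [Real.dist_eq, abs_le]
  constructor <;> linarith

lemma cdist_cont (hη : 0 ≤ η) (hδ : 0 < δ) : ContinuousOn (cdist M δ η a) M := by
  rw [Metric.continuousOn_iff]
  intro z hz ε hε
  refine ⟨min δ ε, by positivity, fun w hw h => ?_⟩
  exact (cdist_lip hη hw hz (h.le.trans (min_le_left _ _))).trans_lt
    (h.trans_le (min_le_right _ _))

end cdist

lemma hausdorff_image_le_of_local {X : Type*} [MetricSpace X] [MeasurableSpace X] [BorelSpace X]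
    {M V : Set X} (hM : IsCompact M) (hV : V ⊆ M) {δ : ℝ} (hδ : 0 < δ) (u : X → ℝ)
    (hu : ∀ z ∈ V, ∀ w ∈ V, dist z w ≤ δ → dist (u z) (u w) ≤ dist z w) :
    μH[1] (u '' V) ≤ μH[1] V := by
  rcases V.eq_empty_or_nonempty with rfl | hne
  · simp
  obtain ⟨t, ht, hcov⟩ := Metric.totallyBounded_iff.1 hM.totallyBounded (δ / 2) (by positivity)
  have htne : t.Nonempty := by
    obtain ⟨v, hv⟩ := hne
    obtain ⟨y, hy⟩ := mem_iUnion.1 (hcov (hV hv))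
    obtain ⟨hy, _⟩ := mem_iUnion.1 hy
    exact ⟨y, hy⟩
  obtain ⟨y, rfl⟩ := ht.countable.exists_eq_range htne
  set B : ℕ → Set X := fun n => ball (y n) (δ / 2) with hB
  have hBm : ∀ n, MeasurableSet (disjointed B n) := fun n =>
    MeasurableSet.disjointed (fun i => isOpen_ball.measurableSet) n
  have hcov2 : V ⊆ ⋃ n, disjointed B n := by
    rw [iUnion_disjointed]
    refine hV.trans (hcov.trans ?_)
    intro x hx
    simpa [hB] using hx
  calc μH[1] (u '' V) ≤ μH[1] (⋃ n, u '' (disjointed B n ∩ V)) := by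
        apply measure_mono
        rw [← image_iUnion, ← iUnion_inter]
        exact image_mono (subset_inter hcov2 le_rfl)
    _ ≤ ∑' n, μH[1] (u '' (disjointed B n ∩ V)) := measure_iUnion_le _
    _ ≤ ∑' n, μH[1] (disjointed B n ∩ V) := by
        refine ENNReal.tsum_le_tsum fun n => ?_
        have : LipschitzOnWith 1 u (disjointed B n ∩ V) := by
          refine LipschitzOnWith.of_dist_le_mul fun z hz w hw => ?_
          rw [NNReal.coe_one, one_mul]
          refine hu z hz.2 w hw.2 ?_
          have h1 : dist z (y n) < δ / 2 := disjointed_subset B n hz.1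
          have h2 : dist w (y n) < δ / 2 := disjointed_subset B n hw.1
          have := dist_triangle_right z w (y n)
          linarith
        simpa using this.hausdorffMeasure_image_le (d := 1) zero_le_one
    _ = ∑' n, (μH[1].restrict V) (disjointed B n) := by
        congr 1; ext n; rw [Measure.restrict_apply (hBm n)]
    _ = (μH[1].restrict V) (⋃ n, disjointed B n) :=
        (measure_iUnion (disjoint_disjointed B) hBm).symm
    _ ≤ (μH[1].restrict V) univ := measure_mono (subset_univ _)
    _ = μH[1] V := by simp

lemma separated_card_le {X : Type*} [MetricSpace X] [MeasurableSpace X] [BorelSpace X]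
    {M C : Set X} (hM : IsCompact M) (hC : C ⊆ M) (hconn : IsPreconnected C)
    {δ η : ℝ} (hδ : 0 < δ) (hη : 0 < η) (F : Finset X) (hF : ↑F ⊆ C) (hcard : 2 ≤ F.card)
    (hsep : ∀ a ∈ F, ∀ b ∈ F, a ≠ b → ∀ L, Chn M δ a b L → η < L) :
    (F.card : ℝ≥0∞) * ENNReal.ofReal (η / 2) ≤ μH[1] C := by
  have hη2 : 0 ≤ η / 2 := by positivity
  set O : X → Set X := fun a => {z | z ∈ M ∧ cdist M δ (η / 2) a z < η / 2} with hO
  have hOm : ∀ a, MeasurableSet (O a) := by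
    intro a
    obtain ⟨u, hu, he⟩ := continuousOn_iff'.1 (cdist_cont (M := M) (a := a) hη2 hδ) (Iio (η / 2))
      isOpen_Iio
    have : O a = u ∩ M := by
      rw [← he]; ext z; simp [hO, and_comm]
    rw [this]
    exact hu.measurableSet.inter hM.isClosed.measurableSet
  have hdisj : ∀ a ∈ F, ∀ b ∈ F, a ≠ b → Disjoint (O a) (O b) := by
    intro a ha b hb hab
    rw [Set.disjoint_left]
    rintro z ⟨_, hz1⟩ ⟨_, hz2⟩
    obtain ⟨L1, h1, c1⟩ := exists_of_cdist_lt hz1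
    obtain ⟨L2, h2, c2⟩ := exists_of_cdist_lt hz2
    have := hsep a ha b hb hab _ (c1.trans c2.symm)
    linarith
  have hbig : ∀ a ∈ F, ENNReal.ofReal (η / 2) ≤ μH[1] (O a ∩ C) := by
    intro a ha
    obtain ⟨b, hb, hba⟩ := Finset.exists_mem_ne (by omega : 1 < F.card) a
    have haM : a ∈ M := hC (hF ha)
    have h0 : cdist M δ (η / 2) a a = 0 :=
      le_antisymm (cdist_le hη2 (Chn.refl haM)) (cdist_nonneg hη2)
    have h1 : cdist M δ (η / 2) a b = η / 2 := by
      refine le_antisymm (cdist_le_eta hη2) (not_lt.1 fun hlt => ?_)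
      obtain ⟨L, hL, c⟩ := exists_of_cdist_lt hlt
      have := hsep a ha b hb hba.symm _ c
      linarith
    have hicc := hconn.intermediate_value (hF ha) (hF hb) ((cdist_cont (a := a) hη2 hδ).mono hC)
    rw [h0, h1] at hicc
    have hsub : Ico 0 (η / 2) ⊆ cdist M δ (η / 2) a '' (O a ∩ C) := by
      intro s hs
      obtain ⟨z, hz, rfl⟩ := hicc ⟨hs.1, hs.2.le⟩
      exact ⟨z, ⟨⟨hC hz, hs.2⟩, hz⟩, rfl⟩
    calc ENNReal.ofReal (η / 2) = μH[1] (Ico 0 (η / 2)) := by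
          rw [hausdorffMeasure_real]; simp
      _ ≤ μH[1] (cdist M δ (η / 2) a '' (O a ∩ C)) := measure_mono hsub
      _ ≤ _ := hausdorff_image_le_of_local hM (inter_subset_right.trans hC) hδ _
          (fun z hz w hw h => cdist_lip hη2 (hC hz.2) (hC hw.2) h)
  calc (F.card : ℝ≥0∞) * ENNReal.ofReal (η / 2) = ∑ a ∈ F, ENNReal.ofReal (η / 2) := by simp
    _ ≤ ∑ a ∈ F, (μH[1].restrict C) (O a) := by
        refine Finset.sum_le_sum fun a ha => ?_
        rw [Measure.restrict_apply (hOm a)]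
        exact hbig a ha
    _ = (μH[1].restrict C) (⋃ a ∈ F, O a) :=
        (measure_biUnion_finset (fun a ha b hb hab => hdisj a ha b hb hab) (fun a _ => hOm a)).symm
    _ ≤ (μH[1].restrict C) univ := measure_mono (subset_univ _)
    _ = μH[1] C := by simp

lemma exists_close_chain {X : Type*} [MetricSpace X] [MeasurableSpace X] [BorelSpace X]
    {M C : Set X} (hM : IsCompact M) (hC : C ⊆ M) (hconn : IsPreconnected C)
    (hfin : μH[1] C < ∞) (y : ℕ → X) (hy : ∀ n, y n ∈ C) {p : X}
    (hp : Tendsto y atTop (𝓝 p)) {η : ℝ} (hη : 0 < η) (n₀ : ℕ) :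
    ∃ k ≥ n₀, ∀ δ > 0, ∃ l ≤ η + δ, Chn M δ p (y k) l := by
  classical
  have hpM : p ∈ M := hM.isClosed.mem_of_tendsto hp (Eventually.of_forall fun n => hC (hy n))
  set S : Set ℕ := {n | ∃ F : Finset X, (∀ a ∈ F, ∃ k ≥ n₀, y k = a) ∧
    (∀ a ∈ F, ∀ b ∈ F, a ≠ b → ∃ δ > 0, ∀ L, Chn M δ a b L → η < L) ∧ F.card = n} with hS
  have hmono : ∀ {a b : X} {L δ δ' : ℝ}, δ ≤ δ' → Chn M δ a b L → Chn M δ' a b L := by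
    intro a b L δ δ' hle h
    induction h with
    | refl h => exact Chn.refl h
    | step _ h1 h2 ih => exact Chn.step ih h1 (h2.trans hle)
  have hne : S.Nonempty := ⟨0, ∅, by simp⟩
  have hbdd : BddAbove S := by
    obtain ⟨N, hN⟩ := ENNReal.exists_nat_gt
      (ENNReal.div_lt_top hfin.ne (by simpa using hη : ENNReal.ofReal (η / 2) ≠ 0)).ne
    refine ⟨max 1 N, ?_⟩
    rintro n ⟨F, hF1, hF2, rfl⟩
    by_cases h2 : 2 ≤ F.card
    · have : ∃ δ > 0, ∀ a ∈ F, ∀ b ∈ F, a ≠ b → ∀ L, Chn M δ a b L → η < L := by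
        have h3 : ∀ q : X × X, ∃ δ : ℝ, δ > 0 ∧ (q.1 ∈ F → q.2 ∈ F → q.1 ≠ q.2 →
            ∀ L, Chn M δ q.1 q.2 L → η < L) := by
          intro q
          by_cases hq : q.1 ∈ F ∧ q.2 ∈ F ∧ q.1 ≠ q.2
          · obtain ⟨δ, h, h'⟩ := hF2 _ hq.1 _ hq.2.1 hq.2.2
            exact ⟨δ, h, fun _ _ _ => h'⟩
          · exact ⟨1, one_pos, fun a b c => absurd ⟨a, b, c⟩ hq⟩
        choose d d1 d2 using h3
        have hFF : (F ×ˢ F).Nonempty := by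
          have : F.Nonempty := Finset.card_pos.1 (by omega)
          exact this.product this
        obtain ⟨q, hq, hq'⟩ := Finset.exists_min_image (F ×ˢ F) d hFF
        refine ⟨d q, d1 q, fun a ha b hb hab L hL => ?_⟩
        exact d2 (a, b) ha hb hab L (hmono (hq' (a, b) (Finset.mk_mem_product ha hb)) hL)
      obtain ⟨δ, hδ, hsep⟩ := this
      have := separated_card_le hM hC hconn hδ hη F
        (by intro a ha; obtain ⟨k, _, rfl⟩ := hF1 a ha; exact hy k) h2 hsep
      have h4 : (F.card : ℝ≥0∞) ≤ μH[1] C / ENNReal.ofReal (η / 2) := by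
        rwa [ENNReal.le_div_iff_mul_le (Or.inl (by simpa using hη)) (Or.inl ENNReal.ofReal_ne_top)]
      have h5 : (F.card : ℝ≥0∞) < N := h4.trans_lt hN
      have : F.card < N := by exact_mod_cast h5
      exact le_max_of_le_right this.le
    · exact le_max_of_le_left (by omega)
  obtain ⟨F, hF1, hF2, hF3⟩ := Nat.sSup_mem hne hbdd
  have hcov : ∀ m ≥ n₀, ∃ f ∈ F, ∀ δ > 0, ∃ L ≤ η, Chn M δ f (y m) L := by
    intro m hm
    by_contra hcon
    push Not at hcon
    have hnot : y m ∉ F := by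
      intro hmem
      obtain ⟨δ, hδ, h⟩ := hcon _ hmem
      exact h 0 hη.le (Chn.refl (hC (hy m)))
    have : F.card + 1 ∈ S := by
      refine ⟨insert (y m) F, ?_, ?_, Finset.card_insert_of_notMem hnot⟩
      · intro a ha
        rcases Finset.mem_insert.1 ha with rfl | ha
        · exact ⟨m, hm, rfl⟩
        · exact hF1 a ha
      · intro a ha b hb hab
        rcases Finset.mem_insert.1 ha with rfl | ha <;> rcases Finset.mem_insert.1 hb with rfl | hb
        · exact absurd rfl hab
        · obtain ⟨δ, hδ, h⟩ := hcon _ hb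
          exact ⟨δ, hδ, fun L hL => not_le.1 fun hle => h L hle hL.symm⟩
        · obtain ⟨δ, hδ, h⟩ := hcon _ ha
          exact ⟨δ, hδ, fun L hL => not_le.1 fun hle => h L hle hL⟩
        · exact hF2 a ha b hb hab
    have := le_csSup hbdd this
    omega
  have hfreq : ∃ f ∈ F, ∃ᶠ m in atTop, ∀ δ > 0, ∃ L ≤ η, Chn M δ f (y m) L := by
    by_contra hcon
    push Not at hcon
    have h1 : ∀ f ∈ F, ∀ᶠ m in atTop, ¬ ∀ δ > 0, ∃ L ≤ η, Chn M δ f (y m) L :=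
      fun f hf => not_frequently.1 (fun h => by
        have := hcon f hf
        exact absurd h (by simpa using this))
    have h2 := (Filter.eventually_all_finset F).2 h1
    obtain ⟨m, hm, hm'⟩ := (h2.and (eventually_ge_atTop n₀)).exists
    obtain ⟨f, hf, h⟩ := hcov m hm'
    exact hm f hf h
  obtain ⟨f, hf, hfr⟩ := hfreq
  obtain ⟨k, hk, rfl⟩ := hF1 f hf
  refine ⟨k, hk, fun δ hδ => ?_⟩
  obtain ⟨m, hm, hm'⟩ := (hfr.and_eventually (Metric.tendsto_nhds.1 hp δ hδ)).exists
  obtain ⟨L, hL, c⟩ := hm δ hδ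
  refine ⟨_, ?_, (c.trans (Chn.single (hC (hy m)) hpM hm'.le)).symm⟩
  linarith

lemma exists_finite_sphere {X : Type*} [MetricSpace X] [MeasurableSpace X] [BorelSpace X]
    {M : Set X} (hM : μH[2] M < ∞) (x : X) {ε : ℝ} (hε : 0 < ε) :
    ∃ t, 0 < t ∧ t < ε ∧ μH[1] (M ∩ sphere x t) < ∞ := by
  have h0 : ∀ n : ℕ, (0 : ℝ≥0∞) < ((n : ℝ≥0∞) + 1)⁻¹ := fun n => by simp
  have hcov : ∀ n : ℕ, ∃ A : ℕ → Set X, M ⊆ ⋃ i, A i ∧ (∀ i, ediam (A i) ≤ ((n : ℝ≥0∞) + 1)⁻¹) ∧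
      ∑' i, (⨆ _ : (A i).Nonempty, ediam (A i) ^ (2 : ℝ)) < μH[2] M + 1 := by
    intro n
    have h1 : (⨅ (t : ℕ → Set X) (_ : M ⊆ ⋃ n, t n) (_ : ∀ i, ediam (t i) ≤ ((n : ℝ≥0∞) + 1)⁻¹),
          ∑' n, ⨆ _ : (t n).Nonempty, ediam (t n) ^ (2 : ℝ)) < μH[2] M + 1 := by
      refine lt_of_le_of_lt ?_ (ENNReal.lt_add_right hM.ne one_ne_zero)
      conv_rhs => rw [Measure.hausdorffMeasure_apply]
      exact le_iSup₂_of_le (((n : ℝ≥0∞) + 1)⁻¹) (h0 n) le_rfl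
    simp only [iInf_lt_iff] at h1
    obtain ⟨A, a1, a2, a3⟩ := h1
    exact ⟨A, a1, a2, a3⟩
  choose A a1 a2 a3 using hcov
  -- the interval hull of the distances
  have hJ : ∀ n i, ∃ J : Set ℝ, MeasurableSet J ∧ (∀ z ∈ A n i, dist z x ∈ J) ∧
      ediam (A n i) * volume J ≤ ⨆ _ : (A n i).Nonempty, ediam (A n i) ^ (2 : ℝ) := by
    intro n i
    rcases (A n i).eq_empty_or_nonempty with h | h
    · exact ⟨∅, MeasurableSet.empty, by simp [h], by simp⟩
    · set T := (fun z => dist z x) '' A n i with hT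
      have hfin : ediam (A n i) ≠ ∞ := ((a2 n i).trans_lt (by simp)).ne
      have hlip : LipschitzWith 1 (fun z => dist z x) := LipschitzWith.dist_left x
      have hTd : ediam T ≤ ediam (A n i) := by
        simpa using hlip.ediam_image_le (A n i)
      have hTb : Bornology.IsBounded T := by
        rw [Metric.isBounded_iff_ediam_ne_top]
        exact (hTd.trans_lt hfin.lt_top).ne
      refine ⟨Icc (sInf T) (sSup T), measurableSet_Icc, fun z hz => ?_, ?_⟩
      · have : dist z x ∈ T := ⟨z, hz, rfl⟩
        exact ⟨csInf_le hTb.bddBelow this, le_csSup hTb.bddAbove this⟩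
      · rw [Real.volume_Icc, ← Real.ediam_eq hTb, iSup_pos h, ENNReal.rpow_two, sq]
        gcongr
  choose J j1 j2 j3 using hJ
  set G : ℕ → ℝ → ℝ≥0∞ := fun n t => ∑' i, (J n i).indicator (fun _ => ediam (A n i)) t with hG
  have hGm : ∀ n, Measurable (G n) := fun n =>
    Measurable.ennreal_tsum fun i => measurable_const.indicator (j1 n i)
  have hGi : ∀ n, ∫⁻ t, G n t ≤ μH[2] M + 1 := by
    intro n
    rw [lintegral_tsum fun i => (measurable_const.indicator (j1 n i)).aemeasurable]
    refine le_trans (ENNReal.tsum_le_tsum fun i => ?_) (a3 n).le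
    rw [lintegral_indicator_const (j1 n i)]
    exact j3 n i
  have hfatou : ∫⁻ t, liminf (fun n => G n t) atTop < ∞ := by
    refine (lintegral_liminf_le hGm).trans_lt ?_
    refine lt_of_le_of_lt (b := μH[2] M + 1) ?_ (by simp [hM])
    refine (liminf_le_liminf (Eventually.of_forall hGi)).trans ?_
    simp
  have hae := ae_lt_top (Measurable.liminf hGm) hfatou.ne
  have hpos : (volume : Measure ℝ) (Ioo 0 ε) ≠ 0 := by simp [hε]
  obtain ⟨t, ht1, ht2⟩ : ∃ t ∈ Ioo (0 : ℝ) ε, liminf (fun n => G n t) atTop < ∞ := by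
    by_contra hcon
    push Not at hcon
    refine hpos (measure_mono_null ?_ (ae_iff.1 hae))
    intro t ht
    simpa using hcon t ht
  refine ⟨t, ht1.1, ht1.2, lt_of_le_of_lt ?_ ht2⟩
  refine (Measure.hausdorffMeasure_le_liminf_tsum (ι := fun _ : ℕ => ℕ) (l := atTop) 1 _
    (fun n : ℕ => ((n : ℝ≥0∞) + 1)⁻¹) ?_ (fun n i => A n i ∩ sphere x t) ?_ ?_).trans ?_
  · have := ENNReal.tendsto_inv_nat_nhds_zero
    have := (tendsto_add_atTop_iff_nat 1).2 this
    simpa using this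
  · exact Eventually.of_forall fun n i => (ediam_mono inter_subset_left).trans (a2 n i)
  · refine Eventually.of_forall fun n => ?_
    rw [← iUnion_inter]
    exact inter_subset_inter_left _ (a1 n)
  · refine liminf_le_liminf (Eventually.of_forall fun n => ?_)
    refine ENNReal.tsum_le_tsum fun i => ?_
    rw [ENNReal.rpow_one]
    rcases (A n i ∩ sphere x t).eq_empty_or_nonempty with h | ⟨z, hz, hz'⟩
    · simp [h]
    · have : t ∈ J n i := by
        have := j2 n i z hz
        rwa [mem_sphere.1 hz'] at this
      rw [indicator_of_mem this]
      exact ediam_mono inter_subset_left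

lemma const_of_int_mul {Y : Type*} [TopologicalSpace Y] {T : Set Y} (hT : IsPreconnected T)
    {h : Y → ℝ} (hc : ContinuousOn h T) {τ : ℝ} (hi : ∀ z ∈ T, ∃ m : ℤ, h z = m * τ) {p q : Y}
    (hp : p ∈ T) (hq : q ∈ T) : h p = h q := by
  have h1 : (h '' T).Countable := by
    refine (countable_range (fun m : ℤ => (m : ℝ) * τ)).mono ?_
    rintro _ ⟨z, hz, rfl⟩
    obtain ⟨m, hm⟩ := hi z hz
    exact ⟨m, hm.symm⟩
  exact h1.isTotallyDisconnected _ le_rfl (hT.image h hc) ⟨p, hp, rfl⟩ ⟨q, hq, rfl⟩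

lemma continuousAt_indicator_aux {Y : Type*} [TopologicalSpace Y] {W A B : Set Y}
    (hB : IsClosed B) (hA : IsClosed A) (hW : IsOpen W) (hW' : IsOpen ((A ∪ B)ᶜ \ W))
    {φ : Y → ℝ} (hφ : Continuous φ) (hφA : ∀ z ∈ A, φ z = 0) {z : Y} (hz : z ∉ B) :
    ContinuousAt (W.indicator φ) z := by
  by_cases hzA : z ∈ A
  · have h1 : Tendsto φ (𝓝 z) (𝓝 0) := by
      have := hφ.tendsto z
      rwa [hφA z hzA] at this
    have h2 : W.indicator φ z = 0 := by
      by_cases h : z ∈ W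
      · rw [indicator_of_mem h, hφA z hzA]
      · rw [indicator_of_notMem h]
    rw [ContinuousAt, h2]
    refine squeeze_zero_norm (fun y => ?_) (by simpa using h1.norm)
    exact norm_indicator_le_norm_self φ y
  · by_cases h : z ∈ W
    · refine hφ.continuousAt.congr ?_
      filter_upwards [hW.mem_nhds h] with y hy
      rw [indicator_of_mem hy]
    · have : (fun _ => (0 : ℝ)) =ᶠ[𝓝 z] W.indicator φ := by
        filter_upwards [hW'.mem_nhds ⟨by simp [hzA, hz], h⟩] with y hy
        rw [indicator_of_notMem hy.2]
      exact continuousAt_const.congr this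

lemma joinedIn_of_disjoint {Y : Type*} [TopologicalSpace Y] [SimplyConnectedSpace Y]
    [LocallyPathConnectedSpace Y] [NormalSpace Y] {A B : Set Y} (hA : IsClosed A) (hB : IsClosed B)
    (hAB : Disjoint A B) {p q : Y} (h1 : JoinedIn Aᶜ p q) (h2 : JoinedIn Bᶜ p q) :
    JoinedIn (A ∪ B)ᶜ p q := by
  by_contra hcon
  have hpA : p ∉ A := h1.source_mem
  have hpB : p ∉ B := h2.source_mem
  have hopen : IsOpen (A ∪ B)ᶜ := (hA.union hB).isOpen_compl
  set W := pathComponentIn (A ∪ B)ᶜ p with hWdef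
  have hW : IsOpen W := hopen.pathComponentIn p
  have hpW : p ∈ W := mem_pathComponentIn_self (by simp [hpA, hpB])
  have hqW : q ∉ W := hcon
  have hW' : IsOpen ((A ∪ B)ᶜ \ W) := by
    rw [isOpen_iff_mem_nhds]
    rintro z ⟨hz, hzW⟩
    filter_upwards [pathComponentIn_mem_nhds (hopen.mem_nhds hz)] with y hy
    have hy : JoinedIn (A ∪ B)ᶜ z y := hy
    refine ⟨hy.target_mem, fun hyW => hzW ?_⟩
    have hyW : JoinedIn (A ∪ B)ᶜ p y := hyW
    exact hyW.trans hy.symm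
  obtain ⟨φ, φA, φB, -⟩ := exists_continuous_zero_one_of_isClosed hA hB hAB
  set τ : ℝ := 2 * Real.pi with hτ
  have hτ0 : τ ≠ 0 := by positivity
  set ψ : Y → ℝ := W.indicator (fun z => τ * φ z) with hψ
  set χ : Y → ℝ := W.indicator (fun z => τ * (φ z - 1)) with hχ
  have hψc : ∀ z ∉ B, ContinuousAt ψ z := fun z hz =>
    continuousAt_indicator_aux hB hA hW hW' (by fun_prop) (fun z hz => by simp [φA hz]) hz
  have hχc : ∀ z ∉ A, ContinuousAt χ z := fun z hz =>
    continuousAt_indicator_aux hA hB hW (by rwa [union_comm]) (by fun_prop)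
      (fun z hz => by simp [φB hz]) hz
  have heq : ∀ z, Circle.exp (ψ z) = Circle.exp (χ z) := by
    intro z
    rw [Circle.exp_eq_exp]
    by_cases hz : z ∈ W
    · exact ⟨1, by simp only [hψ, hχ, indicator_of_mem hz]; push_cast; ring⟩
    · exact ⟨0, by simp only [hψ, hχ, indicator_of_notMem hz]; simp⟩
  have hFc : Continuous (fun z => Circle.exp (ψ z)) := by
    rw [continuous_iff_continuousAt]
    intro z
    by_cases hz : z ∈ B
    · have hzA : z ∉ A := fun h => Set.disjoint_left.1 hAB h hz
      simp only [heq]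
      exact Circle.exp.continuous.continuousAt.comp (hχc z hzA)
    · exact Circle.exp.continuous.continuousAt.comp (hψc z hz)
  obtain ⟨F, ⟨-, hF⟩, -⟩ := Circle.isCoveringMap_exp.existsUnique_continuousMap_lifts
    ⟨_, hFc⟩ p (ψ p) rfl
  have hF : ∀ z, Circle.exp (F z) = Circle.exp (ψ z) := fun z => congrFun hF z
  obtain ⟨γ1, hγ1⟩ := h1
  obtain ⟨γ2, hγ2⟩ := h2
  have e2 : F p - ψ p = F q - ψ q := by
    refine const_of_int_mul (T := range γ2) (h := fun z => F z - ψ z) (τ := τ)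
      (isPreconnected_range γ2.continuous) ?_ ?_ ⟨0, by simp⟩ ⟨1, by simp⟩
    · rintro _ ⟨s, rfl⟩
      exact (F.continuous.continuousAt.sub (hψc _ (hγ2 s))).continuousWithinAt
    · intro z _
      obtain ⟨m, hm⟩ := Circle.exp_eq_exp.1 (hF z)
      exact ⟨m, by rw [hm]; ring⟩
  have e1 : F p - χ p = F q - χ q := by
    refine const_of_int_mul (T := range γ1) (h := fun z => F z - χ z) (τ := τ)
      (isPreconnected_range γ1.continuous) ?_ ?_ ⟨0, by simp⟩ ⟨1, by simp⟩
    · rintro _ ⟨s, rfl⟩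
      exact (F.continuous.continuousAt.sub (hχc _ (hγ1 s))).continuousWithinAt
    · intro z _
      obtain ⟨m, hm⟩ := Circle.exp_eq_exp.1 ((hF z).trans (heq z))
      exact ⟨m, by rw [hm]; ring⟩
  simp only [hψ, hχ, indicator_of_mem hpW, indicator_of_notMem hqW] at e1 e2
  apply hτ0
  linarith

lemma exists_connected_separator {Y : Type*} [TopologicalSpace Y] [SimplyConnectedSpace Y]
    [LocallyPathConnectedSpace Y] [NormalSpace Y] {K : Set Y} (hK : IsClosed K) {p q : Y}
    (hsep : ¬ JoinedIn Kᶜ p q) :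
    ∃ C ⊆ K, IsClosed C ∧ IsPreconnected C ∧ ¬ JoinedIn Cᶜ p q := by
  obtain ⟨C, hCK, hmin⟩ := zorn_superset_nonempty {C : Set Y | IsClosed C ∧ ¬ JoinedIn Cᶜ p q} (by
    intro c hc hchain hne
    refine ⟨⋂₀ c, ⟨isClosed_sInter fun s hs => (hc hs).1, ?_⟩, fun s hs => sInter_subset_of_mem hs⟩
    rintro ⟨γ, hγ⟩
    have hcomp : IsCompact (range γ) := isCompact_range γ.continuous
    haveI : Nonempty c := hne.to_subtype
    obtain ⟨s, hs⟩ := hcomp.elim_directed_family_closed (fun s : c => (s : Set Y))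
      (fun s => (hc s.2).1) (by
        rw [← sInter_eq_iInter, ← disjoint_iff_inter_eq_empty, Set.disjoint_left]
        rintro _ ⟨t, rfl⟩
        exact hγ t) (by
        intro s t
        rcases hchain.total s.2 t.2 with h | h
        · exact ⟨s, le_rfl, h⟩
        · exact ⟨t, h, le_rfl⟩)
    rw [← disjoint_iff_inter_eq_empty, Set.disjoint_left] at hs
    exact (hc s.2).2 ⟨γ, fun t ht => hs ⟨t, rfl⟩ ht⟩) K ⟨hK, hsep⟩
  refine ⟨C, hCK, hmin.prop.1, ?_, hmin.prop.2⟩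
  rw [isPreconnected_closed_iff]
  intro t t' ht ht' hsub hn hn'
  by_contra hemp
  rw [not_nonempty_iff_eq_empty] at hemp
  have hdis : Disjoint (C ∩ t) (C ∩ t') := by
    rw [Set.disjoint_left]
    rintro z ⟨hz, h1⟩ ⟨_, h2⟩
    exact (hemp ▸ (⟨hz, h1, h2⟩ : z ∈ C ∩ (t ∩ t')) : z ∈ (∅ : Set Y))
  have hun : C ∩ t ∪ C ∩ t' = C := by
    rw [← inter_union_distrib_left]; exact inter_eq_left.2 hsub
  have hcl := hmin.prop.1.inter ht
  have hcl' := hmin.prop.1.inter ht'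
  by_cases j1 : JoinedIn (C ∩ t)ᶜ p q
  · by_cases j2 : JoinedIn (C ∩ t')ᶜ p q
    · have := joinedIn_of_disjoint hcl hcl' hdis j1 j2
      rw [hun] at this
      exact hmin.prop.2 this
    · have := hmin.le_of_le (y := C ∩ t') ⟨hcl', j2⟩ inter_subset_left
      obtain ⟨z, hz⟩ := hn
      exact Set.disjoint_left.1 hdis hz (this hz.1)
  · have := hmin.le_of_le (y := C ∩ t) ⟨hcl, j1⟩ inter_subset_left
    obtain ⟨z, hz⟩ := hn'
    exact Set.disjoint_left.1 hdis (this hz.1) hz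

lemma exists_nice_nhd {X : Type*} [MetricSpace X] (hX : IsMetricSurface X) (x : X) :
    ∃ (Y : Type) (_ : TopologicalSpace Y) (_ : SimplyConnectedSpace Y)
      (_ : LocallyPathConnectedSpace Y) (_ : NormalSpace Y) (e : Y → X),
      IsOpenEmbedding e ∧ x ∈ range e := by
  obtain ⟨_⟩ := hX
  let H := EuclideanHalfSpace 2
  let c : OpenPartialHomeomorph X H := chartAt H x
  have ht : c.target ∈ 𝓝 (c x) := c.open_target.mem_nhds (c.map_source (mem_chart_source H x))
  have hval : IsInducing (Subtype.val : H → EuclideanSpace ℝ (Fin 2)) := IsInducing.subtypeVal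
  rw [hval.nhds_eq_comap, Metric.nhds_basis_ball.comap _ |>.mem_iff] at ht
  obtain ⟨r, hr, hsub⟩ := ht
  let D : Set (EuclideanSpace ℝ (Fin 2)) := {v | 0 ≤ v 0} ∩ ball (c x).1 r
  have hD : Convex ℝ D := EuclideanHalfSpace.convex.inter (convex_ball _ _)
  have hxD : (c x).1 ∈ D := ⟨(c x).2, mem_ball_self hr⟩
  have : ContractibleSpace D := hD.contractibleSpace ⟨_, hxD⟩
  have : LocallyPathConnectedSpace D := hD.locallyPathConnectedSpace
  let j : D → H := fun v => ⟨v.1, v.2.1⟩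
  have hjc : Continuous j := continuous_subtype_val.subtype_mk _
  have hji : IsInducing j := by
    refine IsInducing.of_comp hjc hval.continuous ?_
    exact IsInducing.subtypeVal
  have hjr : range j = Subtype.val ⁻¹' (ball (c x).1 r) := by
    ext v
    constructor
    · rintro ⟨w, rfl⟩; exact w.2.2
    · intro hv; exact ⟨⟨v.1, v.2, hv⟩, rfl⟩
  have hj : IsOpenEmbedding j := by
    refine ⟨⟨hji, fun a b h => ?_⟩, ?_⟩
    · have : a.1 = b.1 := congrArg (fun v : EuclideanHalfSpace 2 => v.1) h
      exact Subtype.ext this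
    · rw [hjr]; exact isOpen_ball.preimage hval.continuous
  have hmem : ∀ v, j v ∈ c.target := fun v => hsub (hjr ▸ mem_range_self v)
  refine ⟨D, inferInstance, inferInstance, inferInstance, inferInstance,
    fun v => c.symm (j v), ?_, ⟨⟨_, hxD⟩, ?_⟩⟩
  · have h1 : IsOpenEmbedding (c.target.domRestrict c.symm) := by
      exact c.symm.isOpenEmbedding_restrict
    have h2 : IsOpenEmbedding (fun v => (⟨j v, hmem v⟩ : c.target)) := by
      refine IsOpenEmbedding.of_comp _ c.open_target.isOpenEmbedding_subtypeVal ?_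
      exact hj
    exact h1.comp h2
  · exact c.left_inv (mem_chart_source H x)

lemma separation {X : Type*} [MetricSpace X] {Y : Type*} [TopologicalSpace Y]
    [SimplyConnectedSpace Y] [LocallyPathConnectedSpace Y] [NormalSpace Y] {e : Y → X}
    (he : IsOpenEmbedding e) {x z : X} {M : Set X} (hMe : M ⊆ range e) {t : ℝ} (ht : 0 < t)
    (hx : x ∈ M) (hz : z ∈ M) (hxz : t < dist z x) :
    ∃ C ⊆ sphere x t, IsPreconnected C ∧
      ∀ᶠ w : X × X in 𝓝 x ×ˢ 𝓝 z, ¬ JoinedIn (M \ C) w.1 w.2 := by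
  obtain ⟨p, rfl⟩ := hMe hx
  obtain ⟨q, rfl⟩ := hMe hz
  have hc : Continuous fun y => dist (e y) (e p) := he.continuous.dist continuous_const
  have hK : IsClosed (e ⁻¹' sphere (e p) t) := isClosed_sphere.preimage he.continuous
  have hpK : p ∉ e ⁻¹' sphere (e p) t := by simp [ht.ne]
  have hqK : q ∉ e ⁻¹' sphere (e p) t := by simp [hxz.ne']
  have hsep : ¬ JoinedIn (e ⁻¹' sphere (e p) t)ᶜ p q := by
    rintro ⟨γ, hγ⟩
    have h1 : Continuous fun s => dist (e (γ s)) (e p) := hc.comp γ.continuous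
    have := mem_range_of_exists_le_of_exists_ge h1 (c := t) ⟨0, by simp [ht.le]⟩
      ⟨1, by simp [hxz.le]⟩
    obtain ⟨s, hs⟩ := this
    exact hγ s hs
  obtain ⟨C, hCK, hCc, hCp, hCs⟩ := exists_connected_separator hK hsep
  refine ⟨e '' C, ?_, hCp.image e he.continuous.continuousOn, ?_⟩
  · rintro _ ⟨y, hy, rfl⟩; exact hCK hy
  have n1 : e '' pathComponentIn Cᶜ p ∈ 𝓝 (e p) := he.isOpenMap.image_mem_nhds
    (pathComponentIn_mem_nhds (hCc.isOpen_compl.mem_nhds fun h => hpK (hCK h)))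
  have n2 : e '' pathComponentIn Cᶜ q ∈ 𝓝 (e q) := he.isOpenMap.image_mem_nhds
    (pathComponentIn_mem_nhds (hCc.isOpen_compl.mem_nhds fun h => hqK (hCK h)))
  filter_upwards [prod_mem_prod n1 n2]
  rintro ⟨_, _⟩ ⟨⟨a, ha, rfl⟩, ⟨b, hb, rfl⟩⟩ hj
  have ha : JoinedIn Cᶜ p a := ha
  have hb : JoinedIn Cᶜ q b := hb
  dsimp only at hj
  have hj2 : JoinedIn (e '' Cᶜ) (e a) (e b) := by
    refine hj.mono ?_
    rintro y ⟨hyM, hyC⟩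
    obtain ⟨y, rfl⟩ := hMe hyM
    exact ⟨y, fun h => hyC ⟨y, h, rfl⟩, rfl⟩
  rw [he.isInducing.joinedIn_image ha.target_mem hb.target_mem] at hj2
  exact hCs ((ha.trans hj2).trans hb.symm)

section extd
variable {X : Type*} [MetricSpace X]

lemma extDist_le_Icc {g : ℝ → X} {a b : ℝ} (hab : a ≤ b) (hg : ContinuousOn g (Icc a b)) :
    extDist (g a) (g b) ≤ eVariationOn g (Icc a b) := by
  set φ : I → ℝ := fun t => a + t * (b - a) with hφ
  have hm : ∀ t, φ t ∈ Icc a b := fun t => by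
    have h0 := t.2.1
    have h1 := t.2.2
    constructor <;> simp only [hφ] <;> nlinarith
  have hmono : Monotone φ := fun s t h => by
    have h : (s : ℝ) ≤ t := h
    simp only [hφ]; nlinarith
  have key : extDist (g a) (g b) ≤ curveLength (g ∘ φ) := by
    unfold extDist
    refine iInf_le_of_le _ (iInf_le_of_le ?_ (iInf_le_of_le (by simp [hφ])
      (iInf_le_of_le (by simp [hφ]) le_rfl)))
    exact hg.comp_continuous (by fun_prop) hm
  exact key.trans (eVariationOn.comp_le_of_monotoneOn g φ (hmono.monotoneOn _) fun t _ => hm t)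

lemma exists_curve {x y : X} {c : ℝ≥0∞} (h : extDist x y < c) :
    ∃ g : ℝ → X, Continuous g ∧ g 0 = x ∧ g 1 = y ∧ eVariationOn g (Icc 0 1) < c := by
  unfold extDist at h
  simp only [iInf_lt_iff] at h
  obtain ⟨γ, h1, h2, h3, h4⟩ := h
  refine ⟨IccExtend zero_le_one γ, h1.Icc_extend', ?_, ?_, lt_of_le_of_lt ?_ h4⟩
  · rw [← h2]; simp
  · rw [← h3]; simp
  · exact eVariationOn.comp_le_of_monotoneOn γ (projIcc 0 1 zero_le_one)
      ((monotone_projIcc _).monotoneOn _) fun _ _ => trivial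

lemma extDist_self (x : X) : extDist x x = 0 := by
  have := extDist_le_Icc (g := fun _ : ℝ => x) (zero_le_one) continuousOn_const
  refine le_antisymm (this.trans (le_of_eq ?_)) bot_le
  exact eVariationOn.constant_on (by rintro _ ⟨_, _, rfl⟩ _ ⟨_, _, rfl⟩; rfl)

lemma extDist_triangle (x y z : X) : extDist x z ≤ extDist x y + extDist y z := by
  refine ENNReal.le_of_forall_pos_le_add fun ε hε hfin => ?_
  obtain ⟨hf1, hf2⟩ := ENNReal.add_lt_top.1 hfin
  have hε2 : ((ε / 2 : ℝ≥0) : ℝ≥0∞) ≠ 0 := by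
    have := (half_pos hε).ne'
    exact_mod_cast this
  obtain ⟨g, g1, g2, g3, g4⟩ := exists_curve (ENNReal.lt_add_right hf1.ne hε2)
  obtain ⟨k, k1, k2, k3, k4⟩ := exists_curve (ENNReal.lt_add_right hf2.ne hε2)
  set h : ℝ → X := fun t => if t ≤ 1 then g t else k (t - 1) with hh
  have hc : Continuous h := by
    refine Continuous.if_le g1 (by fun_prop) continuous_id continuous_const ?_
    intro t ht
    have : t = 1 := ht
    rw [this, sub_self, g3, k2]
  have h0 : h 0 = x := by simp [hh, g2]
  have h2 : h 2 = z := by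
    simp only [hh]; rw [if_neg (by norm_num)]; norm_num [k3]
  have e1 : eVariationOn h (Icc 0 1) = eVariationOn g (Icc 0 1) :=
    eVariationOn.congr fun t ht => by simp [hh, ht.2]
  have e2 : eVariationOn h (Icc 1 2) ≤ eVariationOn k (Icc 0 1) := by
    have : eVariationOn h (Icc 1 2) = eVariationOn (k ∘ fun t => t - 1) (Icc 1 2) := by
      refine eVariationOn.congr fun t ht => ?_
      simp only [hh, Function.comp]
      split_ifs with ht1
      · have : t = 1 := le_antisymm ht1 ht.1
        rw [this, sub_self, g3, k2]
      · rfl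
    rw [this]
    refine eVariationOn.comp_le_of_monotoneOn k _ (fun s _ t _ h => by linarith) ?_
    intro t ht
    constructor <;> dsimp only <;> linarith [ht.1, ht.2]
  have e3 : eVariationOn h (Icc 0 2) = eVariationOn h (Icc 0 1) + eVariationOn h (Icc 1 2) := by
    have := eVariationOn.Icc_add_Icc h (s := univ) (zero_le_one' ℝ) one_le_two trivial
    simpa using this.symm
  have := extDist_le_Icc (g := h) (zero_le_two) hc.continuousOn
  rw [h0, h2, e3] at this
  refine this.trans ?_
  rw [e1]
  refine (add_le_add g4.le (e2.trans k4.le)).trans (le_of_eq ?_)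
  have : (ε : ℝ≥0∞) = ((ε / 2 : ℝ≥0) : ℝ≥0∞) + ((ε / 2 : ℝ≥0) : ℝ≥0∞) := by
    rw [← ENNReal.coe_add, add_halves]
  rw [this]
  abel

lemma chn_of_curve {M : Set X} {g : ℝ → X} {a b : ℝ} (hab : a ≤ b)
    (hg : ContinuousOn g (Icc a b)) (hM : ∀ s ∈ Icc a b, g s ∈ M) {L : ℝ} (hL : 0 ≤ L)
    (hv : eVariationOn g (Icc a b) ≤ ENNReal.ofReal L) {δ : ℝ} (hδ : 0 < δ) :
    ∃ l ≤ L, Chn M δ (g a) (g b) l := by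
  obtain ⟨η, hη, hunif⟩ := Metric.uniformContinuousOn_iff.1
    (isCompact_Icc.uniformContinuousOn_of_continuous hg) δ hδ
  obtain ⟨m, hm⟩ := exists_nat_gt ((b - a) / η)
  have hm0 : (0 : ℝ) < m := lt_of_le_of_lt (div_nonneg (by linarith) hη.le) hm
  set u : ℕ → ℝ := fun i => a + (b - a) * (i / m) with hu
  have hum : Monotone u := by
    intro i j hij
    have : (i : ℝ) ≤ j := by exact_mod_cast hij
    have hba : 0 ≤ b - a := by linarith
    simp only [hu]; gcongr
  have hu0 : u 0 = a := by simp [hu]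
  have hum' : u m = b := by simp [hu, hm0.ne']
  have hmem : ∀ i ≤ m, u i ∈ Icc a b := fun i hi =>
    ⟨hu0 ▸ hum (Nat.zero_le i), hum' ▸ hum hi⟩
  have hstep : ∀ i < m, dist (g (u i)) (g (u (i + 1))) < δ := by
    intro i hi
    refine hunif _ (hmem i hi.le) _ (hmem (i + 1) hi) ?_
    have : u (i + 1) - u i = (b - a) / m := by simp only [hu]; push_cast; field_simp; ring
    rw [dist_comm, Real.dist_eq, this, abs_of_nonneg (div_nonneg (by linarith) hm0.le)]
    rw [div_lt_iff₀ hη] at hm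
    rw [div_lt_iff₀ hm0]
    linarith
  have hch : ∀ i ≤ m, Chn M δ (g a) (g (u i))
      (∑ j ∈ Finset.range i, dist (g (u j)) (g (u (j + 1)))) := by
    intro i
    induction i with
    | zero => intro _; simp only [hu0, Finset.range_zero, Finset.sum_empty]
              exact Chn.refl (hM a ⟨le_rfl, hab⟩)
    | succ i ih =>
      intro hi
      rw [Finset.sum_range_succ]
      exact Chn.step (ih (by omega)) (hM _ (hmem _ hi)) (hstep i (by omega)).le
  refine ⟨_, ?_, hum' ▸ hch m le_rfl⟩
  have := eVariationOn.sum_le_of_monotoneOn_Iic (f := g) (s := Icc a b) (n := m) (u := u)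
    (hum.monotoneOn _) (fun i hi => hmem i hi)
  have h3 := this.trans hv
  rw [← ENNReal.ofReal_le_ofReal_iff hL, ENNReal.ofReal_sum_of_nonneg (fun _ _ => dist_nonneg)]
  refine le_trans (le_of_eq ?_) h3
  refine Finset.sum_congr rfl fun j _ => ?_
  rw [edist_comm, edist_dist]

end extd

lemma extDist_le_of_frequently {X : Type*} [MetricSpace X] [MeasurableSpace X] [BorelSpace X]
    (hX : IsMetricSurface X) (hloc : IsLocallyFiniteMeasure (mu2 X)) (x₀ x : X) (c : ℝ≥0∞)
    (hfreq : ∃ᶠ w in 𝓝 x, extDist w x₀ ≤ c) : extDist x x₀ ≤ c := by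
  rcases eq_or_ne c ∞ with rfl | hc
  · exact le_top
  rcases eq_or_ne x x₀ with rfl | hne
  · rw [extDist_self]; exact bot_le
  obtain ⟨Y, _, _, _, _, e, he, hxe⟩ := exists_nice_nhd hX x
  have hlc : LocallyCompactSpace X := by
    obtain ⟨_⟩ := hX
    have hcl : IsClosed {v : EuclideanSpace ℝ (Fin 2) | 0 ≤ v 0} :=
      isClosed_le continuous_const (by fun_prop)
    have : LocallyCompactSpace (EuclideanHalfSpace 2) :=
      hcl.isClosedEmbedding_subtypeVal.locallyCompactSpace
    exact ChartedSpace.locallyCompactSpace (EuclideanHalfSpace 2) X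
  obtain ⟨K, hK, hKx⟩ := exists_compact_mem_nhds x
  obtain ⟨U, hUx, hU⟩ := hloc.finiteAtNhds x
  have hU2 : μH[2] U < ∞ := by
    rw [mu2, Measure.smul_apply, smul_eq_mul] at hU
    have h0 : ENNReal.ofReal (Real.pi / 4) ≠ 0 := by
      simp [Real.pi_pos]
    by_contra hcon
    rw [not_lt, top_le_iff] at hcon
    rw [hcon, ENNReal.mul_top h0] at hU
    exact lt_irrefl _ hU
  obtain ⟨ε', hε', hsub⟩ := Metric.nhds_basis_closedBall.mem_iff.1
    (inter_mem (inter_mem (he.isOpen_range.mem_nhds hxe) hKx) hUx)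
  have hdpos : 0 < dist x x₀ := dist_pos.2 hne
  set ε := min ε' (dist x x₀) with hεdef
  have hε : 0 < ε := lt_min hε' hdpos
  set M := closedBall x ε with hMdef
  have hMsub : M ⊆ closedBall x ε' := closedBall_subset_closedBall (min_le_left _ _)
  have hMe : M ⊆ range e := fun y hy => (hsub (hMsub hy)).1.1
  have hM : IsCompact M := hK.of_isClosed_subset isClosed_closedBall
    fun y hy => (hsub (hMsub hy)).1.2
  have hM2 : μH[2] M < ∞ := (measure_mono fun y hy => (hsub (hMsub hy)).2).trans_lt hU2
  have hxM : x ∈ M := mem_closedBall_self hε.le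
  obtain ⟨t, ht0, htε, htfin⟩ := exists_finite_sphere hM2 x hε
  have hsphM : sphere x t ⊆ M := sphere_subset_closedBall.trans
    (closedBall_subset_closedBall htε.le)
  rw [inter_eq_right.2 hsphM] at htfin
  -- the sequence
  obtain ⟨xs, hxs, hxs2⟩ := exists_seq_forall_of_frequently
    (hfreq.and_eventually (ball_mem_nhds x hε))
  have hcurve : ∀ n : ℕ, ∃ (g : ℝ → X) (s : ℝ), Continuous g ∧ g 0 = xs n ∧ g 1 = x₀ ∧
      eVariationOn g (Icc 0 1) < c + ((n : ℝ≥0∞) + 1)⁻¹ ∧ s ∈ Icc (0 : ℝ) 1 ∧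
      dist (g s) x = ε ∧ ∀ r ∈ Icc 0 s, g r ∈ M := by
    intro n
    obtain ⟨g, g1, g2, g3, g4⟩ := exists_curve (lt_of_le_of_lt (hxs2 n).1
      (ENNReal.lt_add_right hc (by simp : ((n : ℝ≥0∞) + 1)⁻¹ ≠ 0)))
    have hgd : Continuous fun r => dist (g r) x := g1.dist continuous_const
    have hcomp : IsCompact (Icc (0 : ℝ) 1 ∩ {r | ε ≤ dist (g r) x}) :=
      isCompact_Icc.inter_right (isClosed_le continuous_const hgd)
    obtain ⟨s, ⟨hs1, hs2⟩, hs3⟩ := hcomp.exists_isLeast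
      ⟨1, ⟨zero_le_one, le_rfl⟩, by
        show ε ≤ dist (g 1) x
        rw [g3, dist_comm]; exact min_le_right _ _⟩
    have hd0 : dist (g 0) x < ε := by rw [g2]; exact (hxs2 n).2
    have hds : dist (g s) x = ε := by
      obtain ⟨r, hr, hr2⟩ := intermediate_value_Icc hs1.1 hgd.continuousOn
        (⟨hd0.le, hs2⟩ : ε ∈ Icc _ _)
      have : s ≤ r := hs3 ⟨⟨hr.1, hr.2.trans hs1.2⟩, hr2.ge⟩
      rwa [le_antisymm hr.2 this] at hr2
    refine ⟨g, s, g1, g2, g3, g4, hs1, hds, fun r hr => ?_⟩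
    by_contra hcon
    have hr2 : ε < dist (g r) x := not_le.1 hcon
    have : s ≤ r := hs3 ⟨⟨hr.1, hr.2.trans hs1.2⟩, hr2.le⟩
    rw [le_antisymm hr.2 this, hds] at hr2
    exact lt_irrefl _ hr2
  choose g s g1 g2 g3 g4 s1 s2 s3 using hcurve
  obtain ⟨z, hzM, φ, hφ, hz⟩ := hM.tendsto_subseq (x := fun n => g n (s n))
    (fun n => s3 n _ ⟨(s1 n).1, le_rfl⟩)
  have hzd : dist z x = ε := by
    refine tendsto_nhds_unique (hz.dist tendsto_const_nhds) ?_
    simp only [Function.comp, s2]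
    exact tendsto_const_nhds
  obtain ⟨C, hCs, hCp, hCsep⟩ := separation he hMe ht0 hxM hzM (hzd ▸ htε)
  have hCM : C ⊆ M := hCs.trans hsphM
  have hCfin : μH[1] C < ∞ := (measure_mono hCs).trans_lt htfin
  have hev := ((hxs.comp hφ.tendsto_atTop).prodMk hz).eventually hCsep
  obtain ⟨N, hN⟩ := eventually_atTop.1 hev
  have hhit : ∀ n, ∃ r ∈ Icc 0 (s (φ (n + N))), g (φ (n + N)) r ∈ C := by
    intro n
    by_contra hcon
    push Not at hcon
    refine hN (n + N) (by omega) ?_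
    set m := φ (n + N)
    have hpc : IsPathConnected (g m '' Icc 0 (s m)) :=
      ((convex_Icc _ _).isPathConnected ⟨0, le_rfl, (s1 m).1⟩).image (g1 m)
    have := hpc.joinedIn (g m 0) ⟨0, ⟨le_rfl, (s1 m).1⟩, rfl⟩ (g m (s m))
      ⟨s m, ⟨(s1 m).1, le_rfl⟩, rfl⟩
    rw [g2 m] at this
    refine this.mono ?_
    rintro _ ⟨r, hr, rfl⟩
    exact ⟨s3 m r hr, hcon r hr⟩
  choose r r1 r2 using hhit
  obtain ⟨⟨y, a⟩, hya, ψ, hψ, hlim⟩ := (hM.prod (isCompact_univ (X := ℝ≥0∞))).tendsto_subseq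
    (x := fun n => (g (φ (n + N)) (r n), eVariationOn (g (φ (n + N))) (Icc 0 (r n))))
    (fun n => ⟨hCM (r2 n), trivial⟩)
  set sg : ℕ → ℕ := fun k => φ (ψ k + N) with hsg
  have hsgt : Tendsto sg atTop atTop :=
    hφ.tendsto_atTop.comp ((tendsto_add_atTop_nat N).comp hψ.tendsto_atTop)
  set ys : ℕ → X := fun k => g (sg k) (r (ψ k)) with hys
  set as : ℕ → ℝ≥0∞ := fun k => eVariationOn (g (sg k)) (Icc 0 (r (ψ k))) with has
  set bs : ℕ → ℝ≥0∞ := fun k => eVariationOn (g (sg k)) (Icc (r (ψ k)) 1) with hbs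
  have hyt : Tendsto ys atTop (𝓝 y) := (continuous_fst.tendsto _).comp hlim
  have hat : Tendsto as atTop (𝓝 a) := (continuous_snd.tendsto _).comp hlim
  have hyC : ∀ k, ys k ∈ C := fun k => r2 (ψ k)
  have hyM : y ∈ M := hya.1
  have hr01 : ∀ k, r (ψ k) ∈ Icc (0 : ℝ) 1 := fun k =>
    ⟨(r1 (ψ k)).1, (r1 (ψ k)).2.trans (s1 _).2⟩
  have hab : ∀ k, as k + bs k < c + ((sg k : ℝ≥0∞) + 1)⁻¹ := by
    intro k
    have := eVariationOn.Icc_add_Icc (g (sg k)) (s := univ) (hr01 k).1 (hr01 k).2 trivial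
    simp only [univ_inter] at this
    rw [has, hbs]
    dsimp only
    rw [this]
    exact g4 (sg k)
  have hbd : ∀ k, extDist (ys k) x₀ ≤ bs k := by
    intro k
    have := extDist_le_Icc (hr01 k).2 (g1 (sg k)).continuousOn
    rwa [g3] at this
  have hinv : Tendsto (fun k => ((sg k : ℝ≥0∞) + 1)⁻¹) atTop (𝓝 0) := by
    have h1 := (tendsto_add_atTop_iff_nat 1).2 ENNReal.tendsto_inv_nat_nhds_zero
    have h2 : Tendsto (fun n : ℕ => ((n : ℝ≥0∞) + 1)⁻¹) atTop (𝓝 0) := by simpa using h1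
    exact h2.comp hsgt
  have hafin : a ≠ ∞ := by
    have : a ≤ c + 1 := by
      refine le_of_tendsto' hat fun k => ?_
      refine (le_self_add.trans (hab k).le).trans ?_
      gcongr
      simp
    exact (this.trans_lt (by simp [hc.lt_top])).ne
  refine ENNReal.le_of_forall_pos_le_add fun η hη _ => ?_
  set ζ : ℝ≥0 := η / 4 with hζ
  have hζ0 : 0 < ζ := by positivity
  have hζ' : (0 : ℝ≥0∞) < ζ := by exact_mod_cast hζ0
  have ev1 : ∀ᶠ k in atTop, as k ≤ a + ζ :=
    (hat.eventually (gt_mem_nhds (ENNReal.lt_add_right hafin hζ'.ne'))).mono fun k h => h.le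
  have ev2 : ∀ᶠ k in atTop, a ≤ as k + ζ := by
    have := (hat.add (tendsto_const_nhds (x := (ζ : ℝ≥0∞)))).eventually
      (lt_mem_nhds (ENNReal.lt_add_right hafin hζ'.ne'))
    exact this.mono fun k h => h.le
  have ev3 : ∀ᶠ k in atTop, ((sg k : ℝ≥0∞) + 1)⁻¹ ≤ ζ :=
    (hinv.eventually (gt_mem_nhds hζ')).mono fun k h => h.le
  obtain ⟨N1, hN1⟩ := eventually_atTop.1 ((ev1.and ev2).and ev3)
  -- first part
  have part1 : extDist x y ≤ a + ζ := by
    have hfin : a + ζ ≠ ∞ := by simp [hafin]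
    rw [← ENNReal.ofReal_toReal hfin]
    refine extDist_le_of_chains hM ENNReal.toReal_nonneg fun δ hδ => ?_
    have hx1 : ∀ᶠ k in atTop, dist (xs (sg k)) x < δ / 2 :=
      Metric.tendsto_nhds.1 (hxs.comp hsgt) _ (half_pos hδ)
    have hy1 : ∀ᶠ k in atTop, dist (ys k) y < δ / 2 := Metric.tendsto_nhds.1 hyt _ (half_pos hδ)
    obtain ⟨k, ⟨hk1, hk2⟩, hk3⟩ := ((hx1.and hy1).and ev1).exists
    obtain ⟨l, hl, hch⟩ := chn_of_curve (M := M) (hr01 k).1 (g1 (sg k)).continuousOn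
      (fun q hq => s3 (sg k) q ⟨hq.1, hq.2.trans (r1 (ψ k)).2⟩)
      (ENNReal.toReal_nonneg (a := a + ζ)) (by rw [ENNReal.ofReal_toReal hfin]; exact hk3) hδ
    rw [g2] at hch
    have c1 : Chn M δ x (xs (sg k)) (dist x (xs (sg k))) :=
      Chn.single hxM hch.mem_left (by rw [dist_comm]; linarith)
    have c2 : Chn M δ (ys k) y (dist (ys k) y) :=
      Chn.single (hCM (hyC k)) hyM (by linarith)
    refine ⟨_, ?_, (c1.trans hch).trans c2⟩
    rw [dist_comm x]
    linarith
  obtain ⟨k, hk, hkc⟩ := exists_close_chain hM hCM hCp hCfin ys hyC hyt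
    (η := (ζ : ℝ)) (by exact_mod_cast hζ0) N1
  have part2 : extDist y (ys k) ≤ ζ := by
    have := extDist_le_of_chains hM ζ.2 hkc
    simpa using this
  obtain ⟨⟨k1, k2⟩, k3⟩ := hN1 k hk
  calc extDist x x₀ ≤ extDist x y + extDist y x₀ := extDist_triangle _ _ _
    _ ≤ extDist x y + (extDist y (ys k) + extDist (ys k) x₀) := by
        gcongr; exact extDist_triangle _ _ _
    _ ≤ (a + ζ) + (ζ + bs k) := by
        gcongr; exact hbd k
    _ ≤ ((as k + ζ) + ζ) + (ζ + bs k) := by gcongr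
    _ = (as k + bs k) + (ζ + ζ + ζ) := by abel
    _ ≤ (c + ζ) + (ζ + ζ + ζ) := by
        refine add_le_add ((hab k).le.trans ?_) le_rfl
        exact add_le_add le_rfl k3
    _ = c + η := by
        have : (η : ℝ≥0∞) = ζ + ζ + ζ + ζ := by
          rw [← ENNReal.coe_add, ← ENNReal.coe_add, ← ENNReal.coe_add]
          congr 1
          rw [hζ]
          ext; push_cast; ring
        rw [this]; abel

lemma mem_closure_ball_of_eq {X : Type*} [MetricSpace X] (x₀ x : X) (r : ℝ≥0∞) (hr : 0 < r)
    (hr' : r ≠ ∞) (h : extDist x x₀ ≤ r) : x ∈ closure {w : X | extDist w x₀ < r} := by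
  rcases eq_or_ne x x₀ with rfl | hne
  · exact subset_closure (by simpa [extDist_self] using hr)
  rw [Metric.mem_closure_iff]
  intro ε hε
  have hdpos : 0 < dist x x₀ := dist_pos.2 hne
  set ρ := min (ε / 2) (dist x x₀) with hρ
  have hρ0 : 0 < ρ := lt_min (half_pos hε) hdpos
  have hρ' : ENNReal.ofReal ρ ≠ 0 := by simpa using hρ0
  obtain ⟨g, g1, g2, g3, g4⟩ := exists_curve (lt_of_le_of_lt h (ENNReal.lt_add_right hr' hρ'))
  have hgd : Continuous fun t => dist (g t) x := g1.dist continuous_const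
  obtain ⟨s, hs, hs2⟩ := intermediate_value_Icc zero_le_one hgd.continuousOn
    (⟨by simpa [g2] using hρ0.le, by rw [g3, dist_comm]; exact min_le_right _ _⟩ : ρ ∈ Icc _ _)
  refine ⟨g s, ?_, ?_⟩
  · have h1 := extDist_le_Icc hs.2 g1.continuousOn
    rw [g3] at h1
    have h2 := eVariationOn.Icc_add_Icc g (s := univ) hs.1 hs.2 trivial
    simp only [univ_inter] at h2
    have h3 : ENNReal.ofReal ρ ≤ eVariationOn g (Icc 0 s) := by
      have := eVariationOn.edist_le g (s := Icc 0 s) (x := s) (y := 0) ⟨hs.1, le_rfl⟩ ⟨le_rfl, hs.1⟩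
      rwa [g2, edist_dist, show dist (g s) x = ρ from hs2] at this
    have h4 : ENNReal.ofReal ρ + extDist (g s) x₀ < ENNReal.ofReal ρ + r := by
      calc _ ≤ eVariationOn g (Icc 0 s) + eVariationOn g (Icc s 1) := add_le_add h3 h1
        _ = _ := h2
        _ < _ := by rw [add_comm]; exact g4
    exact (ENNReal.add_lt_add_iff_left ENNReal.ofReal_ne_top).1 h4
  · rw [dist_comm, show dist (g s) x = ρ from hs2]
    exact (min_le_left _ _).trans_lt (half_lt_self hε)

lemma isConnected_extBall {X : Type*} [MetricSpace X] (x₀ : X) (r : ℝ≥0∞) (hr : 0 < r) :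
    IsConnected {w : X | extDist w x₀ < r} := by
  have h0 : x₀ ∈ {w : X | extDist w x₀ < r} := by simpa [extDist_self] using hr
  refine ⟨⟨x₀, h0⟩, isPreconnected_of_forall x₀ fun y hy => ?_⟩
  obtain ⟨g, g1, g2, g3, g4⟩ := exists_curve hy
  refine ⟨g '' Icc 0 1, ?_, ⟨1, by simp, g3⟩, ⟨0, by simp, g2⟩,
    isPreconnected_Icc.image g g1.continuousOn⟩
  rintro _ ⟨s, hs, rfl⟩
  have h1 := extDist_le_Icc hs.2 g1.continuousOn
  rw [g3] at h1
  exact (h1.trans (eVariationOn.mono g (Icc_subset_Icc_left hs.1))).trans_lt g4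

/-- Let `(X,d)` be a metric surface with locally finite Hausdorff 2-measure and `x₀ ∈ X`.
Then `x ↦ d̄(x,x₀)` is lower semicontinuous; moreover for each `r > 0` the open ball
`B_{d̄}(x₀,r)` is connected, the closed ball `{d̄(·,x₀) ≤ r}` is the closure of the open
ball, and in particular the closed ball is connected. -/
theorem extDist_lowerSemicontinuous_and_balls
    {X : Type*} [MetricSpace X] [MeasurableSpace X] [BorelSpace X]
    (hX : IsMetricSurface X) (hloc : IsLocallyFiniteMeasure (mu2 X)) (x₀ : X) :
    LowerSemicontinuous (fun x : X => extDist x x₀) ∧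
    ∀ r : ℝ, 0 < r →
      IsConnected {x : X | extDist x x₀ < ENNReal.ofReal r} ∧
      {x : X | extDist x x₀ ≤ ENNReal.ofReal r} =
        closure {x : X | extDist x x₀ < ENNReal.ofReal r} ∧
      IsConnected {x : X | extDist x x₀ ≤ ENNReal.ofReal r} := by

  have hlsc : LowerSemicontinuous (fun x : X => extDist x x₀) := by
    intro x c hc
    by_contra hcon
    have hf : ∃ᶠ w in 𝓝 x, extDist w x₀ ≤ c :=
      (not_eventually.1 hcon).mono fun w hw => not_lt.1 hw
    exact absurd (extDist_le_of_frequently hX hloc x₀ x c hf) (not_le.2 hc)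
  refine ⟨hlsc, fun r hr => ?_⟩
  have hr' : 0 < ENNReal.ofReal r := by simpa using hr
  have hconn := isConnected_extBall x₀ (ENNReal.ofReal r) hr'
  have heq : {x : X | extDist x x₀ ≤ ENNReal.ofReal r} =
        closure {x : X | extDist x x₀ < ENNReal.ofReal r} := by
    apply Subset.antisymm
    · intro x hx
      exact mem_closure_ball_of_eq x₀ x _ hr' ENNReal.ofReal_ne_top hx
    · refine closure_minimal (fun x (hx : extDist x x₀ < ENNReal.ofReal r) => (show extDist x x₀ ≤ ENNReal.ofReal r from hx.le)) ?_
      exact hlsc.isClosed_preimage (ENNReal.ofReal r)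
  exact ⟨hconn, heq, heq ▸ hconn.closure⟩
end

section
/- There is an absolute constant K > 0 with the following property. Let (X,d) be a metric surface of locally finite Hausdorff 2-measure and let T be a triangular disk in X. If Ω ⊂ ℝ² is a closed Jordan region and, for some L > 0, f : ∂T → ∂Ω is a map that is L-Lipschitz with respect to the extended length metric d̄ on ∂T and has non-zero topological degree, then H²(Ω) ≤ K L² H²_d(T), where H²(Ω) is the Lebesgue/Hausdorff 2-measure of Ω in ℝ² and H²_d(T) is the Hausdorff 2-measure of T with respect to d. -/
open Set Metric MeasureTheory
open scoped ENNReal unitInterval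

/-- A `d̄`-geodesic: a continuous curve of finite length whose length equals the
`d̄`-distance between its endpoints. -/
def IsGeodesic {X : Type*} [MetricSpace X] (γ : I → X) : Prop :=
  Continuous γ ∧ curveLength γ < ⊤ ∧ curveLength γ = extDist (γ 0) (γ 1)

/-- A `d̄`-geodesic arc from `p` to `q`: the image of an injective `d̄`-geodesic. -/
def IsGeodesicArc {X : Type*} [MetricSpace X] (G : Set X) (p q : X) : Prop :=
  ∃ γ : I → X, IsGeodesic γ ∧ Function.Injective γ ∧ γ 0 = p ∧ γ 1 = q ∧ G = Set.range γ

/-- A closed Jordan region: a subset homeomorphic to the closed unit disk whose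
topological boundary is the image of the unit circle under the homeomorphism.  (In the
plane this agrees, by the Jordan–Schoenflies theorem, with the closures of bounded
Jordan domains.) -/
def IsClosedJordanRegion {X : Type*} [TopologicalSpace X] (U : Set X) : Prop :=
  ∃ e : ↥(Metric.closedBall (0 : ℂ) 1) ≃ₜ ↥U,
    frontier U =
      Subtype.val '' (⇑e '' {x : ↥(Metric.closedBall (0 : ℂ) 1) | (x : ℂ) ∈ Metric.sphere (0 : ℂ) 1})

/-- A triangular disk with vertices `p, q, r` and edges `G₁, G₂, G₃`: a closed Jordan
region whose boundary Jordan curve is the union of three `d̄`-geodesic arcs meeting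
only at the vertices. -/
def IsTriangularDiskWith {X : Type*} [MetricSpace X]
    (T : Set X) (p q r : X) (G₁ G₂ G₃ : Set X) : Prop :=
  IsClosedJordanRegion T ∧
  IsGeodesicArc G₁ p q ∧ IsGeodesicArc G₂ q r ∧ IsGeodesicArc G₃ r p ∧
  frontier T = G₁ ∪ G₂ ∪ G₃ ∧
  G₁ ∩ G₂ = {q} ∧ G₂ ∩ G₃ = {r} ∧ G₃ ∩ G₁ = {p}

theorem aux_log_lift {A : Type*} [TopologicalSpace A] [SimplyConnectedSpace A]
    [LocallyPathConnectedSpace A] (g : A → ℂ) (hg : Continuous g) (h0 : ∀ x, g x ≠ 0) :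
    ∃ k : A → ℂ, Continuous k ∧ ∀ x, Complex.exp (k x) = g x := by
  obtain ⟨a⟩ : Nonempty A := inferInstance
  obtain ⟨F, ⟨-, hF⟩, -⟩ := Complex.isCoveringMapOn_exp.existsUnique_continuousMap_lifts
    ⟨g, hg⟩ (Complex.exp_log (h0 a)) (fun x => h0 x)
  exact ⟨F, F.continuous, fun x => congrFun hF x⟩

theorem aux_circle_decomp (b : sphere (0 : ℂ) 1 → ℂ) (hb : Continuous b) (h0 : ∀ s, b s ≠ 0) :
    ∃ (m : ℤ) (h : sphere (0 : ℂ) 1 → ℂ), Continuous h ∧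
      ∀ s, b s = (s : ℂ) ^ m * Complex.exp (h s) := by
  let e : ℝ → sphere (0 : ℂ) 1 := fun t => ⟨Complex.exp (t * Complex.I), by simp⟩
  have he : Continuous e := by
    apply Continuous.subtype_mk; fun_prop
  obtain ⟨k, hk, hke⟩ := aux_log_lift (fun t => b (e t)) (hb.comp he) (fun t => h0 _)
  have h2 : e (2 * Real.pi) = e 0 := by
    apply Subtype.ext
    simp [e, Complex.exp_two_pi_mul_I]
  have h3 : Complex.exp (k (2 * Real.pi)) = Complex.exp (k 0) := by rw [hke, hke, h2]
  obtain ⟨m, hm⟩ := Complex.exp_eq_exp_iff_exists_int.1 h3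
  let q : Icc (0 : ℝ) (2 * Real.pi) → sphere (0 : ℂ) 1 := fun t => e t
  have hqc : Continuous q := he.comp continuous_subtype_val
  have hqs : Function.Surjective q := by
    rintro ⟨s, hs⟩
    have hs1 : ‖s‖ = 1 := by simpa using hs
    have hse : s = Complex.exp (s.arg * Complex.I) := by
      conv_lhs => rw [← Complex.norm_mul_exp_arg_mul_I s, hs1]
      simp
    have := Complex.arg_le_pi s
    have := Complex.neg_pi_lt_arg s
    have := Real.pi_pos
    by_cases h : 0 ≤ s.arg
    · exact ⟨⟨s.arg, h, by linarith⟩, Subtype.ext hse.symm⟩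
    · refine ⟨⟨s.arg + 2 * Real.pi, by linarith, by linarith⟩, Subtype.ext ?_⟩
      change Complex.exp (_ * _) = s
      conv_rhs => rw [hse]
      push_cast
      rw [add_mul, Complex.exp_add, Complex.exp_two_pi_mul_I, mul_one]
  have hq := Topology.IsQuotientMap.of_surjective_continuous hqs hqc
  let h' : C(Icc (0 : ℝ) (2 * Real.pi), ℂ) := ⟨fun t => k t - m * (t * Complex.I), by fun_prop⟩
  have hcompat : ∀ a b : Icc (0 : ℝ) (2 * Real.pi), (a : ℝ) ≤ b → q a = q b → h' a = h' b := by
    rintro ⟨a, ha, ha'⟩ ⟨b, hb, hb'⟩ hle hab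
    have := Real.pi_pos
    simp only at hle
    have h4 : Complex.exp (a * Complex.I) = Complex.exp (b * Complex.I) := congrArg Subtype.val hab
    obtain ⟨n, hn⟩ := Complex.exp_eq_exp_iff_exists_int.1 h4
    have h5 : a = b + n * (2 * Real.pi) := by
      have := congrArg Complex.im hn
      simpa using this
    have h6 : n = 0 ∨ n = -1 := by
      have q1 : (n : ℝ) < 1 := by by_contra hh; push Not at hh; nlinarith
      have q2 : (-2 : ℝ) < n := by by_contra hh; push Not at hh; nlinarith
      have : n < 1 := by exact_mod_cast q1
      have : -2 < n := by exact_mod_cast q2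
      omega
    rcases h6 with rfl | rfl
    · simp at h5; subst h5; rfl
    · push_cast at h5
      have ha0 : a = 0 := by linarith
      have hb0 : b = 2 * Real.pi := by linarith
      subst ha0; subst hb0
      simp only [h', ContinuousMap.coe_mk, hm]
      push_cast; ring
  have hcompat' : ∀ a b : Icc (0 : ℝ) (2 * Real.pi), q a = q b → h' a = h' b := by
    intro a b hab
    rcases le_total (a : ℝ) b with h | h
    · exact hcompat a b h hab
    · exact (hcompat b a h hab.symm).symm
  let qq : C(Icc (0 : ℝ) (2 * Real.pi), sphere (0 : ℂ) 1) := ⟨q, hqc⟩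
  let H := Topology.IsQuotientMap.lift (f := qq) hq h' hcompat'
  refine ⟨m, H, H.continuous, fun s => ?_⟩
  obtain ⟨t, rfl⟩ := hqs s
  have hH : H (q t) = h' t := DFunLike.congr_fun (Topology.IsQuotientMap.lift_comp (f := qq) hq h' hcompat') t
  rw [hH]
  change b (e t) = _
  rw [← hke]
  simp only [h', q, e, ContinuousMap.coe_mk]
  rw [← Complex.exp_int_mul, ← Complex.exp_add]
  congr 1; ring

theorem aux_zpow_log (n : ℤ) (h : sphere (0 : ℂ) 1 → ℂ) (hc : Continuous h)
    (hh : ∀ s : sphere (0 : ℂ) 1, (s : ℂ) ^ n = Complex.exp (h s)) : n = 0 := by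
  let e : ℝ → sphere (0 : ℂ) 1 := fun t => ⟨Complex.exp (t * Complex.I), by simp⟩
  have he : Continuous e := by
    apply Continuous.subtype_mk; fun_prop
  have h2 : e (2 * Real.pi) = e 0 := by
    apply Subtype.ext
    simp [e, Complex.exp_two_pi_mul_I]
  have key : ∀ t : ℝ, ∃ j : ℤ, h (e t) = n * (t * Complex.I) + j * (2 * Real.pi * Complex.I) := by
    intro t
    apply Complex.exp_eq_exp_iff_exists_int.1
    rw [← hh, Complex.exp_int_mul]
  choose j hj using key
  have hjc : Continuous fun t => (j t : ℝ) := by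
    have : (fun t => (j t : ℝ)) = fun t => ((h (e t)).im - n * t) / (2 * Real.pi) := by
      ext t
      rw [hj]
      have := Real.pi_pos
      simp
    rw [this]
    have := Complex.continuous_im.comp (hc.comp he)
    simp only [Function.comp_def] at this
    fun_prop
  have hjc' : Continuous j := Int.isClosedEmbedding_coe_real.isEmbedding.continuous_iff.2 hjc
  have hconst : j (2 * Real.pi) = j 0 := PreconnectedSpace.constant inferInstance hjc'
  have e1 := hj (2 * Real.pi)
  rw [h2, hj 0, hconst] at e1
  have := congrArg Complex.im e1
  simpa using this

theorem aux_null (a : C(sphere (0 : ℂ) 1, sphere (0 : ℂ) 1)) (h : sphere (0 : ℂ) 1 → ℂ)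
    (hc : Continuous h) (hh : ∀ s, (a s : ℂ) = Complex.exp (h s)) : a.Nullhomotopic := by
  have hre : ∀ s, (h s).re = 0 := by
    intro s
    have h1 : ‖(a s : ℂ)‖ = 1 := by simpa using (a s).2
    rw [hh, Complex.norm_exp] at h1
    simpa using h1
  refine ⟨⟨1, by simp⟩, ⟨⟨⟨fun p => ⟨Complex.exp ((1 - (p.1 : ℝ) : ℝ) * (h p.2)), ?_⟩, ?_⟩, ?_, ?_⟩⟩⟩
  · simp [Complex.norm_exp, hre]
  · apply Continuous.subtype_mk; fun_prop
  · intro s; apply Subtype.ext; simp [hh]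
  · intro s; apply Subtype.ext; simp

theorem aux_surj (a : C(sphere (0 : ℂ) 1, sphere (0 : ℂ) 1)) (hn : ¬ a.Nullhomotopic) :
    Function.Surjective a := by
  by_contra hs
  simp only [Function.Surjective, not_forall, not_exists] at hs
  obtain ⟨w, hw⟩ := hs
  have hw1 : ‖(w : ℂ)‖ = 1 := by simpa using w.2
  have hw0 : (w : ℂ) ≠ 0 := by intro h; simp [h] at hw1
  have hsl : ∀ s, (a s : ℂ) / (-w) ∈ Complex.slitPlane := by
    intro s
    have h1 : ‖(a s : ℂ)‖ = 1 := by simpa using (a s).2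
    rw [Complex.mem_slitPlane_iff_not_le_zero]
    intro hle
    set z := (a s : ℂ) / (-w) with hz
    have hz1 : ‖z‖ = 1 := by simp [hz, h1, hw1]
    rw [Complex.le_def] at hle
    simp only [Complex.zero_re, Complex.zero_im] at hle
    have hzr : z = (z.re : ℂ) := Complex.ext (by simp) (by simp [hle.2])
    rw [hzr, Complex.norm_real, Real.norm_eq_abs, abs_of_nonpos hle.1] at hz1
    have : z = -1 := by rw [hzr, show z.re = -1 by linarith]; simp
    rw [hz, div_eq_iff (neg_ne_zero.2 hw0)] at this
    exact hw s (Subtype.ext (by rw [this]; ring))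
  apply hn
  refine aux_null a (fun s => Complex.log ((a s : ℂ) / (-w)) + Complex.log (-w)) ?_ ?_
  · refine Continuous.add ?_ continuous_const
    refine Continuous.clog ?_ hsl
    fun_prop
  · intro s
    rw [Complex.exp_add, Complex.exp_log (Complex.slitPlane_ne_zero (hsl s)),
      Complex.exp_log (neg_ne_zero.2 hw0)]
    field_simp

theorem aux_comp (a : C(sphere (0 : ℂ) 1, sphere (0 : ℂ) 1)) (hn : ¬ a.Nullhomotopic)
    (b : sphere (0 : ℂ) 1 → ℂ) (hb : Continuous b) (h0 : ∀ s, b s ≠ 0)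
    (g : sphere (0 : ℂ) 1 → ℂ) (hg : Continuous g) (hbg : ∀ s, b (a s) = Complex.exp (g s)) :
    ∃ h : sphere (0 : ℂ) 1 → ℂ, Continuous h ∧ ∀ s, b s = Complex.exp (h s) := by
  obtain ⟨m, h, hc, hh⟩ := aux_circle_decomp b hb h0
  obtain ⟨d, u, uc, hu⟩ := aux_circle_decomp (fun s => (a s : ℂ)) (by fun_prop) (by
    intro s hs
    have h1 : ‖(a s : ℂ)‖ = 1 := by simpa using (a s).2
    simp [hs] at h1)
  have hdm : d * m = 0 := by
    refine aux_zpow_log (d * m) (fun s => g s - m * u s - h (a s)) ?_ ?_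
    · fun_prop
    · intro s
      have e1 := hh (a s)
      rw [hbg] at e1
      rw [Complex.exp_sub, Complex.exp_sub, e1, hu s, mul_zpow, ← zpow_mul, ← Complex.exp_int_mul]
      field_simp [Complex.exp_ne_zero]
  rcases mul_eq_zero.1 hdm with rfl | rfl
  · exact absurd (aux_null a u uc (by simpa using hu)) hn
  · exact ⟨h, hc, by simpa using hh⟩

/-- Borsuk: winding around an interior point is essential. -/
theorem aux_borsuk (Ω : Set ℂ) (hΩ : IsCompact Ω) (z : ℂ) (hz : z ∈ interior Ω)
    (k : frontier Ω → ℂ) (hk : Continuous k) (hkz : ∀ w : frontier Ω, (w : ℂ) - z = Complex.exp (k w)) :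
    False := by
  obtain ⟨k', hk'⟩ := ContinuousMap.exists_restrict_eq (s := frontier Ω) isClosed_frontier ⟨k, hk⟩
  classical
  have hfr : ∀ w ∈ frontier Ω, Complex.exp (k' w) = w - z := by
    intro w hw
    have := DFunLike.congr_fun hk' ⟨w, hw⟩
    simp at this
    rw [this, ← hkz]
  let Φ : ℂ → ℂ := fun w => if w ∈ Ω then Complex.exp (k' w) else w - z
  have hΦ : Continuous Φ := by
    refine Continuous.if hfr ?_ ?_ <;> fun_prop
  have hΦ0 : ∀ w, Φ w ≠ 0 := by
    intro w
    by_cases hw : w ∈ Ω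
    · simp [Φ, hw]
    · simp only [Φ, hw, if_false]
      intro h
      exact hw (sub_eq_zero.1 h ▸ interior_subset hz)
  obtain ⟨j, hj, hje⟩ := aux_log_lift Φ hΦ hΦ0
  obtain ⟨R, hR0, hR⟩ := hΩ.isBounded.subset_ball_lt 0 z
  have := aux_zpow_log 1 (fun s => j (z + R * s) - Complex.log R) (by fun_prop) (by
    intro s
    have h1 : ‖(s : ℂ)‖ = 1 := by simpa using s.2
    have : z + R * (s : ℂ) ∉ Ω := by
      intro h
      have := hR h
      simp [h1, abs_of_pos hR0] at this
    have hR' : (R : ℂ) ≠ 0 := by exact_mod_cast hR0.ne'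
    rw [Complex.exp_sub, hje, Complex.exp_log hR']
    simp only [Φ, this, if_false]
    field_simp
    simp)
  exact one_ne_zero this

/-- `ε`-chains in `T` with their total length. -/
inductive AuxReach {X : Type*} [MetricSpace X] (T : Set X) (ε : ℝ) : X → X → ℝ → Prop
  | refl (x : X) (hx : x ∈ T) : AuxReach T ε x x 0
  | step (x y z : X) (l : ℝ) (h : AuxReach T ε x y l) (hz : z ∈ T) (hyz : dist y z < ε) :
      AuxReach T ε x z (l + dist y z)

theorem aux_reach_curve {X : Type*} [MetricSpace X] {T : Set X} {ε : ℝ} (hε : 0 < ε) {x y : X}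
    {l : ℝ} (h : AuxReach T ε x y l) :
    0 ≤ l ∧ ∃ g : ℝ → X, (∀ t, g t ∈ T) ∧ g 0 = x ∧ (∀ t, l ≤ t → g t = y) ∧
      ∀ s t, s ≤ t → dist (g s) (g t) ≤ t - s + ε := by
  induction h with
  | refl hx =>
    refine ⟨le_rfl, fun _ => x, fun _ => hx, rfl, fun _ _ => rfl, fun s t hst => ?_⟩
    simp; linarith
  | step y z l h hz hyz ih =>
    obtain ⟨hl, g, hgT, hg0, hgl, hg⟩ := ih
    have hd : 0 ≤ dist y z := dist_nonneg
    refine ⟨by positivity, fun t => if t < l + dist y z then g t else z, ?_, ?_, ?_, ?_⟩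
    · intro t; dsimp only; split_ifs
      · exact hgT t
      · exact hz
    · dsimp only; split_ifs with h0
      · exact hg0
      · have hl0 : l = 0 := by linarith
        have hd0 : dist y z = 0 := by linarith
        rw [← dist_eq_zero.1 hd0, ← hgl 0 hl0.le, hg0]
    · intro t ht
      simp [not_lt.2 ht]
    · intro s t hst
      dsimp only
      split_ifs with hs ht ht
      · exact hg s t hst
      · rcases le_total s l with hsl | hsl
        · have := hg s l hsl
          rw [hgl l le_rfl] at this
          have := dist_triangle (g s) y z
          linarith
        · rw [hgl s hsl]; linarith
      · linarith
      · simp; linarith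

theorem aux_extDist_le {X : Type*} [MetricSpace X] (g : ℝ → X)
    (hg : ∀ s t, dist (g s) (g t) ≤ |s - t|) (l : ℝ) (hl : 0 ≤ l) :
    extDist (g 0) (g l) ≤ ENNReal.ofReal l := by
  have hL : LipschitzWith 1 g := LipschitzWith.of_dist_le_mul (by
    intro s t; simpa [Real.dist_eq] using hg s t)
  let v : I → ℝ := fun t => l * t
  have hv : Monotone v := fun a b hab => mul_le_mul_of_nonneg_left hab hl
  refine iInf_le_of_le (fun t => g (v t)) (iInf_le_of_le (hL.continuous.comp (by fun_prop))
    (iInf_le_of_le (by simp [v]) (iInf_le_of_le (by simp [v]) ?_)))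
  have h1 := (hL.lipschitzOnWith (s := univ)).comp_eVariationOn_le (f := g) (g := v) (s := univ)
    (mapsTo_univ _ _)
  have h2 := (hv.monotoneOn univ).eVariationOn_eq (a := 0) (b := 1) (mem_univ _) (mem_univ _)
  have h3 : (univ ∩ Icc (0 : I) 1) = univ := by
    ext t; exact ⟨fun _ => mem_univ _, fun _ => ⟨mem_univ _, t.2.1, t.2.2⟩⟩
  rw [h3] at h2
  refine h1.trans ?_
  simpa [v] using h2.le

theorem aux_ultra {Y : Type*} [TopologicalSpace Y] {K : Set Y} (hK : IsCompact K) (u : ℕ → Y)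
    (hu : ∀ n, u n ∈ K) :
    ∃ x ∈ K, Filter.Tendsto u (Filter.hyperfilter ℕ : Filter ℕ) (nhds x) := by
  obtain ⟨x, hx, h⟩ := hK.ultrafilter_le_nhds ((Filter.hyperfilter ℕ).map u) (by
    rw [Filter.le_principal_iff]
    rw [Ultrafilter.coe_map]
    exact Filter.mem_map.2 (Filter.mem_of_superset Filter.univ_mem (fun n _ => hu n)))
  exact ⟨x, hx, h⟩

theorem aux_key {X : Type*} [MetricSpace X] {T S : Set X} (hT : IsCompact T) (hS : IsCompact S)
    (f : X → ℂ) (hfc : ContinuousOn f S) {L : ℝ} (hL : 0 < L)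
    (hf : ∀ x ∈ S, ∀ y ∈ S, edist (f x) (f y) ≤ ENNReal.ofReal L * extDist x y)
    {δ : ℝ} (hδ : 0 < δ) :
    ∃ ε : ℝ, 0 < ε ∧ ∀ x ∈ S, ∀ y ∈ S, ∀ l, AuxReach T ε x y l →
      dist (f x) (f y) ≤ L * (l + δ) := by
  by_contra! hcon
  have hpos : ∀ n : ℕ, (0 : ℝ) < 1 / (n + 1) := fun n => Nat.one_div_pos_of_nat
  choose x hx y hy l hr hlt using fun n : ℕ => hcon (1 / (n + 1)) (hpos n)
  choose hl g hgT hg0 hgl hg using fun n => aux_reach_curve (hpos n) (hr n)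
  obtain ⟨x₀, hx₀, hxt⟩ := aux_ultra hS x hx
  obtain ⟨y₀, hy₀, hyt⟩ := aux_ultra hS y hy
  choose G hGT hGt using fun t : ℝ => aux_ultra hT (fun n => g n t) (fun n => hgT n t)
  obtain ⟨C, hC⟩ := isBounded_iff.1 (hS.image_of_continuousOn hfc).isBounded
  have hlC : ∀ n, l n ∈ Icc 0 (C / L) := by
    intro n
    refine ⟨hl n, ?_⟩
    have := hC (mem_image_of_mem f (hx n)) (mem_image_of_mem f (hy n))
    rw [le_div_iff₀ hL]
    nlinarith [hlt n]
  obtain ⟨l₀, hl₀, hlt₀⟩ := aux_ultra isCompact_Icc l hlC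
  have hε : Filter.Tendsto (fun n : ℕ => 1 / ((n : ℝ) + 1)) (Filter.hyperfilter ℕ : Filter ℕ)
      (nhds 0) := tendsto_one_div_add_atTop_nhds_zero_nat.mono_left Nat.hyperfilter_le_atTop
  have hgabs : ∀ n s t, dist (g n s) (g n t) ≤ |s - t| + 1 / ((n : ℝ) + 1) := by
    intro n s t
    rcases le_total s t with h | h
    · rw [abs_sub_comm, abs_of_nonneg (sub_nonneg.2 h)]; exact hg n s t h
    · rw [dist_comm, abs_of_nonneg (sub_nonneg.2 h)]; exact hg n t s h
  have hGlip : ∀ s t, dist (G s) (G t) ≤ |s - t| := by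
    intro s t
    have h2 := (tendsto_const_nhds (x := |s - t|)).add hε
    rw [add_zero] at h2
    exact le_of_tendsto_of_tendsto' ((hGt s).dist (hGt t)) h2 (fun n => hgabs n s t)
  have hG0 : G 0 = x₀ := tendsto_nhds_unique (hGt 0) (by simpa [hg0] using hxt)
  have hGl : G l₀ = y₀ := by
    have h1 : Filter.Tendsto (fun n => |l₀ - l n| + 1 / ((n : ℝ) + 1))
        (Filter.hyperfilter ℕ : Filter ℕ) (nhds (|l₀ - l₀| + 0)) :=
      ((tendsto_const_nhds.sub hlt₀).abs).add hε
    have h2 := le_of_tendsto_of_tendsto' ((hGt l₀).dist hyt) h1 (fun n => by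
      have := hgabs n l₀ (l n)
      rwa [hgl n (l n) le_rfl] at this)
    simpa using h2
  have hext := aux_extDist_le G hGlip l₀ hl₀.1
  rw [hG0, hGl] at hext
  have h1 : edist (f x₀) (f y₀) ≤ ENNReal.ofReal (L * l₀) := by
    rw [ENNReal.ofReal_mul hL.le]
    exact (hf x₀ hx₀ y₀ hy₀).trans (by gcongr)
  rw [edist_dist, ENNReal.ofReal_le_ofReal_iff (mul_nonneg hL.le hl₀.1)] at h1
  have hft : ∀ (u : ℕ → X) (a : X), (∀ n, u n ∈ S) → a ∈ S →
      Filter.Tendsto u (Filter.hyperfilter ℕ : Filter ℕ) (nhds a) →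
      Filter.Tendsto (fun n => f (u n)) (Filter.hyperfilter ℕ : Filter ℕ) (nhds (f a)) := by
    intro u a hu ha h
    exact (hfc a ha).tendsto.comp (tendsto_nhdsWithin_iff.2 ⟨h, Filter.Eventually.of_forall hu⟩)
  have h2 : L * (l₀ + δ) ≤ dist (f x₀) (f y₀) :=
    le_of_tendsto_of_tendsto' ((hlt₀.add_const δ).const_mul L)
      ((hft x x₀ hx hx₀ hxt).dist (hft y y₀ hy hy₀ hyt)) (fun n => (hlt n).le)
  nlinarith [mul_pos hL hδ]

theorem aux_mcshane {X : Type*} [MetricSpace X] {T S : Set X} (hST : S ⊆ T)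
    (f : X → ℝ) {B : ℝ} (hB : ∀ x ∈ S, |f x| ≤ B) {L ε δ : ℝ} (hL : 0 < L) (hε : 0 < ε)
    (hδ : 0 < δ)
    (h : ∀ x ∈ S, ∀ y ∈ S, ∀ l, AuxReach T ε x y l → |f x - f y| ≤ L * (l + δ)) :
    ∃ F : X → ℝ, (∀ x ∈ T, ∀ y ∈ T, dist x y < ε → |F x - F y| ≤ L * dist x y) ∧
      ∀ x ∈ S, |F x - f x| ≤ L * δ := by
  let V : X → Set ℝ := fun x => {r | r = B ∨ ∃ y ∈ S, ∃ l, AuxReach T ε y x l ∧ r = f y + L * l}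
  have hVn : ∀ x, (V x).Nonempty := fun x => ⟨B, Or.inl rfl⟩
  have hVb : ∀ x, BddBelow (V x) := by
    intro x
    refine ⟨-|B|, ?_⟩
    rintro r (rfl | ⟨y, hy, l, hr, rfl⟩)
    · exact neg_abs_le _
    · have := (aux_reach_curve hε hr).1
      have h1 := abs_le.1 (hB y hy)
      have := le_abs_self B
      nlinarith
  have hone : ∀ x ∈ T, ∀ y ∈ T, dist x y < ε → sInf (V y) ≤ sInf (V x) + L * dist x y := by
    intro x hx y hy hxy
    rw [← sub_le_iff_le_add]
    refine le_csInf (hVn x) ?_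
    have := mul_nonneg hL.le (dist_nonneg (x := x) (y := y))
    rintro r (rfl | ⟨w, hw, l, hr, rfl⟩)
    · have := csInf_le (hVb y) (Or.inl rfl : r ∈ V y)
      linarith
    · have := csInf_le (hVb y) (Or.inr ⟨w, hw, _, hr.step _ _ _ _ hy hxy, rfl⟩)
      linarith
  refine ⟨fun x => sInf (V x), ?_, ?_⟩
  · intro x hx y hy hxy
    have h1 := hone x hx y hy hxy
    have h2 := hone y hy x hx (by rwa [dist_comm])
    rw [dist_comm] at h2
    rw [abs_le]; constructor <;> linarith
  · intro x hx
    have h1 : sInf (V x) ≤ f x := by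
      have := csInf_le (hVb x) (Or.inr ⟨x, hx, _, AuxReach.refl x (hST hx), rfl⟩)
      simpa using this
    have hpos := mul_pos hL hδ
    have h2 : f x - L * δ ≤ sInf (V x) := by
      refine le_csInf (hVn x) ?_
      rintro r (rfl | ⟨w, hw, l, hr, rfl⟩)
      · have := (abs_le.1 (hB x hx)).2
        linarith
      · have := (abs_le.1 (h w hw x hx l hr)).1
        linarith
    rw [abs_le]; constructor <;> linarith

theorem aux_image_measure {X Y : Type*} [MetricSpace X] [MeasurableSpace X] [BorelSpace X]
    [MetricSpace Y] [MeasurableSpace Y] [BorelSpace Y] {T : Set X} (hT : IsCompact T)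
    (F : X → Y) {L ε : ℝ} (hL : 0 < L) (hε : 0 < ε)
    (hF : ∀ x ∈ T, ∀ y ∈ T, dist x y < ε → dist (F x) (F y) ≤ L * dist x y) :
    μH[2] (F '' T) ≤ ENNReal.ofReal (L ^ 2) * μH[2] T := by
  obtain ⟨t, -, htf, htc⟩ := hT.finite_cover_balls (half_pos hε)
  obtain rfl | hne := T.eq_empty_or_nonempty
  · simp
  have htn : t.Nonempty := by
    obtain ⟨x, hx⟩ := hne
    obtain ⟨i, hi, -⟩ := mem_iUnion₂.1 (htc hx)
    exact ⟨i, hi⟩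
  obtain ⟨c, hc⟩ := htf.countable.exists_eq_range htn
  let A : ℕ → Set X := disjointed fun n => ball (c n) (ε / 2)
  have hA : ∀ n, MeasurableSet (A n) := fun n =>
    MeasurableSet.disjointed (fun _ => measurableSet_ball) n
  have hcov : T = ⋃ n, T ∩ A n := by
    rw [← inter_iUnion, iUnion_disjointed, eq_comm, inter_eq_left]
    refine htc.trans ?_
    rw [hc]
    simp
  have hdis : Pairwise (Function.onFun Disjoint fun n => T ∩ A n) := fun i j hij =>
    (disjoint_disjointed (fun n => ball (c n) (ε / 2)) hij).mono inter_subset_right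
      inter_subset_right
  have hone : ∀ n, μH[2] (F '' (T ∩ A n)) ≤ ENNReal.ofReal (L ^ 2) * μH[2] (T ∩ A n) := by
    intro n
    have hlip : LipschitzOnWith L.toNNReal F (T ∩ A n) := by
      refine LipschitzOnWith.of_dist_le_mul fun x hx y hy => ?_
      rw [Real.coe_toNNReal _ hL.le]
      refine hF x hx.1 y hy.1 ?_
      have h1 := disjointed_subset _ n hx.2
      have h2 := disjointed_subset _ n hy.2
      simp only [mem_ball] at h1 h2
      have := dist_triangle_right x y (c n)
      linarith
    refine (hlip.hausdorffMeasure_image_le zero_le_two).trans (le_of_eq ?_)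
    congr 1
    rw [ENNReal.ofReal_pow hL.le]
    exact ENNReal.rpow_natCast _ 2
  calc μH[2] (F '' T) = μH[2] (⋃ n, F '' (T ∩ A n)) := by rw [← image_iUnion, ← hcov]
    _ ≤ ∑' n, μH[2] (F '' (T ∩ A n)) := measure_iUnion_le _
    _ ≤ ∑' n, ENNReal.ofReal (L ^ 2) * μH[2] (T ∩ A n) := ENNReal.tsum_le_tsum hone
    _ = ENNReal.ofReal (L ^ 2) * μH[2] T := by
      rw [ENNReal.tsum_mul_left, ← measure_iUnion hdis
        (fun n => hT.isClosed.measurableSet.inter (hA n)), ← hcov]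

theorem aux_volume_complex (S : Set ℂ) :
    volume S = μH[2] ((fun z : ℂ => (z.re, z.im)) '' S) := by
  rw [hausdorffMeasure_prod_real]
  have := Complex.volume_preserving_equiv_real_prod.measure_preimage_equiv
    ((fun z : ℂ => (z.re, z.im)) '' S)
  rw [← this]
  congr 1
  exact (preimage_image_eq S Complex.measurableEquivRealProd.injective).symm

theorem aux_curve_null {X : Type*} [MetricSpace X] (γ : I → X) (hγ : Continuous γ)
    (hlen : curveLength γ < ⊤) (f : X → ℂ) {L : ℝ} (hL : 0 < L)
    (hf : ∀ s t, edist (f (γ s)) (f (γ t)) ≤ ENNReal.ofReal L * extDist (γ s) (γ t)) :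
    volume (f '' range γ) = 0 := by
  let v : I → ℝ := fun t => (eVariationOn γ (Icc 0 t)).toReal
  have hfin : ∀ A : Set I, eVariationOn γ A ≠ ⊤ := fun A =>
    ((eVariationOn.mono γ (subset_univ A)).trans_lt hlen).ne
  have hext : ∀ s t : I, s ≤ t → extDist (γ s) (γ t) ≤ ENNReal.ofReal |v s - v t| := by
    intro s t hst
    have hadd := eVariationOn.Icc_add_Icc γ (s := univ) (a := 0) (b := s) (c := t) s.2.1 hst
      (mem_univ _)
    simp only [univ_inter] at hadd
    have hv : v t = v s + (eVariationOn γ (Icc s t)).toReal := by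
      simp only [v]
      rw [← hadd, ENNReal.toReal_add (hfin _) (hfin _)]
    have hvs : |v s - v t| = (eVariationOn γ (Icc s t)).toReal := by
      rw [hv, abs_sub_comm, add_sub_cancel_left, abs_of_nonneg ENNReal.toReal_nonneg]
    rw [hvs, ENNReal.ofReal_toReal (hfin _)]
    have hst' : (s : ℝ) ≤ t := hst
    let c : I → I := fun r => ⟨s + r * (t - s), by
      have := r.2.1; have := r.2.2; have := s.2.1; have := t.2.2
      constructor
      · nlinarith
      · nlinarith⟩
    have hc : Continuous c := by apply Continuous.subtype_mk; fun_prop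
    have hcm : Monotone c := by
      intro a b hab
      have : (a : ℝ) ≤ b := hab
      change (s : ℝ) + a * (t - s) ≤ s + b * (t - s)
      nlinarith
    have hc0 : c 0 = s := Subtype.ext (by simp [c])
    have hc1 : c 1 = t := Subtype.ext (by simp [c])
    refine iInf_le_of_le (γ ∘ c) (iInf_le_of_le (hγ.comp hc)
      (iInf_le_of_le (by simp [hc0]) (iInf_le_of_le (by simp [hc1]) ?_)))
    refine eVariationOn.comp_le_of_monotoneOn γ c (hcm.monotoneOn _) ?_
    intro r _
    exact ⟨hc0 ▸ hcm r.2.1, hc1 ▸ hcm r.2.2⟩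
  have hd0 : ∀ s t : I, s ≤ t → dist (f (γ s)) (f (γ t)) ≤ L * |v s - v t| := by
    intro s t hst
    have := (hf s t).trans (mul_le_mul_right (hext s t hst) _)
    rw [← ENNReal.ofReal_mul hL.le, edist_dist,
      ENNReal.ofReal_le_ofReal_iff (by positivity)] at this
    exact this
  have hd : ∀ s t : I, dist (f (γ s)) (f (γ t)) ≤ L * |v s - v t| := by
    intro s t
    rcases le_total s t with h | h
    · exact hd0 s t h
    · rw [dist_comm, abs_sub_comm]; exact hd0 t s h
  let F : ℝ → ℝ × ℝ := fun r =>
    ((f (γ (Function.invFun v r))).re, (f (γ (Function.invFun v r))).im)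
  have hinv : ∀ r ∈ range v, v (Function.invFun v r) = r := fun r hr => Function.invFun_eq hr
  have hlip : LipschitzOnWith L.toNNReal F (range v) := by
    refine LipschitzOnWith.of_dist_le_mul fun a ha b hb => ?_
    rw [Real.coe_toNNReal _ hL.le]
    have h1 := hd (Function.invFun v a) (Function.invFun v b)
    rw [hinv a ha, hinv b hb, ← Real.dist_eq, dist_eq_norm (f _)] at h1
    rw [Prod.dist_eq]
    refine max_le ?_ ?_
    · refine le_trans ?_ h1
      rw [Real.dist_eq, ← Complex.sub_re]; exact Complex.abs_re_le_norm _
    · refine le_trans ?_ h1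
      rw [Real.dist_eq, ← Complex.sub_im]; exact Complex.abs_im_le_norm _
  have hsub : (fun z : ℂ => (z.re, z.im)) '' (f '' range γ) ⊆ F '' range v := by
    rintro _ ⟨_, ⟨_, ⟨t, rfl⟩, rfl⟩, rfl⟩
    refine ⟨v t, ⟨t, rfl⟩, ?_⟩
    have h1 := hd (Function.invFun v (v t)) t
    rw [hinv (v t) ⟨t, rfl⟩] at h1
    have h2 : f (γ (Function.invFun v (v t))) = f (γ t) := by
      rw [← dist_le_zero]; simpa using h1
    simp only [F, h2]
  rw [aux_volume_complex]
  refine measure_mono_null hsub (le_antisymm ?_ zero_le)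
  refine (hlip.hausdorffMeasure_image_le zero_le_two).trans ?_
  have h0 : μH[((2 : NNReal) : ℝ)] (univ : Set ℝ) = 0 := by
    apply hausdorffMeasure_of_dimH_lt
    rw [Real.dimH_univ]; norm_num
  have h0' : μH[2] (range v) = 0 := measure_mono_null (subset_univ _) (by simpa using h0)
  rw [h0', mul_zero]

theorem aux_degree {X : Type*} [MetricSpace X] {T : Set X} (hT : IsCompact T)
    (e : closedBall (0 : ℂ) 1 ≃ₜ T) (F f : X → ℂ) (hF : ContinuousOn F T)
    {Ω : Set ℂ} (hΩ : IsCompact Ω) (hmaps : Set.MapsTo f (frontier T) (frontier Ω))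
    (φ : sphere (0 : ℂ) 1 ≃ₜ frontier T) (ψ : sphere (0 : ℂ) 1 ≃ₜ frontier Ω)
    (a : C(sphere (0 : ℂ) 1, sphere (0 : ℂ) 1)) (hn : ¬ a.Nullhomotopic)
    (ha : ∀ s, (ψ (a s) : ℂ) = f (φ s))
    (z : ℂ) (hz : z ∈ interior Ω) (hFf : ∀ x ∈ frontier T, ‖F x - f x‖ < ‖f x - z‖) :
    z ∈ F '' T := by
  by_contra hzF
  have hsub : frontier T ⊆ T := hT.isClosed.frontier_subset
  let pr : ℂ → closedBall (0 : ℂ) 1 := fun w => ⟨w / ((max 1 ‖w‖ : ℝ) : ℂ), by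
    have h1 : (1 : ℝ) ≤ max 1 ‖w‖ := le_max_left _ _
    have h2 : ‖w‖ ≤ max 1 ‖w‖ := le_max_right _ _
    rw [mem_closedBall_zero_iff, norm_div, Complex.norm_real, Real.norm_eq_abs,
      abs_of_nonneg (by linarith)]
    exact div_le_one_of_le₀ h2 (by linarith)⟩
  have hprc : Continuous pr := by
    apply Continuous.subtype_mk
    refine Continuous.div (by fun_prop) (by fun_prop) ?_
    intro w
    have h1 : (1 : ℝ) ≤ max 1 ‖w‖ := le_max_left _ _
    exact_mod_cast (by linarith : (0 : ℝ) < max 1 ‖w‖).ne'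
  have hpr : ∀ w : closedBall (0 : ℂ) 1, pr w = w := by
    intro w
    have h1 : ‖(w : ℂ)‖ ≤ 1 := mem_closedBall_zero_iff.1 w.2
    apply Subtype.ext
    simp [pr, max_eq_left h1]
  have hFr : Continuous (fun x : T => F x) := continuousOn_iff_continuous_domRestrict.1 hF
  obtain ⟨k, hk, hke⟩ := aux_log_lift (fun w : ℂ => F (e (pr w)) - z)
    ((hFr.comp (e.continuous.comp hprc)).sub continuous_const)
    (fun w h => hzF ⟨e (pr w), (e (pr w)).2, sub_eq_zero.1 h⟩)
  let κ : T → ℂ := fun x => k (e.symm x)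
  have hκ : Continuous κ := hk.comp (continuous_subtype_val.comp e.symm.continuous)
  have hκe : ∀ x : T, Complex.exp (κ x) = F x - z := by
    intro x
    simp only [κ, hke, hpr, Homeomorph.apply_symm_apply]
  let ι : sphere (0 : ℂ) 1 → T := fun s => ⟨φ s, hsub (φ s).2⟩
  have hι : Continuous ι := (continuous_subtype_val.comp φ.continuous).subtype_mk _
  have hfc : Continuous fun s : sphere (0 : ℂ) 1 => f (φ s) := by
    simp only [← ha]
    exact continuous_subtype_val.comp (ψ.continuous.comp a.continuous)
  have hψz : ∀ s, (ψ s : ℂ) - z ≠ 0 := by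
    intro s h
    have := (ψ s).2
    rw [sub_eq_zero.1 h] at this
    exact this.2 hz
  have hfz : ∀ s, f (φ s) - z ≠ 0 := fun s => by rw [← ha]; exact hψz _
  have hsl : ∀ s, (F (φ s) - z) / (f (φ s) - z) ∈ Complex.slitPlane := by
    intro s
    have h1 : (F (φ s) - z) / (f (φ s) - z) = 1 + (F (φ s) - f (φ s)) / (f (φ s) - z) := by
      field_simp [hfz s]
      ring
    rw [h1]
    apply Complex.mem_slitPlane_of_norm_lt_one
    rw [norm_div, div_lt_one (norm_pos_iff.2 (hfz s))]
    exact hFf _ (φ s).2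
  have hFφ : Continuous fun s : sphere (0 : ℂ) 1 => F (φ s) := hFr.comp hι
  obtain ⟨h, hh, hbe⟩ := aux_comp a hn (fun s => (ψ s : ℂ) - z)
    ((continuous_subtype_val.comp ψ.continuous).sub continuous_const) hψz
    (fun s => κ (ι s) - Complex.log ((F (φ s) - z) / (f (φ s) - z)))
    ((hκ.comp hι).sub (Continuous.clog (Continuous.div (hFφ.sub continuous_const)
      (hfc.sub continuous_const) hfz) hsl))
    (by
      intro s
      have h0 := Complex.slitPlane_ne_zero (hsl s)
      have h1 : F (φ s) - z ≠ 0 := fun h => h0 (by rw [h, zero_div])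
      rw [Complex.exp_sub, Complex.exp_log h0, hκe, ha]
      field_simp [hfz s]
      rfl)
  refine aux_borsuk Ω hΩ z hz (fun w => h (ψ.symm w)) (hh.comp ψ.symm.continuous) ?_
  intro w
  rw [← hbe, Homeomorph.apply_symm_apply]

theorem aux_compact_volume {X : Type*} [MetricSpace X] [MeasurableSpace X] [BorelSpace X]
    {T : Set X} (hT : IsCompact T)
    (e : closedBall (0 : ℂ) 1 ≃ₜ T) (f : X → ℂ)
    {Ω : Set ℂ} (hΩ : IsCompact Ω) (hmaps : Set.MapsTo f (frontier T) (frontier Ω))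
    (hfc : ContinuousOn f (frontier T)) {L : ℝ} (hL : 0 < L)
    (hf : ∀ x ∈ frontier T, ∀ y ∈ frontier T,
      edist (f x) (f y) ≤ ENNReal.ofReal L * extDist x y)
    (φ : sphere (0 : ℂ) 1 ≃ₜ frontier T) (ψ : sphere (0 : ℂ) 1 ≃ₜ frontier Ω)
    (a : C(sphere (0 : ℂ) 1, sphere (0 : ℂ) 1)) (hn : ¬ a.Nullhomotopic)
    (ha : ∀ s, (ψ (a s) : ℂ) = f (φ s)) (K : Set ℂ) (hK : IsCompact K) (hKΩ : K ⊆ interior Ω) :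
    volume K ≤ ENNReal.ofReal (L ^ 2) * μH[2] T := by
  have hsub : frontier T ⊆ T := hT.isClosed.frontier_subset
  have hS : IsCompact (frontier T) := hT.of_isClosed_subset isClosed_frontier hsub
  obtain ⟨η, hη, hηK⟩ := hK.exists_thickening_subset_open isOpen_interior hKΩ
  obtain ⟨δ, hδ, hδη⟩ : ∃ δ : ℝ, 0 < δ ∧ 2 * (L * δ) < η := by
    refine ⟨η / (4 * L), by positivity, ?_⟩
    field_simp
    linarith
  obtain ⟨ε, hε, hkey⟩ := aux_key hT hS f hfc hL hf hδ
  obtain ⟨B, hB⟩ := (hS.image_of_continuousOn hfc).isBounded.exists_norm_le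
  have hB' : ∀ x ∈ frontier T, ‖f x‖ ≤ B := fun x hx => hB _ (mem_image_of_mem f hx)
  obtain ⟨F₁, hF₁, hF₁f⟩ := aux_mcshane hsub (fun x => (f x).re)
    (fun x hx => (Complex.abs_re_le_norm _).trans (hB' x hx)) hL hε hδ (by
      intro x hx y hy l hr
      rw [← Complex.sub_re]
      refine (Complex.abs_re_le_norm _).trans ?_
      rw [← dist_eq_norm]
      exact hkey x hx y hy l hr)
  obtain ⟨F₂, hF₂, hF₂f⟩ := aux_mcshane hsub (fun x => (f x).im)
    (fun x hx => (Complex.abs_im_le_norm _).trans (hB' x hx)) hL hε hδ (by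
      intro x hx y hy l hr
      rw [← Complex.sub_im]
      refine (Complex.abs_im_le_norm _).trans ?_
      rw [← dist_eq_norm]
      exact hkey x hx y hy l hr)
  have hcont : ∀ G : X → ℝ, (∀ x ∈ T, ∀ y ∈ T, dist x y < ε → |G x - G y| ≤ L * dist x y) →
      ContinuousOn G T := by
    intro G hG
    rw [Metric.continuousOn_iff]
    intro x hx c hc
    refine ⟨min ε (c / L), lt_min hε (by positivity), fun y hy hyx => ?_⟩
    rw [Real.dist_eq]
    refine (hG y hy x hx (hyx.trans_le (min_le_left _ _))).trans_lt ?_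
    have := hyx.trans_le (min_le_right _ _)
    rw [lt_div_iff₀ hL] at this
    linarith
  let F : X → ℂ := fun x => ⟨F₁ x, F₂ x⟩
  have hFc : ContinuousOn F T := by
    have h1 := Complex.continuous_ofReal.comp_continuousOn (hcont F₁ hF₁)
    have h2 := Complex.continuous_ofReal.comp_continuousOn (hcont F₂ hF₂)
    have h3 := h1.add (h2.mul (continuousOn_const (c := Complex.I)))
    refine h3.congr fun x _ => ?_
    exact Complex.mk_eq_add_mul_I _ _
  have hKF : K ⊆ F '' T := by
    intro z hz
    refine aux_degree hT e F f hFc hΩ hmaps φ ψ a hn ha z (hKΩ hz) ?_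
    intro x hx
    have h1 : ‖F x - f x‖ ≤ |(F x - f x).re| + |(F x - f x).im| := Complex.norm_le_abs_re_add_abs_im _
    have h2 : |(F x - f x).re| ≤ L * δ := hF₁f x hx
    have h3 : |(F x - f x).im| ≤ L * δ := hF₂f x hx
    have h4 : η ≤ ‖f x - z‖ := by
      by_contra hlt
      push Not at hlt
      have : f x ∈ thickening η K := mem_thickening_iff.2 ⟨z, hz, by rwa [dist_eq_norm]⟩
      exact (hmaps hx).2 (hηK this)
    linarith
  refine (measure_mono hKF).trans ?_
  rw [aux_volume_complex, image_image]
  refine aux_image_measure hT (fun x => (F₁ x, F₂ x)) hL hε ?_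
  intro x hx y hy hxy
  rw [Prod.dist_eq]
  exact max_le (hF₁ x hx y hy hxy) (hF₂ x hx y hy hxy)

/-- **Area estimate for triangles.**  There is an absolute constant `K > 0` such that:
if `(X,d)` is a metric surface of locally finite Hausdorff 2-measure, `T ⊆ X` a
triangular disk, `Ω ⊆ ℝ² (= ℂ)` a closed Jordan region, and `f : ∂T → ∂Ω` is
`L`-Lipschitz with respect to the extended length metric `d̄` on `∂T` and has non-zero
topological degree (i.e. the induced circle map is not null-homotopic), then
`H²(Ω) ≤ K L² H²_d(T)`. -/
theorem triangle_area_estimate :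
    ∃ K : ℝ, 0 < K ∧
      ∀ (X : Type*) [MetricSpace X] [MeasurableSpace X] [BorelSpace X],
        IsMetricSurface X → IsLocallyFiniteMeasure (mu2 X) →
        ∀ (T : Set X) (p q r : X) (G₁ G₂ G₃ : Set X),
          IsTriangularDiskWith T p q r G₁ G₂ G₃ →
          ∀ Ω : Set ℂ, IsClosedJordanRegion Ω →
            ∀ L : ℝ, 0 < L →
              ∀ f : X → ℂ,
                (∀ x ∈ frontier T, ∀ y ∈ frontier T,
                  edist (f x) (f y) ≤ ENNReal.ofReal L * extDist x y) →
                ∀ hmaps : Set.MapsTo f (frontier T) (frontier Ω),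
                  (∃ (φ : ↥(Metric.sphere (0 : ℂ) 1) ≃ₜ ↥(frontier T))
                      (ψ : ↥(Metric.sphere (0 : ℂ) 1) ≃ₜ ↥(frontier Ω))
                      (hc : Continuous fun z : ↥(Metric.sphere (0 : ℂ) 1) =>
                        ψ.symm (hmaps.restrict f (frontier T) (frontier Ω) (φ z))),
                    ¬ ContinuousMap.Nullhomotopic
                        (⟨fun z => ψ.symm (hmaps.restrict f (frontier T) (frontier Ω) (φ z)),
                          hc⟩ :
                          C(↥(Metric.sphere (0 : ℂ) 1), ↥(Metric.sphere (0 : ℂ) 1)))) →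
                  volume Ω ≤ ENNReal.ofReal (K * L ^ 2) * mu2 X T := by
  refine ⟨4 / Real.pi, by positivity, ?_⟩
  intro X _ _ _ _ _ T p q r G₁ G₂ G₃ hTri Ω hJ L hL f hf hmaps hdeg
  obtain ⟨⟨e, -⟩, hg₁, hg₂, hg₃, hfr, -, -, -⟩ := hTri
  obtain ⟨e', -⟩ := hJ
  obtain ⟨φ, ψ, hc, hn⟩ := hdeg
  have hT : IsCompact T := by
    have : CompactSpace T := e.compactSpace
    exact isCompact_iff_compactSpace.2 this
  have hΩ : IsCompact Ω := by
    have : CompactSpace Ω := e'.compactSpace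
    exact isCompact_iff_compactSpace.2 this
  set a : C(sphere (0 : ℂ) 1, sphere (0 : ℂ) 1) :=
    ⟨fun z => ψ.symm (hmaps.restrict f (frontier T) (frontier Ω) (φ z)), hc⟩ with ha_def
  have ha : ∀ s, (ψ (a s) : ℂ) = f (φ s) := by
    intro s
    simp [a]
  have hfc : ContinuousOn f (frontier T) := by
    rw [continuousOn_iff_continuous_domRestrict]
    have h1 : Continuous fun x : frontier T => (ψ (a (φ.symm x)) : ℂ) :=
      continuous_subtype_val.comp (ψ.continuous.comp (a.continuous.comp φ.symm.continuous))
    refine h1.congr fun x => ?_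
    rw [ha]
    simp
  have hfrontier : volume (frontier Ω) = 0 := by
    have hsurj : frontier Ω ⊆ f '' (G₁ ∪ G₂ ∪ G₃) := by
      intro w hw
      obtain ⟨s, hs⟩ := aux_surj a hn (ψ.symm ⟨w, hw⟩)
      refine ⟨φ s, hfr ▸ (φ s).2, ?_⟩
      rw [← ha, hs]
      simp
    have hnull : ∀ (G : Set X) (p q : X), IsGeodesicArc G p q → G ⊆ frontier T →
        volume (f '' G) = 0 := by
      rintro G p q ⟨γ, ⟨hγc, hγl, -⟩, -, -, -, rfl⟩ hG
      exact aux_curve_null γ hγc hγl f hL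
        (fun s t => hf _ (hG ⟨s, rfl⟩) _ (hG ⟨t, rfl⟩))
    refine measure_mono_null hsurj ?_
    rw [image_union, image_union]
    refine measure_union_null (measure_union_null ?_ ?_) ?_
    · exact hnull _ _ _ hg₁ (hfr ▸ fun x hx => Or.inl (Or.inl hx))
    · exact hnull _ _ _ hg₂ (hfr ▸ fun x hx => Or.inl (Or.inr hx))
    · exact hnull _ _ _ hg₃ (hfr ▸ fun x hx => Or.inr hx)
  have hint : volume (interior Ω) ≤ ENNReal.ofReal (L ^ 2) * μH[2] T := by
    rw [isOpen_interior.measure_eq_iSup_isCompact]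
    refine iSup₂_le fun K hKΩ => iSup_le fun hK => ?_
    exact aux_compact_volume hT e f hΩ hmaps hfc hL hf φ ψ a hn ha K hK hKΩ
  have hsplit : Ω ⊆ interior Ω ∪ frontier Ω := by
    rw [← closure_eq_interior_union_frontier]
    exact subset_closure
  calc volume Ω ≤ volume (interior Ω) + volume (frontier Ω) :=
        (measure_mono hsplit).trans (measure_union_le _ _)
    _ ≤ ENNReal.ofReal (L ^ 2) * μH[2] T := by rw [hfrontier, add_zero]; exact hint
    _ = ENNReal.ofReal (4 / Real.pi * L ^ 2) * mu2 X T := by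
      have hpi := Real.pi_pos
      rw [mu2, Measure.smul_apply, smul_eq_mul, ← mul_assoc,
        ← ENNReal.ofReal_mul (by positivity)]
      congr 2
      field_simp
end

section
/- Let X be a compact, locally connected metric space and {X_n}_{n=1}^∞ a sequence of compact metric spaces. Suppose there exists an approximately isometric sequence of maps f_n : X_n → X, each f_n being a topological embedding, and an approximately isometric sequence of retractions R_n : X → f_n(X_n). Then the sequence {X_n}_{n=1}^∞ is asymptotically uniformly locally path connected. -/
open Set Metric Filter
open scoped ENNReal unitInterval Topology

/-- A (not necessarily continuous) map `f : X → Y` between metric spaces is an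
`ε`-isometry if it distorts distances by less than `ε` and its image is `ε`-dense. -/
def IsEpsIsometry {X Y : Type*} [MetricSpace X] [MetricSpace Y] (f : X → Y) (ε : ℝ) : Prop :=
  (∀ x y : X, |dist (f x) (f y) - dist x y| < ε) ∧ ∀ z : Y, ∃ x : X, dist z (f x) < ε

/-- A sequence of maps `f n : Xs n → X` is approximately isometric if `f n` is an
`ε n`-isometry for some sequence `ε n → 0`. -/
def ApproxIsometricSeq {Xs : ℕ → Type*} [∀ n, MetricSpace (Xs n)] {X : Type*} [MetricSpace X]
    (f : ∀ n, Xs n → X) : Prop :=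
  ∃ ε : ℕ → ℝ, Tendsto ε atTop (𝓝 0) ∧ ∀ n, IsEpsIsometry (f n) (ε n)

/-- A sequence of metric spaces is asymptotically uniformly locally path connected:
for each `ε > 0` there are `δ > 0` and `N` such that for `n ≥ N` any two points of
`Xs n` at distance less than `δ` are joined by a curve of diameter less than `ε`. -/
def AULPC (Xs : ℕ → Type*) [∀ n, MetricSpace (Xs n)] : Prop :=
  ∀ ε : ℝ, 0 < ε → ∃ δ : ℝ, 0 < δ ∧ ∃ N : ℕ, ∀ n, N ≤ n →
    ∀ x y : Xs n, dist x y < δ →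
      ∃ γ : I → Xs n, Continuous γ ∧ γ 0 = x ∧ γ 1 = y ∧ Metric.diam (Set.range γ) < ε

def LGood {X : Type*} [MetricSpace X] (δ : ℝ) (x y : X) (a b : ℝ) (h : ℝ → X) : Prop :=
  (∀ t, ∀ᶠ s in 𝓝 t, dist (h s) (h t) < δ) ∧ (∀ t ≤ a, h t = x) ∧ (∀ t, b ≤ t → h t = y)

lemma LGood.trans {X : Type*} [MetricSpace X] {δ : ℝ} {x y z : X} {a b c : ℝ} {h k : ℝ → X}
    (hab : a ≤ b) (hbc : b < c) (H : LGood δ x y a b h) (K : LGood δ y z b c k) :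
    LGood δ x z a c (fun t => if t ≤ b then h t else k t) := by
  obtain ⟨h1, h2, h3⟩ := H
  obtain ⟨k1, k2, k3⟩ := K
  refine ⟨fun t => ?_, fun t ht => ?_, fun t ht => ?_⟩
  · rcases lt_trichotomy t b with hl | rfl | hl
    · filter_upwards [h1 t, Iio_mem_nhds hl] with s hs hs2
      have : s < b := hs2
      simpa [hl.le, this.le] using hs
    · filter_upwards [h1 t, k1 t] with s hs hs2
      have e : h t = k t := by rw [h3 t le_rfl, k2 t le_rfl]
      by_cases hst : s ≤ t
      · simpa [hst] using hs
      · simpa [hst, e] using hs2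
    · filter_upwards [k1 t, Ioi_mem_nhds hl] with s hs hs2
      have : b < s := hs2
      simpa [not_le.2 hl, not_le.2 this] using hs
  · simpa [ht.trans hab] using h2 t ht
  · have : ¬ t ≤ b := by linarith
    simpa [this] using k3 t ht

lemma LGood.step {X : Type*} [MetricSpace X] {δ : ℝ} {x y : X} (hxy : dist x y < δ) {a b : ℝ}
    (hab : a < b) : LGood δ x y a b (fun t => if t ≤ a then x else y) := by
  have hδ : 0 < δ := dist_nonneg.trans_lt hxy
  refine ⟨fun t => Eventually.of_forall fun s => ?_, fun t ht => by simp [ht], fun t ht => ?_⟩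
  · try dsimp only
    split_ifs <;> simp [hδ, hxy, dist_comm y x]
  · have : ¬ t ≤ a := by linarith
    simp [this]

lemma chain_of_preconnected {X : Type*} [MetricSpace X] {C : Set X} (hC : IsPreconnected C)
    {δ : ℝ} (hδ : 0 < δ) {x y : X} (hx : x ∈ C) (hy : y ∈ C) :
    ∀ a b : ℝ, a < b → ∃ h, LGood δ x y a b h ∧ ∀ t, h t ∈ C := by
  have := hC.induction₂' (fun x y => x ∈ C → y ∈ C → ∀ a b : ℝ, a < b →
    ∃ h, LGood δ x y a b h ∧ ∀ t, h t ∈ C) ?_ ?_ hx hy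
  · exact this hx hy
  · intro u hu
    filter_upwards [mem_nhdsWithin_of_mem_nhds (Metric.ball_mem_nhds u hδ)] with v hv
    refine ⟨fun h1 h2 a b hab => ⟨_, LGood.step (by simpa [dist_comm] using hv) hab, ?_⟩,
      fun h1 h2 a b hab => ⟨_, LGood.step (by simpa using hv) hab, ?_⟩⟩ <;>
    · intro t
      try dsimp only
      split_ifs <;> assumption
  · intro u v w hu hv hw H K _ _ a b hab
    obtain ⟨h, h1, h2⟩ := H hu hv a ((a+b)/2) (by linarith)
    obtain ⟨k, k1, k2⟩ := K hv hw ((a+b)/2) b (by linarith)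
    refine ⟨_, h1.trans (by linarith) (by linarith) k1, fun t => ?_⟩
    try dsimp only
    split_ifs
    · exact h2 t
    · exact k2 t

lemma unif_conn (X : Type*) [MetricSpace X] [CompactSpace X] [LocallyConnectedSpace X]
    {ε : ℝ} (hε : 0 < ε) : ∃ δ > 0, ∀ x y : X, dist x y < δ →
      ∃ C : Set X, IsPreconnected C ∧ x ∈ C ∧ y ∈ C ∧ ∀ u ∈ C, ∀ v ∈ C, dist u v < ε := by
  have h := fun x : X => locallyConnectedSpace_iff_subsets_isOpen_isConnected.1
    (inferInstance : LocallyConnectedSpace X) x (ball x (ε/2)) (Metric.ball_mem_nhds x (by linarith))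
  choose V hV1 hV2 hV3 hV4 using h
  obtain ⟨δ, hδ, H⟩ := lebesgue_number_lemma_of_metric (s := (univ : Set X)) isCompact_univ hV2
    (fun x _ => mem_iUnion.2 ⟨x, hV3 x⟩)
  refine ⟨δ, hδ, fun x y hxy => ?_⟩
  obtain ⟨i, hi⟩ := H x (mem_univ x)
  refine ⟨V i, (hV4 i).isPreconnected, hi (mem_ball_self hδ), hi (by simpa [dist_comm] using hxy),
    fun u hu v hv => ?_⟩
  have h1 := hV1 i hu
  have h2 := hV1 i hv
  rw [mem_ball] at h1 h2
  linarith [dist_triangle_right u v i]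

lemma LGood.unif {X : Type*} [MetricSpace X] {δ : ℝ} {x y : X} {g : ℝ → X}
    (H : LGood δ x y 0 1 g) : ∃ N : ℕ, 0 < N ∧ ∀ s ∈ Icc (0:ℝ) 1, ∀ t, |t - s| ≤ 1 / N →
      dist (g s) (g t) < 2 * δ := by
  have h1 := fun t => Metric.eventually_nhds_iff.1 (H.1 t)
  choose r hr hr2 using h1
  obtain ⟨η, hη, K⟩ := lebesgue_number_lemma_of_metric (s := Icc (0:ℝ) 1)
    (c := fun t : ℝ => ball t (r t)) isCompact_Icc (fun _ => isOpen_ball)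
    (fun t _ => mem_iUnion.2 ⟨t, mem_ball_self (hr t)⟩)
  obtain ⟨n, hn⟩ := exists_nat_one_div_lt hη
  refine ⟨n + 1, n.succ_pos, fun s hs t hst => ?_⟩
  obtain ⟨i, hi⟩ := K s hs
  have a1 := hr2 i (hi (mem_ball_self hη))
  have a2 : dist (g t) (g i) < δ := hr2 i (hi (by
    rw [mem_ball, Real.dist_eq]; push_cast at hst; linarith))
  linarith [dist_triangle_right (g s) (g t) (g i)]

lemma refine_path (X : Type*) [MetricSpace X] [CompactSpace X] [LocallyConnectedSpace X]
    {ε : ℝ} (hε : 0 < ε) : ∃ δ > 0, δ ≤ ε ∧ ∀ (x y : X) (g : ℝ → X), LGood δ x y 0 1 g →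
      ∀ δ' > 0, ∃ g', LGood δ' x y 0 1 g' ∧ ∀ t, dist (g t) (g' t) ≤ ε := by
  obtain ⟨δ, hδ, U⟩ := unif_conn X (half_pos hε)
  refine ⟨min (δ/2) (ε/4), by positivity, (min_le_right _ _).trans (by linarith), ?_⟩
  intro x y g hg δ' hδ'
  obtain ⟨N, hN, hgN⟩ := hg.unif
  have m1 := min_le_left (δ/2) (ε/4)
  have m2 := min_le_right (δ/2) (ε/4)
  have hN' : (0:ℝ) < N := by exact_mod_cast hN
  have key : ∀ i : ℕ, i ≤ N → ∃ h, LGood δ' x (g (i/N)) 0 (i/N) h ∧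
      ∀ t ≤ (i/N : ℝ), dist (g t) (h t) ≤ ε := by
    intro i
    induction i with
    | zero =>
      intro _
      refine ⟨fun _ => x, ⟨fun t => by simp [hδ'], fun _ _ => rfl, fun t _ => ?_⟩, fun t ht => ?_⟩
      · simp [hg.2.1 0 le_rfl]
      · rw [hg.2.1 t (by simpa using ht)]; simp [hε.le]
    | succ i ih =>
      intro hi
      obtain ⟨h, h1, h2⟩ := ih (by omega)
      have hi' : ((i:ℝ) + 1) ≤ N := by exact_mod_cast hi
      have hs : (i / N : ℝ) ∈ Icc (0:ℝ) 1 :=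
        ⟨by positivity, by rw [div_le_one hN']; linarith⟩
      have e : (((i+1 : ℕ) : ℝ) / N) = i / N + 1 / N := by push_cast; ring
      have p : (0:ℝ) < 1 / N := by positivity
      have d1 := hgN _ hs (((i+1 : ℕ) : ℝ) / N) (by rw [e]; simp)
      obtain ⟨C, hC, c1, c2, c3⟩ := U _ _ (d1.trans_le (by linarith))
      obtain ⟨k, k1, k2⟩ := chain_of_preconnected hC hδ' c1 c2 (i/N) (((i+1 : ℕ) : ℝ) / N)
        (by rw [e]; linarith)
      refine ⟨_, h1.trans hs.1 (by rw [e]; linarith) k1, fun t ht => ?_⟩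
      try dsimp only
      split_ifs with hti
      · exact h2 t hti
      · have d2 := hgN _ hs t (by rw [e] at ht; rw [abs_le]; constructor <;> linarith)
        have d3 := c3 _ c1 _ (k2 t)
        linarith [dist_triangle_left (g t) (k t) (g (i/N))]
  obtain ⟨h, h1, h2⟩ := key N le_rfl
  rw [div_self hN'.ne', hg.2.2 1 le_rfl] at h1
  rw [div_self hN'.ne'] at h2
  refine ⟨h, h1, fun t => ?_⟩
  rcases le_total t 1 with ht | ht
  · exact h2 t ht
  · rw [hg.2.2 t ht, h1.2.2 t ht]; simp [hε.le]

lemma ulpc (X : Type*) [MetricSpace X] [CompactSpace X] [LocallyConnectedSpace X]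
    {ε : ℝ} (hε : 0 < ε) : ∃ δ > 0, ∀ x y : X, dist x y < δ →
      ∃ γ : ℝ → X, Continuous γ ∧ γ 0 = x ∧ γ 1 = y ∧ ∀ s t, dist (γ s) (γ t) ≤ ε := by
  obtain ⟨C, hC, hCε⟩ : ∃ C : ℝ, 0 < C ∧ 3 * C ≤ ε := ⟨ε/3, by positivity, by linarith⟩
  have h := fun n : ℕ => refine_path X (ε := C / 2 / 2 ^ n) (by positivity)
  choose δ hδ hδ2 F using h
  have hδ0 : δ 0 ≤ C := (hδ2 0).trans (by simp; linarith)
  refine ⟨δ 0, hδ 0, fun x y hxy => ?_⟩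
  have F' := fun (n : ℕ) (g : {g : ℝ → X // LGood (δ n) x y 0 1 g}) =>
    F n x y g.1 g.2 (δ (n+1)) (hδ (n+1))
  choose G hG1 hG2 using F'
  let g : ∀ n : ℕ, {g : ℝ → X // LGood (δ n) x y 0 1 g} := fun n =>
    Nat.rec ⟨_, LGood.step hxy zero_lt_one⟩ (fun n g => ⟨G n g, hG1 n g⟩) n
  have hg : ∀ n t, dist ((g n).1 t) ((g (n+1)).1 t) ≤ C / 2 / 2 ^ n := fun n t => hG2 n (g n) t
  have hlim : ∀ t, ∃ z, Tendsto (fun n => (g n).1 t) atTop (𝓝 z) := fun t =>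
    cauchySeq_tendsto_of_complete (cauchySeq_of_le_geometric_two (C := C) (fun n => hg n t))
  choose γ hγ using hlim
  have hd : ∀ n t, dist ((g n).1 t) (γ t) ≤ C / 2 ^ n := fun n t =>
    dist_le_of_le_geometric_two_of_tendsto (C := C) (fun n => hg n t) (hγ t) n
  refine ⟨γ, ?_, ?_, ?_, fun s t => ?_⟩
  · rw [continuous_iff_continuousAt]
    intro t
    rw [ContinuousAt, Metric.tendsto_nhds]
    intro e he
    obtain ⟨n, hn⟩ : ∃ n : ℕ, C / 2 ^ n < e / 3 := by
      obtain ⟨n, hn⟩ := exists_pow_lt_of_lt_one (show 0 < e / 3 / C by positivity)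
        (show (1/2 : ℝ) < 1 by norm_num)
      refine ⟨n, ?_⟩
      rw [lt_div_iff₀ hC] at hn
      simpa [div_eq_mul_inv, mul_comm] using hn
    filter_upwards [(g n).2.1 t] with s hs
    have a1 := hd n s
    have a2 := hd n t
    have a3 := hδ2 n
    have a4 : C / 2 / 2 ^ n = C / 2 ^ n / 2 := by ring
    have a5 : 0 < C / 2 ^ n := by positivity
    have := dist_triangle4 (γ s) ((g n).1 s) ((g n).1 t) (γ t)
    rw [dist_comm (γ s) ((g n).1 s)] at this
    linarith
  · exact tendsto_nhds_unique (hγ 0) (by simp [fun n => (g n).2.2.1 0 le_rfl])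
  · exact tendsto_nhds_unique (hγ 1) (by simp [fun n => (g n).2.2.2 1 le_rfl])
  · have a1 := hd 0 s
    have a2 := hd 0 t
    simp only [pow_zero, div_one] at a1 a2
    have a3 : dist ((g 0).1 s) ((g 0).1 t) ≤ C := by
      show dist (if s ≤ 0 then x else y) (if t ≤ 0 then x else y) ≤ C
      have hyx := dist_comm y x
      split_ifs <;> first | linarith | simp [hC.le]
    have := dist_triangle4 (γ s) ((g 0).1 s) ((g 0).1 t) (γ t)
    rw [dist_comm (γ s) ((g 0).1 s)] at this
    linarith

/-- If `X` is a compact locally connected metric space, `Xs n` are compact metric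
spaces, `f n : Xs n → X` is an approximately isometric sequence of topological
embeddings, and `R n : X → fₙ(Xs n)` is an approximately isometric sequence of
retractions, then the sequence `Xs` is asymptotically uniformly locally path
connected. -/
theorem aulpc_of_embeddings_and_retractions
    {X : Type*} [MetricSpace X] [CompactSpace X] [LocallyConnectedSpace X]
    (Xs : ℕ → Type*) [∀ n, MetricSpace (Xs n)] [∀ n, CompactSpace (Xs n)]
    (f : ∀ n, Xs n → X) (hemb : ∀ n, Topology.IsEmbedding (f n))
    (hf : ApproxIsometricSeq f)
    (R : ℕ → X → X)
    (hRcont : ∀ n, Continuous (R n))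
    (hRinto : ∀ n, ∀ x : X, R n x ∈ Set.range (f n))
    (hRretr : ∀ n, ∀ y ∈ Set.range (f n), R n y = y)
    (hRapprox : ∃ δ : ℕ → ℝ, Tendsto δ atTop (𝓝 0) ∧
      ∀ n, ∀ x y : X, |dist (R n x) (R n y) - dist x y| < δ n) :
    AULPC Xs := by
  intro ε hε
  obtain ⟨e, he0, he⟩ := hf
  obtain ⟨d, hd0, hd⟩ := hRapprox
  obtain ⟨δ, hδ, H⟩ := ulpc X (show 0 < ε / 4 by linarith)
  have E := ((he0.eventually (gt_mem_nhds (show (0:ℝ) < min (δ/2) (ε/4) by positivity))).and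
    (hd0.eventually (gt_mem_nhds (show (0:ℝ) < ε/4 by positivity))))
  obtain ⟨N, hN⟩ := eventually_atTop.1 E
  refine ⟨δ/2, by positivity, N, fun n hn x y hxy => ?_⟩
  obtain ⟨b1, b2⟩ := hN n hn
  have b3 := b1.trans_le (min_le_left _ _)
  have b4 := b1.trans_le (min_le_right _ _)
  have b5 := abs_lt.1 ((he n).1 x y)
  obtain ⟨γ, g1, g2, g3, g4⟩ := H (f n x) (f n y) (by linarith [b5.2])
  choose k hk using fun t : I => hRinto n (γ t)
  refine ⟨k, ?_, ?_, ?_, ?_⟩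
  · rw [(hemb n).continuous_iff]
    have : f n ∘ k = fun t : I => R n (γ t) := funext hk
    rw [this]
    exact (hRcont n).comp (g1.comp continuous_subtype_val)
  · apply (hemb n).injective
    rw [hk]
    rw [show ((0 : I) : ℝ) = 0 from rfl, g2]
    exact hRretr n _ ⟨x, rfl⟩
  · apply (hemb n).injective
    rw [hk]
    rw [show ((1 : I) : ℝ) = 1 from rfl, g3]
    exact hRretr n _ ⟨y, rfl⟩
  · have e0 := (abs_nonneg _).trans_lt ((he n).1 x x)
    have d0 := (abs_nonneg _).trans_lt (hd n (f n x) (f n x))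
    refine lt_of_le_of_lt (Metric.diam_le_of_forall_dist_le (C := ε/4 + d n + e n)
      (by linarith) ?_) (by linarith)
    rintro _ ⟨s, rfl⟩ _ ⟨t, rfl⟩
    have c1 := abs_lt.1 ((he n).1 (k s) (k t))
    rw [hk, hk] at c1
    have c2 := abs_lt.1 (hd n (γ s) (γ t))
    linarith [g4 s t, c1.1, c2.2]
end

section
/- Let {X_n}_{n=1}^∞ be an asymptotically uniformly locally path connected sequence of metric spaces, let X be a metric space, and let f_n : X_n → X be an approximately isometric sequence of maps. Then for every path γ : [0,1] → X and all sequences of points a_n, b_n ∈ X_n with f_n(a_n) → γ(0) and f_n(b_n) → γ(1) as n → ∞, there exist N ∈ ℕ and paths γ_n : [0,1] → X_n for n ≥ N such that γ_n(0) = a_n, γ_n(1) = b_n, and f_n ∘ γ_n converges uniformly to γ as n → ∞. -/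
open Set Metric Filter
open scoped ENNReal unitInterval Topology

theorem glue_aux {Y : Type*} [MetricSpace Y] (ε : ℝ) (hε : 0 < ε) (p : ℕ → Y)  (k : ℕ)
    (h : ∀ i, i < k → ∃ d : ℝ → Y, Continuous d ∧ d 0 = p i ∧ d 1 = p (i+1) ∧
      ∀ t, dist (d t) (p i) < ε) :
    ∃ c : ℝ → Y, Continuous c ∧ c 0 = p 0 ∧ c k = p k ∧
      ∀ t : ℝ, 0 ≤ t → t ≤ k → ∃ i : ℕ, (i : ℝ) ≤ t ∧ t ≤ i + 1 ∧ dist (c t) (p i) < ε := by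
  induction k with
  | zero =>
    refine ⟨fun _ => p 0, continuous_const, rfl, rfl, fun t h0 h1 => ⟨0, ?_, ?_, ?_⟩⟩
    · simpa using h0
    · have : t ≤ 0 := by simpa using h1
      push_cast; linarith
    · simpa using hε
  | succ k ih =>
    obtain ⟨c, hc, c0, ck, hcc⟩ := ih (fun i hi => h i (by omega))
    obtain ⟨d, hd, d0, d1, hdd⟩ := h k (by omega)
    have hk : (0:ℝ) ≤ k := Nat.cast_nonneg k
    refine ⟨fun t => if t ≤ k then c t else d (t - k), ?_, ?_, ?_, ?_⟩
    · refine Continuous.if_le hc (by fun_prop) continuous_id continuous_const ?_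
      intro t ht
      have : t = k := ht
      subst this
      simp [ck, d0]
    · simp [c0, hk]
    · have : ¬ (((k+1 : ℕ) : ℝ) ≤ k) := by push_cast; linarith
      simp only [this, if_false]
      rw [← d1]; congr 1; push_cast; ring
    · intro t h0 h1
      by_cases ht : t ≤ k
      · obtain ⟨i, h2, h3, h4⟩ := hcc t h0 ht
        exact ⟨i, h2, h3, by simpa [ht] using h4⟩
      · push_cast at h1
        refine ⟨k, by linarith, h1, ?_⟩
        simpa [ht] using hdd (t - k)

theorem claim_aux
    (Xs : ℕ → Type*) [∀ n, MetricSpace (Xs n)] {X : Type*} [MetricSpace X]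
    (hXs : AULPC Xs)
    (f : ∀ n, Xs n → X) (hf : ApproxIsometricSeq f)
    (γ : I → X) (hγ : Continuous γ)
    (a b : ∀ n, Xs n)
    (ha : Tendsto (fun n => f n (a n)) atTop (𝓝 (γ 0)))
    (hb : Tendsto (fun n => f n (b n)) atTop (𝓝 (γ 1))) (ε : ℝ) (hε : 0 < ε) :
    ∃ N : ℕ, ∀ n, N ≤ n → ∃ g : I → Xs n, Continuous g ∧ g 0 = a n ∧ g 1 = b n ∧
      ∀ t, dist (γ t) (f n (g t)) < ε := by
  obtain ⟨e, he, hfe⟩ := hf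
  obtain ⟨δ, hδ, N0, hN0⟩ := hXs (ε/4) (by positivity)
  obtain ⟨s, hs, hsδ, hsε⟩ : ∃ s : ℝ, 0 < s ∧ s ≤ δ/8 ∧ s ≤ ε/8 :=
    ⟨min (δ/8) (ε/8), by positivity, min_le_left _ _, min_le_right _ _⟩
  have huc := CompactSpace.uniformContinuous_of_continuous hγ
  obtain ⟨η, hη, huc⟩ := Metric.uniformContinuous_iff.1 huc s hs
  obtain ⟨m, hm⟩ := exists_nat_gt (1/η)
  have hm0 : (0:ℝ) < m := lt_trans (by positivity) hm
  have hmη : 1 / (m:ℝ) < η := by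
    rw [div_lt_iff₀ hη] at hm
    rw [div_lt_iff₀ hm0]; linarith
  let P : ℝ → I := Set.projIcc 0 1 zero_le_one
  have hP : ∀ x y : ℝ, |x - y| ≤ 1 → dist (γ (P (x/m))) (γ (P (y/m))) < s := by
    intro x y hxy
    apply huc
    refine lt_of_le_of_lt ?_ hmη
    have h1 : dist (P (x/m)) (P (y/m)) ≤ |x/m - y/m| := by
      rw [Subtype.dist_eq, Real.dist_eq]
      exact Set.abs_projIcc_sub_projIcc zero_le_one
    refine h1.trans ?_
    rw [← sub_div, abs_div, abs_of_pos hm0]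
    gcongr
  have E := (((he.eventually (gt_mem_nhds hs)).and (eventually_ge_atTop N0)).and
    ((Metric.tendsto_nhds.1 ha s hs).and (Metric.tendsto_nhds.1 hb s hs)))
  obtain ⟨N, hN⟩ := eventually_atTop.1 E
  refine ⟨N, fun n hn => ?_⟩
  obtain ⟨⟨hen, hn0⟩, han, hbn⟩ := hN n hn
  have hmne : m ≠ 0 := by rintro rfl; simp at hm0
  have hp : ∀ i : ℕ, ∃ q : Xs n, dist (γ (P (i/m))) (f n q) < s ∧ (i = 0 → q = a n) ∧
      (i = m → q = b n) := by
    intro i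
    by_cases h0 : i = 0
    · refine ⟨a n, ?_, fun _ => rfl, fun h => absurd (h.symm.trans h0) hmne⟩
      have : P ((i:ℝ)/m) = 0 := by
        subst h0; simp only [Nat.cast_zero, zero_div]; exact (Set.projIcc_left zero_le_one)
      rw [this, dist_comm]; exact han
    by_cases h1 : i = m
    · refine ⟨b n, ?_, fun h => absurd h h0, fun _ => rfl⟩
      have : P ((i:ℝ)/m) = 1 := by
        rw [h1, div_self hm0.ne']; exact (Set.projIcc_right zero_le_one)
      rw [this, dist_comm]; exact hbn
    · obtain ⟨q, hq⟩ := (hfe n).2 (γ (P (i/m)))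
      exact ⟨q, hq.trans hen, fun h => absurd h h0, fun h => absurd h h1⟩
  choose p hp hpa hpb using hp
  obtain ⟨c, hc, c0, cm, hcc⟩ := glue_aux (ε/4) (by positivity) p m (by
    intro i _
    have hd : dist (p i) (p (i+1)) < δ := by
      have h1 := (abs_lt.1 ((hfe n).1 (p i) (p (i+1)))).1
      have h2 := hP i ((i+1 : ℕ)) (by push_cast; simp)
      have h3 := hp i
      have h4 := hp (i+1)
      have h5 := dist_triangle4 (f n (p i)) (γ (P (i/m))) (γ (P ((i+1 : ℕ)/m))) (f n (p (i+1)))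
      rw [dist_comm (f n (p i)) (γ (P (i/m)))] at h5
      linarith
    obtain ⟨g, hg, g0, g1, hdi⟩ := hN0 n hn0 _ _ hd
    refine ⟨fun t => g (P t), hg.comp continuous_projIcc, ?_, ?_, ?_⟩
    · rw [← g0]; exact congrArg g (Set.projIcc_left zero_le_one)
    · rw [← g1]; exact congrArg g (Set.projIcc_right zero_le_one)
    · intro t
      refine lt_of_le_of_lt ?_ hdi
      rw [← g0]
      exact Metric.dist_le_diam_of_mem (isCompact_range hg).isBounded ⟨_, rfl⟩ ⟨_, rfl⟩)
  refine ⟨fun t => c (m * t), by fun_prop, ?_, ?_, ?_⟩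
  · simp [c0, hpa 0 rfl]
  · simp [cm, hpb m rfl]
  · intro t
    obtain ⟨i, h1, h2, h3⟩ := hcc (m * t) (mul_nonneg hm0.le t.2.1)
      (mul_le_of_le_one_right hm0.le t.2.2)
    have h4 := hP (m * t) i (by rw [abs_le]; constructor <;> linarith)
    have h5 : P ((m * t : ℝ)/m) = t := by
      rw [mul_div_cancel_left₀ _ hm0.ne']; exact Set.projIcc_val _ t
    rw [h5] at h4
    have h6 := hp i
    have h7 := (abs_lt.1 ((hfe n).1 (p i) (c (m*t)))).2
    rw [dist_comm (p i)] at h7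
    have h8 := dist_triangle4 (γ t) (γ (P (i/m))) (f n (p i)) (f n (c (m*t)))
    show dist (γ t) (f n (c (m*t))) < ε
    linarith

/-- **Path lifting along approximately isometric maps.**  If `Xs` is an asymptotically
uniformly locally path connected sequence of metric spaces, and `f n : Xs n → X` is an
approximately isometric sequence, then for each path `γ : [0,1] → X` and points
`a n, b n ∈ Xs n` with `f n (a n) → γ 0` and `f n (b n) → γ 1`, there are `N` and paths
`γs n` in `Xs n` for `n ≥ N` from `a n` to `b n` with `f n ∘ γs n → γ` uniformly. -/
theorem path_lifting
    (Xs : ℕ → Type*) [∀ n, MetricSpace (Xs n)] {X : Type*} [MetricSpace X]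
    (hXs : AULPC Xs)
    (f : ∀ n, Xs n → X) (hf : ApproxIsometricSeq f)
    (γ : I → X) (hγ : Continuous γ)
    (a b : ∀ n, Xs n)
    (ha : Tendsto (fun n => f n (a n)) atTop (𝓝 (γ 0)))
    (hb : Tendsto (fun n => f n (b n)) atTop (𝓝 (γ 1))) :
    ∃ (N : ℕ) (γs : ∀ n, I → Xs n),
      (∀ n, N ≤ n → Continuous (γs n) ∧ γs n 0 = a n ∧ γs n 1 = b n) ∧
      TendstoUniformly (fun n t => f n (γs n t)) γ atTop := by
  classical
  have H := claim_aux Xs hXs f hf γ hγ a b ha hb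
  let Q : ℕ → ℕ → Prop := fun n k => ∃ g : I → Xs n, Continuous g ∧ g 0 = a n ∧ g 1 = b n ∧
      ∀ t, dist (γ t) (f n (g t)) < 1 / ((k:ℝ) + 1)
  have HQ : ∀ k : ℕ, ∃ N, ∀ n, N ≤ n → Q n k := fun k => H (1 / ((k:ℝ) + 1)) (by positivity)
  obtain ⟨N, hN⟩ := HQ 0
  have HS : ∀ n, ∃ g : I → Xs n, N ≤ n → Continuous g ∧ g 0 = a n ∧ g 1 = b n ∧
      ∀ t, dist (γ t) (f n (g t)) < 1 / ((Nat.findGreatest (Q n) n : ℝ) + 1) := by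
    intro n
    by_cases hn : N ≤ n
    · obtain ⟨g, hg⟩ : Q n (Nat.findGreatest (Q n) n) :=
        Nat.findGreatest_spec (Nat.zero_le n) (hN n hn)
      exact ⟨g, fun _ => hg⟩
    · exact ⟨fun _ => a n, fun h => absurd h hn⟩
  choose g hg using HS
  refine ⟨N, g, fun n hn => ⟨(hg n hn).1, (hg n hn).2.1, (hg n hn).2.2.1⟩, ?_⟩
  rw [Metric.tendstoUniformly_iff]
  intro ε hε
  obtain ⟨k, hk⟩ := exists_nat_one_div_lt hε
  obtain ⟨M, hM⟩ := HQ k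
  filter_upwards [eventually_ge_atTop N, eventually_ge_atTop M, eventually_ge_atTop k]
    with n h1 h2 h3 t
  refine ((hg n h1).2.2.2 t).trans_le (le_trans ?_ hk.le)
  have : k ≤ Nat.findGreatest (Q n) n := Nat.le_findGreatest h3 (hM n h2)
  have : (k:ℝ) ≤ Nat.findGreatest (Q n) n := by exact_mod_cast this
  gcongr
end

section
/- Let X be a metric space homeomorphic to the closed unit disk and {X_n}_{n=1}^∞ a sequence of metric spaces, each homeomorphic to X. Suppose there exists an approximately isometric sequence f_n : X_n → X of topological embeddings. Then liminf_{n→∞} diam(∂X_n) ≥ diam(∂X). -/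
open Set Metric Filter
open scoped ENNReal unitInterval Topology

/-- The manifold boundary of a metric space homeomorphic to the closed unit disk,
computed from a homeomorphism `e` with the closed unit disk in the plane `ℂ = ℝ²`: the
image of the unit circle (independent of the choice of `e` by invariance of domain). -/
def diskBoundary {X : Type*} [TopologicalSpace X]
    (e : ↥(Metric.closedBall (0 : ℂ) 1) ≃ₜ X) : Set X :=
  ⇑e '' {x : ↥(Metric.closedBall (0 : ℂ) 1) | (x : ℂ) ∈ Metric.sphere (0 : ℂ) 1}

lemma aux_log_lift_s10 (H : ℂ → ℂ) (hc : Continuous H) (h0 : ∀ z, H z ≠ 0) :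
    ∃ L : ℂ → ℂ, Continuous L ∧ ∀ z, Complex.exp (L z) = H z := by
  obtain ⟨L, ⟨-, hL⟩, -⟩ := Complex.isCoveringMap_exp.existsUnique_continuousMap_lifts
    (A := ℂ) ⟨fun z => (⟨H z, h0 z⟩ : {z : ℂ // z ≠ 0}), by fun_prop⟩ 0 (Complex.log (H 0))
    (by simp [Complex.exp_log (h0 0)])
  exact ⟨L, L.continuous, fun z => by simpa using congrArg Subtype.val (congrFun hL z)⟩

lemma aux_no_ext (H : ↥(Metric.closedBall (0 : ℂ) 1) → ℂ) (hc : Continuous H)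
    (h0 : ∀ z, H z ≠ 0) (p : ℂ) (hp : ‖p‖ < 1)
    (hb : ∀ z : ↥(Metric.closedBall (0 : ℂ) 1), (z : ℂ) ∈ Metric.sphere (0 : ℂ) 1 →
      H z = z - p) : False := by
  let r : ℂ → ↥(Metric.closedBall (0 : ℂ) 1) := fun z =>
    ⟨((max 1 ‖z‖ : ℝ) : ℂ)⁻¹ * z, by
      have h1 : (0 : ℝ) < max 1 ‖z‖ := lt_of_lt_of_le one_pos (le_max_left _ _)
      rw [mem_closedBall_zero_iff, norm_mul, norm_inv, Complex.norm_real, Real.norm_of_nonneg h1.le,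
        inv_mul_le_one₀ h1]
      exact le_max_right _ _⟩
  have hr : Continuous r := by
    refine Continuous.subtype_mk ?_ _
    refine Continuous.mul (Continuous.inv₀ (by fun_prop) ?_) continuous_id
    intro z
    have h1 : (0 : ℝ) < max 1 ‖z‖ := lt_of_lt_of_le one_pos (le_max_left _ _)
    exact_mod_cast h1.ne'
  obtain ⟨L, hLc, hL⟩ := aux_log_lift_s10 (fun z => H (r z)) (hc.comp hr) (fun z => h0 _)
  have hcirc : ∀ θ : ℝ, Complex.exp (L (Complex.exp (θ * Complex.I)))
      = Complex.exp (θ * Complex.I) - p := by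
    intro θ
    have hn : ‖Complex.exp (θ * Complex.I)‖ = 1 := Complex.norm_exp_ofReal_mul_I θ
    have hv : ((r (Complex.exp (θ * Complex.I))) : ℂ) = Complex.exp (θ * Complex.I) := by
      simp [r, hn]
    rw [hL, hb _ (by rw [hv]; simp [hn]), hv]
  have hsl : ∀ θ : ℝ, 1 - p * Complex.exp (-(θ * Complex.I)) ∈ Complex.slitPlane := by
    intro θ
    refine Complex.mem_slitPlane_of_norm_lt_one (z := - (p * Complex.exp (-(θ * Complex.I)))) ?_
    have : ‖Complex.exp (-(θ * Complex.I))‖ = 1 := by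
      have := Complex.norm_exp_ofReal_mul_I (-θ)
      simpa using this
    rw [norm_neg, norm_mul, this, mul_one]
    exact hp
  let M : ℝ → ℂ := fun θ => L (Complex.exp (θ * Complex.I))
    - Complex.log (1 - p * Complex.exp (-(θ * Complex.I))) - θ * Complex.I
  have hM : Continuous M := by
    refine Continuous.sub (Continuous.sub (by fun_prop) ?_) (by fun_prop)
    exact Continuous.clog (by fun_prop) hsl
  have hM1 : ∀ θ, Complex.exp (M θ) = 1 := by
    intro θ
    have hne := Complex.slitPlane_ne_zero (hsl θ)
    simp only [M]
    rw [Complex.exp_sub, Complex.exp_sub, hcirc, Complex.exp_log hne]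
    have he := Complex.exp_ne_zero (θ * Complex.I)
    have hk : Complex.exp (θ * Complex.I) - p
      = (1 - p * Complex.exp (-(θ * Complex.I))) * Complex.exp (θ * Complex.I) := by
      rw [sub_mul, mul_assoc, ← Complex.exp_add]; simp
    rw [hk]
    field_simp
  have hconst := Complex.isCoveringMap_exp.const_of_comp hM
    (fun a a' => Subtype.ext (by simp [hM1])) 0 (2 * Real.pi)
  have e1 : Complex.exp (((2 * Real.pi : ℝ) : ℂ) * Complex.I) = 1 := by
    push_cast; exact Complex.exp_two_pi_mul_I
  have e2 : Complex.exp (-(((2 * Real.pi : ℝ) : ℂ) * Complex.I)) = 1 := by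
    rw [Complex.exp_neg, e1, inv_one]
  simp only [M] at hconst
  rw [e1, e2] at hconst
  have h5 : (2 * (Real.pi : ℂ)) * Complex.I = 0 := by
    simp at hconst
    linear_combination hconst
  simp [Real.pi_ne_zero] at h5

lemma aux_ext_line {S : Type*} [TopologicalSpace S] [CompactSpace S] (i : S → ℝ)
    (hi : Continuous i) (hinj : Function.Injective i) (u : S → ℂ) (hu : Continuous u)
    (h0 : ∀ x, u x ≠ 0) :
    ∃ Φ : ℝ → ℂ, Continuous Φ ∧ (∀ t, Φ t ≠ 0) ∧ ∀ x, Φ (i x) = u x := by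
  have hce : Topology.IsClosedEmbedding i := hi.isClosedEmbedding hinj
  obtain ⟨F, hF⟩ := ContinuousMap.exists_extension' hce (⟨u, hu⟩ : C(S, ℂ))
  have hF' : ∀ x, F (i x) = u x := fun x => congrFun hF x
  obtain ⟨m, hm, hmu⟩ : ∃ m : ℝ, 0 < m ∧ ∀ x, m ≤ ‖u x‖ := by
    rcases isEmpty_or_nonempty S with h | h
    · exact ⟨1, one_pos, fun x => h.elim x⟩
    · obtain ⟨x, -, hx⟩ := isCompact_univ.exists_isMinOn (univ_nonempty (α := S))
        (hu.norm.continuousOn)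
      exact ⟨‖u x‖, norm_pos_iff.2 (h0 x), fun y => hx (mem_univ y)⟩
  obtain ⟨a, b, hab⟩ : ∃ a b : ℝ, ∀ x, i x ∈ Icc a b := by
    have hb : Bornology.IsBounded (range i) := (isCompact_range hi).isBounded
    obtain ⟨R, hR⟩ := hb.subset_closedBall 0
    refine ⟨-R, R, fun x => ?_⟩
    have := hR (mem_range_self x)
    rw [mem_closedBall_zero_iff, Real.norm_eq_abs, abs_le] at this
    exact this
  obtain ⟨P, hP⟩ := exists_polynomial_near_of_continuousOn a b (fun t => (F t).re)
    (by fun_prop) (m / 4) (by positivity)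
  obtain ⟨Q, hQ⟩ := exists_polynomial_near_of_continuousOn a b (fun t => (F t).im)
    (by fun_prop) (m / 4) (by positivity)
  let G : ℝ → ℂ := fun t => (P.eval t : ℝ) + (Q.eval t : ℝ) * Complex.I
  have hG : ContDiff ℝ 1 G := by
    have h1 : ContDiff ℝ 1 (fun t : ℝ => P.eval t) := by
      simpa using P.contDiff_aeval (𝕜 := ℝ) 1
    have h2 : ContDiff ℝ 1 (fun t : ℝ => Q.eval t) := by
      simpa using Q.contDiff_aeval (𝕜 := ℝ) 1
    exact (Complex.ofRealCLM.contDiff.comp h1).add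
      ((Complex.ofRealCLM.contDiff.comp h2).mul contDiff_const)
  have hd := hG.dense_compl_range_of_finrank_lt_finrank (by simp)
  obtain ⟨c, hc, hcm⟩ := hd.exists_dist_lt (0 : ℂ) (show 0 < m / 4 by positivity)
  have hcm' : ‖c‖ < m / 4 := by simpa [dist_eq_norm] using hcm
  let G' : ℝ → ℂ := fun t => G t - c
  have hG'c : Continuous G' := hG.continuous.sub continuous_const
  have hG'0 : ∀ t, G' t ≠ 0 := fun t h => hc ⟨t, sub_eq_zero.1 h⟩
  have hclose : ∀ x, ‖G' (i x) - u x‖ < ‖u x‖ := by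
    intro x
    have h1 := hP _ (hab x)
    have h2 := hQ _ (hab x)
    rw [hF'] at h1 h2
    have h3 : ‖G (i x) - u x‖ ≤ |(G (i x) - u x).re| + |(G (i x) - u x).im| :=
      Complex.norm_le_abs_re_add_abs_im _
    have h4 : (G (i x) - u x).re = P.eval (i x) - (u x).re := by simp [G]
    have h5 : (G (i x) - u x).im = Q.eval (i x) - (u x).im := by simp [G]
    rw [h4, h5] at h3
    have h6 : ‖G' (i x) - u x‖ ≤ ‖G (i x) - u x‖ + ‖c‖ := by
      have : G' (i x) - u x = (G (i x) - u x) - c := by simp only [G']; ring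
      rw [this]; exact norm_sub_le _ _
    linarith [hmu x]
  have hsl : ∀ x, G' (i x) / u x ∈ Complex.slitPlane := by
    intro x
    have : G' (i x) / u x = 1 + (G' (i x) - u x) / u x := by
      have := h0 x
      field_simp
      ring
    rw [this]
    apply Complex.mem_slitPlane_of_norm_lt_one
    rw [norm_div, div_lt_one (norm_pos_iff.2 (h0 x))]
    exact hclose x
  obtain ⟨W, hW⟩ := ContinuousMap.exists_extension' hce
    (⟨fun x => Complex.log (G' (i x) / u x),
      Continuous.clog ((hG'c.comp hi).div hu h0) hsl⟩ : C(S, ℂ))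
  have hW' : ∀ x, W (i x) = Complex.log (G' (i x) / u x) := fun x => congrFun hW x
  refine ⟨fun t => G' t * Complex.exp (-W t), by fun_prop,
    fun t => mul_ne_zero (hG'0 t) (Complex.exp_ne_zero _), fun x => ?_⟩
  have := h0 x
  have := hG'0 (i x)
  simp only
  rw [hW', Complex.exp_neg, Complex.exp_log (Complex.slitPlane_ne_zero (hsl x))]
  field_simp

lemma aux_max_principle (g : ↥(Metric.closedBall (0 : ℂ) 1) → ℂ) (hg : Continuous g)
    (hinj : Function.Injective g) (s : ℝ)
    (hs : ∀ z : ↥(Metric.closedBall (0 : ℂ) 1), (z : ℂ) ∈ Metric.sphere (0 : ℂ) 1 →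
      (g z).re ≤ s) (p : ↥(Metric.closedBall (0 : ℂ) 1)) : (g p).re ≤ s := by
  by_contra hlt
  push Not at hlt
  have hp : ‖(p : ℂ)‖ < 1 := by
    refine lt_of_le_of_ne (mem_closedBall_zero_iff.1 p.2) fun h => ?_
    exact absurd (hs p (by simpa using h)) (not_le.2 hlt)
  have hre : Continuous fun z => (g z).re := by fun_prop
  have : CompactSpace ↥(Metric.closedBall (0 : ℂ) 1) :=
    isCompact_iff_compactSpace.1 (isCompact_closedBall _ _)
  have : CompactSpace {z : ↥(Metric.closedBall (0 : ℂ) 1) // (g z).re = s} := by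
    have : IsClosed {z : ↥(Metric.closedBall (0 : ℂ) 1) | (g z).re = s} :=
      isClosed_eq hre continuous_const
    exact isCompact_iff_compactSpace.1 this.isCompact
  obtain ⟨Φ, hΦc, hΦ0, hΦ⟩ := aux_ext_line (S := {z : ↥(Metric.closedBall (0 : ℂ) 1) // (g z).re = s}) (fun z => (g z.1).im) (by fun_prop)
    (fun x y h => Subtype.ext (hinj (Complex.ext (x.2.trans y.2.symm) h)))
    (fun z => (z.1 : ℂ) - p) (by fun_prop) (fun z h => by
      have h1 : z.1 = p := Subtype.ext (sub_eq_zero.1 h)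
      have h2 := z.2
      rw [h1] at h2
      exact hlt.ne' h2)
  classical
  let H : ↥(Metric.closedBall (0 : ℂ) 1) → ℂ := fun z =>
    if (g z).re ≤ s then (z : ℂ) - p else Φ (g z).im
  have hH : Continuous H := by
    refine Continuous.if_le (by fun_prop) (by fun_prop) hre continuous_const ?_
    intro z hz
    exact (hΦ ⟨z, hz⟩).symm
  refine aux_no_ext H hH (fun z => ?_) p hp (fun z hz => by simp [H, hs z hz])
  simp only [H]
  split_ifs with h
  · intro h1
    have h1 : z = p := Subtype.ext (sub_eq_zero.1 h1)
    rw [h1] at h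
    exact absurd h (not_le.2 hlt)
  · exact hΦ0 _

lemma aux_near {X : Type*} [MetricSpace X] (e : ↥(Metric.closedBall (0 : ℂ) 1) ≃ₜ X)
    (a : X) (ha : a ∈ diskBoundary e) (δ : ℝ) (hδ : 0 < δ) :
    ∃ ε > 0, ∀ g : ↥(Metric.closedBall (0 : ℂ) 1) → X, Continuous g → Function.Injective g →
      (∃ p, dist a (g p) < ε) →
      ∃ q : ↥(Metric.closedBall (0 : ℂ) 1), (q : ℂ) ∈ Metric.sphere (0 : ℂ) 1 ∧
        dist a (g q) < δ := by
  obtain ⟨α, hα, rfl⟩ := ha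
  have hα1 : ‖(α : ℂ)‖ = 1 := by simpa using hα
  obtain ⟨η, hη, hη'⟩ := Metric.continuous_iff.1 e.continuous α δ hδ
  let k : X → ℂ := fun x => (starRingEnd ℂ) (α : ℂ) * (e.symm x : ℂ)
  have hk : Continuous k := by fun_prop
  have hkα : (k (e α)).re = 1 := by
    simp only [k, e.symm_apply_apply]
    rw [Complex.conj_mul', hα1]; simp
  have hopen : IsOpen {x | 1 - η ^ 2 / 2 < (k x).re} :=
    isOpen_lt continuous_const (by fun_prop)
  obtain ⟨ε, hε, hε'⟩ := Metric.isOpen_iff.1 hopen (e α) (by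
    simp only [mem_setOf_eq, hkα]; nlinarith)
  refine ⟨ε, hε, fun g hg hgi ⟨p, hp⟩ => ?_⟩
  by_contra! hcon
  have hstep := aux_max_principle (fun z => k (g z)) (hk.comp hg) (fun x y hxy => by
      have hα0 : (starRingEnd ℂ) (α : ℂ) ≠ 0 := by
        intro h
        rw [map_eq_zero] at h
        rw [h] at hα1; simp at hα1
      exact hgi (e.symm.injective (Subtype.ext (mul_left_cancel₀ hα0 hxy)))) (1 - η ^ 2 / 2)
    (fun z hz => ?_) p
  · have := hε' (show g p ∈ ball (e α) ε by rw [mem_ball, dist_comm]; exact hp)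
    exact absurd this (not_lt.2 hstep)
  · by_contra! hlt
    refine absurd (hcon z hz) (not_le.2 ?_)
    have hw := mem_closedBall_zero_iff.1 (e.symm (g z)).2
    have hd : dist (e.symm (g z)) α < η := by
      rw [Subtype.dist_eq, dist_eq_norm]
      refine lt_of_pow_lt_pow_left₀ 2 hη.le ?_
      have hsq : ‖((e.symm (g z) : ℂ)) - α‖ ^ 2
          = ‖(e.symm (g z) : ℂ)‖ ^ 2 + ‖(α : ℂ)‖ ^ 2 - 2 * (k (g z)).re := by
        simp only [k, ← Complex.normSq_eq_norm_sq, Complex.normSq_apply, Complex.sub_re,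
          Complex.sub_im, Complex.mul_re, Complex.conj_re, Complex.conj_im]
        ring
      rw [hsq, hα1]
      nlinarith [norm_nonneg (e.symm (g z) : ℂ)]
    have := hη' _ hd
    rw [e.apply_symm_apply, dist_comm] at this
    exact this

/-- **Lower semicontinuity of boundary diameter.**  Let `X` be a metric space
homeomorphic to the closed unit disk and `Xs n` metric spaces homeomorphic to `X` (each
given by a homeomorphism with the closed disk).  If `f n : Xs n → X` is an
approximately isometric sequence of topological embeddings, then
`liminf diam(∂Xs n) ≥ diam(∂X)`. -/
theorem liminf_boundary_diam
    {X : Type*} [MetricSpace X] (e : ↥(Metric.closedBall (0 : ℂ) 1) ≃ₜ X)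
    (Xs : ℕ → Type*) [∀ n, MetricSpace (Xs n)]
    (es : ∀ n, ↥(Metric.closedBall (0 : ℂ) 1) ≃ₜ Xs n)
    (f : ∀ n, Xs n → X) (hemb : ∀ n, Topology.IsEmbedding (f n))
    (hf : ApproxIsometricSeq f) :
    EMetric.diam (diskBoundary e) ≤
      Filter.atTop.liminf fun n => EMetric.diam (diskBoundary (es n)) := by
  obtain ⟨ε, hε, hiso⟩ := hf
  refine Metric.ediam_le fun a ha b hb => ?_
  refine le_of_forall_lt fun c hc => ?_
  obtain ⟨c', hcc', hc'⟩ := exists_between hc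
  refine lt_of_lt_of_le hcc' ?_
  have hctop : c' ≠ ⊤ := (lt_top_of_lt hc').ne
  have hgap : c'.toReal < dist a b := by
    rw [edist_dist] at hc'
    rwa [← ENNReal.lt_ofReal_iff_toReal_lt hctop]
  set δ := (dist a b - c'.toReal) / 4 with hδ
  have hδ0 : 0 < δ := by rw [hδ]; linarith
  obtain ⟨ε₁, hε₁, h₁⟩ := aux_near e a ha δ hδ0
  obtain ⟨ε₂, hε₂, h₂⟩ := aux_near e b hb δ hδ0
  refine Filter.le_liminf_of_le (by isBoundedDefault) ?_
  filter_upwards [hε.eventually_lt_const hε₁, hε.eventually_lt_const hε₂,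
    hε.eventually_lt_const hδ0] with n hn1 hn2 hn3
  obtain ⟨hdist, hdense⟩ := hiso n
  have hgc : Continuous (fun z => f n (es n z)) := (hemb n).continuous.comp (es n).continuous
  have hgi : Function.Injective (fun z => f n (es n z)) :=
    (hemb n).injective.comp (es n).injective
  have hd : ∀ z : X, ∃ p, dist z (f n (es n p)) < ε n := fun z => by
    obtain ⟨x, hx⟩ := hdense z
    exact ⟨(es n).symm x, by simpa using hx⟩
  obtain ⟨q, hq, hqa⟩ := h₁ _ hgc hgi ((hd a).imp fun p hp => hp.trans hn1)
  obtain ⟨r, hr, hrb⟩ := h₂ _ hgc hgi ((hd b).imp fun p hp => hp.trans hn2)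
  refine le_trans ?_ (Metric.edist_le_ediam_of_mem (mem_image_of_mem _ hq) (mem_image_of_mem _ hr))
  rw [edist_dist, ENNReal.le_ofReal_iff_toReal_le hctop dist_nonneg]
  have h3 := (abs_lt.1 (hdist (es n q) (es n r))).2
  have h4 := dist_triangle4 a (f n (es n q)) (f n (es n r)) b
  rw [dist_comm (f n (es n r)) b] at h4
  linarith
end

section
/- Let C ⊂ [0,1] be a Cantor set (a non-empty compact, perfect, totally disconnected set) with 0, 1 ∈ C such that H¹(C ∩ I) > 0 for every open interval I ⊂ ℝ intersecting C. For each connected component J of [0,1] ∖ C, let η(J) > 0 and let H(J) ⊂ ℝ² be the union of the segment J̄ × {0} with the two vertical segments {a} × [−η(J), η(J)] and {b} × [−η(J), η(J)], where a < b are the endpoints of J. Set F = (C × {0}) ∪ ⋃_J H(J). Let R be the equivalence relation on ℝ² that identifies all points within each set H(J) and is trivial otherwise, and let d_R be the associated quotient pseudometric: d_R(x,y) = inf { Σ_{i=1}^k |p_i − q_i| : p₁ = x, q_k = y, q_i R p_{i+1} for 1 ≤ i ≤ k−1 }, the infimum over all finite chains of points in ℝ². Then for all x, y ∈ F, writing x̃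 and ỹ for their first coordinates with x̃ ≤ ỹ, one has d_R(x,y) = H¹(C ∩ [x̃, ỹ]). -/
open Set MeasureTheory
open scoped ENNReal

/-- `J` is a connected component of `[0,1] ∖ C`. -/
def IsCompOf (C : Set ℝ) (J : Set ℝ) : Prop :=
  ∃ x ∈ Set.Icc (0 : ℝ) 1 \ C, J = connectedComponentIn (Set.Icc (0 : ℝ) 1 \ C) x

/-- The `H`-shape associated to a component `J` of `[0,1] ∖ C` (with `a = inf J`,
`b = sup J`): the horizontal segment `J̄ × {0}` together with the two vertical segments
`{a} × [−η(J), η(J)]` and `{b} × [−η(J), η(J)]`.  Points of the plane `ℝ²` are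
represented by complex numbers `z = (z.re, z.im)`. -/
def Hshape (η : Set ℝ → ℝ) (J : Set ℝ) : Set ℂ :=
  {z : ℂ | z.im = 0 ∧ z.re ∈ closure J} ∪
  {z : ℂ | z.re = sInf J ∧ |z.im| ≤ η J} ∪
  {z : ℂ | z.re = sSup J ∧ |z.im| ≤ η J}

/-- The set `F = (C × {0}) ∪ ⋃_J H(J)`. -/
def Fset (C : Set ℝ) (η : Set ℝ → ℝ) : Set ℂ :=
  {z : ℂ | z.im = 0 ∧ z.re ∈ C} ∪ ⋃ J ∈ {J : Set ℝ | IsCompOf C J}, Hshape η J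

/-- The equivalence relation on `ℝ² = ℂ` identifying all points within each `H`-shape
`H(J)` and trivial otherwise. -/
def Rrel (C : Set ℝ) (η : Set ℝ → ℝ) (x y : ℂ) : Prop :=
  x = y ∨ ∃ J : Set ℝ, IsCompOf C J ∧ x ∈ Hshape η J ∧ y ∈ Hshape η J

/-- The quotient pseudometric associated to `Rrel`:
`d_R(x,y) = inf { Σ_{i=0}^k |p_i − q_i| : p₀ = x, q_k = y, q_i R p_{i+1} }`,
the infimum over all finite chains of points in the plane. -/
noncomputable def dR (C : Set ℝ) (η : Set ℝ → ℝ) (x y : ℂ) : ℝ :=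
  sInf {s : ℝ | ∃ (k : ℕ) (p q : Fin (k + 1) → ℂ),
    p 0 = x ∧ q (Fin.last k) = y ∧
    (∀ i : Fin k, Rrel C η (q i.castSucc) (p i.succ)) ∧
    s = ∑ i, dist (p i) (q i)}

def ChainLen (C : Set ℝ) (η : Set ℝ → ℝ) (x y : ℂ) (s : ℝ) : Prop :=
  ∃ (k : ℕ) (p q : Fin (k + 1) → ℂ),
    p 0 = x ∧ q (Fin.last k) = y ∧
    (∀ i : Fin k, Rrel C η (q i.castSucc) (p i.succ)) ∧
    s = ∑ i, dist (p i) (q i)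

lemma dR_eq (C : Set ℝ) (η : Set ℝ → ℝ) (x y : ℂ) :
    dR C η x y = sInf {s | ChainLen C η x y s} := rfl

lemma chain_nonneg {C : Set ℝ} {η : Set ℝ → ℝ} {x y : ℂ} {s : ℝ}
    (h : ChainLen C η x y s) : 0 ≤ s := by
  obtain ⟨k, p, q, -, -, -, rfl⟩ := h
  exact Finset.sum_nonneg fun _ _ => dist_nonneg

lemma chain_one (C : Set ℝ) (η : Set ℝ → ℝ) (x y : ℂ) :
    ChainLen C η x y (dist x y) :=
  ⟨0, fun _ => x, fun _ => y, rfl, rfl, fun i => i.elim0, by simp⟩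

lemma chain_bdd (C : Set ℝ) (η : Set ℝ → ℝ) (x y : ℂ) :
    BddBelow {s | ChainLen C η x y s} := ⟨0, fun _ h => chain_nonneg h⟩

lemma chain_snoc {C : Set ℝ} {η : Set ℝ → ℝ} {x y z w : ℂ} {s : ℝ}
    (h : ChainLen C η x y s) (hR : Rrel C η y z) :
    ChainLen C η x w (s + dist z w) := by
  obtain ⟨k, p, q, hp, hq, hr, rfl⟩ := h
  refine ⟨k + 1, Fin.snoc (α := fun _ => ℂ) p z, Fin.snoc (α := fun _ => ℂ) q w, ?_, ?_, ?_, ?_⟩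
  · rw [← Fin.castSucc_zero, Fin.snoc_castSucc, hp]
  · simp
  · intro i
    refine Fin.lastCases ?_ (fun j => ?_) i
    · rw [Fin.succ_last, Fin.snoc_last, Fin.snoc_castSucc, hq]; exact hR
    · rw [Fin.succ_castSucc, Fin.snoc_castSucc, Fin.snoc_castSucc]; exact hr j
  · simp only [Fin.sum_univ_castSucc (n := k + 1), Fin.snoc_castSucc, Fin.snoc_last]

lemma dR_step (C : Set ℝ) (η : Set ℝ → ℝ) {x y z : ℂ} (w : ℂ) (hR : Rrel C η y z) :
    dR C η x w ≤ dR C η x y + dist z w := by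
  rw [← sub_le_iff_le_add]
  conv_rhs => rw [dR_eq]
  refine le_csInf ⟨_, chain_one C η x y⟩ fun s hs => ?_
  rw [sub_le_iff_le_add]
  exact csInf_le (chain_bdd C η x w) (chain_snoc hs hR)

lemma Rrel_symm {C : Set ℝ} {η : Set ℝ → ℝ} {x y : ℂ} (h : Rrel C η x y) : Rrel C η y x := by
  rcases h with h | ⟨J, h1, h2, h3⟩
  · exact Or.inl h.symm
  · exact Or.inr ⟨J, h1, h3, h2⟩

lemma dR_rel (C : Set ℝ) (η : Set ℝ → ℝ) {x y z : ℂ} (hR : Rrel C η y z) :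
    dR C η x y = dR C η x z := by
  apply le_antisymm
  · simpa using dR_step C η (x := x) y (Rrel_symm hR)
  · simpa using dR_step C η (x := x) z hR

lemma dR_self (C : Set ℝ) (η : Set ℝ → ℝ) (x : ℂ) : dR C η x x = 0 := by
  apply le_antisymm
  · exact csInf_le (chain_bdd C η x x) ((dist_self x) ▸ chain_one C η x x : ChainLen C η x x 0)
  · exact Real.sInf_nonneg fun s hs => chain_nonneg (C := C) (η := η) hs

lemma comp_props {C J : Set ℝ} (h : IsCompOf C J) :
    J.Nonempty ∧ J ⊆ Icc 0 1 \ C ∧ J.OrdConnected := by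
  obtain ⟨x, hx, rfl⟩ := h
  exact ⟨⟨x, mem_connectedComponentIn hx⟩, connectedComponentIn_subset _ _,
    isPreconnected_connectedComponentIn.ordConnected⟩

lemma H_re {C J : Set ℝ} {η : Set ℝ → ℝ} (h : IsCompOf C J) {z : ℂ} (hz : z ∈ Hshape η J) :
    z.re ∈ closure J := by
  obtain ⟨hn, hs, -⟩ := comp_props h
  have hb : BddBelow J := ⟨0, fun t ht => (hs ht).1.1⟩
  have ha : BddAbove J := ⟨1, fun t ht => (hs ht).1.2⟩
  rcases hz with (⟨-, hz⟩ | ⟨hz, -⟩) | ⟨hz, -⟩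
  · exact hz
  · rw [hz]; exact csInf_mem_closure hn hb
  · rw [hz]; exact csSup_mem_closure hn ha

lemma F_rel {C : Set ℝ} {η : Set ℝ → ℝ} {z : ℂ} (hz : z ∈ Fset C η) :
    Rrel C η z (z.re : ℂ) := by
  rcases hz with ⟨h, -⟩ | h
  · exact Or.inl (Complex.ext (by simp) (by simp [h]))
  · simp only [mem_iUnion, mem_ofPred_eq] at h
    obtain ⟨J, hJ, hz⟩ := h
    exact Or.inr ⟨J, hJ, hz, Or.inl (Or.inl ⟨by simp, by simpa using H_re hJ hz⟩)⟩

noncomputable def fC (C : Set ℝ) (t : ℝ) : ℝ := (volume (C ∩ Icc 0 t)).toReal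

lemma vol_fin (C : Set ℝ) (a b : ℝ) : volume (C ∩ Icc a b) ≠ ∞ :=
  ne_top_of_le_ne_top (by simp) (measure_mono inter_subset_right)

lemma fC_sub {C : Set ℝ} (hC : MeasurableSet C) (hsub : C ⊆ Icc 0 1) {s t : ℝ} (hst : s ≤ t) :
    fC C t = fC C s + (volume (C ∩ Icc s t)).toReal := by
  unfold fC
  rw [← ENNReal.toReal_add (vol_fin _ _ _) (vol_fin _ _ _)]
  congr 1
  have e : C ∩ Icc 0 t = (C ∩ Icc 0 s) ∪ (C ∩ Icc s t) := by
    ext u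
    constructor
    · rintro ⟨h, h1, h2⟩
      rcases le_total u s with h3 | h3
      · exact Or.inl ⟨h, h1, h3⟩
      · exact Or.inr ⟨h, h3, h2⟩
    · rintro (⟨h, h1, h2⟩ | ⟨h, h1, h2⟩)
      · exact ⟨h, h1, h2.trans hst⟩
      · exact ⟨h, (hsub h).1, h2⟩
  rw [e]
  refine measure_union₀ (hC.inter measurableSet_Icc).nullMeasurableSet ?_
  refine measure_mono_null (t := {s}) ?_ (by simp)
  rintro u ⟨⟨-, h1⟩, -, h2⟩
  exact le_antisymm h1.2 h2.1

lemma fC_lip {C : Set ℝ} (hC : MeasurableSet C) (hsub : C ⊆ Icc 0 1) (s t : ℝ) :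
    |fC C t - fC C s| ≤ |t - s| := by
  wlog h : s ≤ t generalizing s t
  · rw [abs_sub_comm, abs_sub_comm t s]; exact this t s (le_of_not_ge h)
  · rw [fC_sub hC hsub h, add_sub_cancel_left, abs_of_nonneg ENNReal.toReal_nonneg,
      abs_of_nonneg (sub_nonneg.2 h)]
    refine ENNReal.toReal_le_of_le_ofReal (sub_nonneg.2 h) ?_
    rw [← Real.volume_Icc]
    exact measure_mono inter_subset_right

lemma fC_cont {C : Set ℝ} (hC : MeasurableSet C) (hsub : C ⊆ Icc 0 1) : Continuous (fC C) := by
  have : LipschitzWith 1 (fC C) := LipschitzWith.of_dist_le_mul fun s t => by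
    simpa [Real.dist_eq] using fC_lip hC hsub t s
  exact this.continuous

lemma fC_const {C J : Set ℝ} (hC : MeasurableSet C) (hsub : C ⊆ Icc 0 1) (h : IsCompOf C J)
    {s t : ℝ} (hs : s ∈ closure J) (ht : t ∈ closure J) : fC C s = fC C t := by
  obtain ⟨⟨u, hu⟩, hJ, ho⟩ := comp_props h
  have key : ∀ a ∈ J, ∀ b ∈ J, a ≤ b → fC C a = fC C b := by
    intro a ha b hb hab
    have e : C ∩ Icc a b = ∅ := by
      ext v
      simp only [mem_inter_iff, mem_empty_iff_false, iff_false, not_and]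
      exact fun hv hv' => (hJ (ho.out ha hb hv')).2 hv
    rw [fC_sub hC hsub hab, e]; simp
  have key2 : EqOn (fC C) (fun _ => fC C u) J := fun a ha => by
    rcases le_total a u with h | h
    · exact key a ha u hu h
    · exact (key u hu a ha h).symm
  have k3 := key2.closure (fC_cont hC hsub) continuous_const
  rw [k3 hs, k3 ht]

lemma fC_rel {C : Set ℝ} {η : Set ℝ → ℝ} (hC : MeasurableSet C) (hsub : C ⊆ Icc 0 1) {z w : ℂ}
    (h : Rrel C η z w) : fC C z.re = fC C w.re := by
  rcases h with rfl | ⟨J, hJ, hz, hw⟩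
  · rfl
  · exact fC_const hC hsub hJ (H_re hJ hz) (H_re hJ hw)

lemma fC_dist {C : Set ℝ} (hC : MeasurableSet C) (hsub : C ⊆ Icc 0 1) (z w : ℂ) :
    fC C w.re - fC C z.re ≤ dist z w := by
  refine (le_abs_self _).trans ((fC_lip hC hsub _ _).trans ?_)
  rw [dist_comm, Complex.dist_eq, ← Complex.sub_re]
  exact Complex.abs_re_le_norm _

lemma chain_lower {C : Set ℝ} {η : Set ℝ → ℝ} (hC : MeasurableSet C) (hsub : C ⊆ Icc 0 1) :
    ∀ (k : ℕ) (p q : Fin (k + 1) → ℂ),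
    (∀ i : Fin k, Rrel C η (q i.castSucc) (p i.succ)) →
    fC C (q (Fin.last k)).re - fC C (p 0).re ≤ ∑ i, dist (p i) (q i) := by
  intro k
  induction k with
  | zero => intro p q _; simpa using fC_dist hC hsub (p 0) (q 0)
  | succ k ih =>
    intro p q h
    have h1 := ih (fun i => p i.castSucc) (fun i => q i.castSucc) (fun i => h i.castSucc)
    have h2 := fC_rel hC hsub (h (Fin.last k))
    have h3 := fC_dist hC hsub (p (Fin.last (k+1))) (q (Fin.last (k+1)))
    rw [Fin.sum_univ_castSucc]
    rw [Fin.succ_last] at h2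
    simp only [Fin.castSucc_zero] at h1
    linarith

lemma gap_rat {C : Set ℝ} {η : Set ℝ → ℝ} (hC : IsClosed C) (h0 : (0 : ℝ) ∈ C)
    (h1 : (1 : ℝ) ∈ C) {t : ℝ} (ht : t ∈ Icc (0 : ℝ) 1 \ C) :
    ∃ q : ℚ, Rrel C η (t : ℂ) (((q : ℝ) : ℝ) : ℂ) := by
  have e : Icc (0 : ℝ) 1 \ C = Ioo 0 1 \ C := by
    ext u
    constructor
    · rintro ⟨⟨a, b⟩, c⟩
      exact ⟨⟨lt_of_le_of_ne a (fun h => c (h ▸ h0)), lt_of_le_of_ne b (fun h => c (h ▸ h1))⟩, c⟩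
    · rintro ⟨⟨a, b⟩, c⟩
      exact ⟨⟨a.le, b.le⟩, c⟩
  have ho : IsOpen (Icc (0 : ℝ) 1 \ C) := by rw [e]; exact isOpen_Ioo.sdiff hC
  have ho2 := ho.connectedComponentIn (x := t)
  obtain ⟨q, hq⟩ := Rat.denseRange_cast (𝕜 := ℝ) |>.exists_mem_open ho2
    ⟨t, mem_connectedComponentIn ht⟩
  refine ⟨q, Or.inr ⟨_, ⟨t, ht, rfl⟩, Or.inl (Or.inl ⟨by simp, ?_⟩), Or.inl (Or.inl ⟨by simp, ?_⟩)⟩⟩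
  · exact subset_closure (by simpa using mem_connectedComponentIn ht)
  · exact subset_closure (by simpa using hq)

lemma upper {C : Set ℝ} {η : Set ℝ → ℝ} (hC : IsClosed C) (h0 : (0 : ℝ) ∈ C)
    (h1 : (1 : ℝ) ∈ C) (x : ℂ) {a b : ℝ} (ha : 0 ≤ a) (hb : b ≤ 1) (hab : a ≤ b) :
    dR C η x (b : ℂ) ≤ dR C η x (a : ℂ) + (volume (C ∩ Icc a b)).toReal := by
  set h : ℝ → ℝ := fun t => dR C η x (t : ℂ) with hh
  have hl : LipschitzWith 1 h := LipschitzWith.of_le_add fun s t => by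
    have := dR_step C η (x := x) (s : ℂ) (Or.inl rfl : Rrel C η (t : ℂ) t)
    have e : dist (t : ℂ) (s : ℂ) = dist s t := by
      rw [dist_comm, Complex.dist_eq, ← Complex.ofReal_sub, Complex.norm_real, Real.dist_eq,
        Real.norm_eq_abs]
    rwa [e] at this
  have hsub : Icc (h a) (h b) ⊆ h '' (C ∩ Icc a b) ∪ range (fun q : ℚ => h q) := by
    intro v hv
    obtain ⟨t, ht, rfl⟩ := intermediate_value_Icc hab hl.continuous.continuousOn hv
    by_cases htC : t ∈ C
    · exact Or.inl ⟨t, ⟨htC, ht⟩, rfl⟩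
    · obtain ⟨q, hq⟩ := gap_rat (η := η) hC h0 h1 (t := t)
        ⟨⟨ha.trans ht.1, ht.2.trans hb⟩, htC⟩
      exact Or.inr ⟨q, (dR_rel C η hq).symm⟩
  have hm : ENNReal.ofReal (h b - h a) ≤ volume (C ∩ Icc a b) := by
    rw [← Real.volume_Icc]
    refine (measure_mono hsub).trans ((measure_union_le _ _).trans ?_)
    rw [(countable_range _).measure_zero, add_zero, ← hausdorffMeasure_real]
    simpa using hl.hausdorffMeasure_image_le zero_le_one (C ∩ Icc a b)
  have := (ENNReal.ofReal_le_iff_le_toReal (vol_fin _ _ _)).1 hm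
  change h b ≤ h a + _
  linarith

lemma F_Icc {C : Set ℝ} {η : Set ℝ → ℝ} (hsub : C ⊆ Icc 0 1) {z : ℂ} (hz : z ∈ Fset C η) :
    z.re ∈ Icc (0 : ℝ) 1 := by
  rcases hz with ⟨-, h⟩ | h
  · exact hsub h
  · simp only [mem_iUnion, mem_ofPred_eq] at h
    obtain ⟨J, hJ, hz⟩ := h
    exact closure_minimal (fun t ht => ((comp_props hJ).2.1 ht).1) isClosed_Icc (H_re hJ hz)

/-- **The quotient pseudometric on the collapsed Cantor construction.**  Let
`C ⊆ [0,1]` be a Cantor set containing `0` and `1` such that `H¹(C ∩ I) > 0` for every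
open interval `I` meeting `C`, and let `η(J) > 0` for each component `J` of
`[0,1] ∖ C`.  Then for all `x, y ∈ F` with `x̃ ≤ ỹ` (first coordinates), one has
`d_R(x,y) = H¹(C ∩ [x̃, ỹ])`. -/
theorem dR_eq_hausdorff_measure
    (C : Set ℝ) (hCsub : C ⊆ Set.Icc 0 1) (hCcpt : IsCompact C) (hCperf : Perfect C)
    (hCtd : IsTotallyDisconnected C) (h0 : (0 : ℝ) ∈ C) (h1 : (1 : ℝ) ∈ C)
    (hpos : ∀ a b : ℝ, a < b → (Set.Ioo a b ∩ C).Nonempty →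
      0 < μH[1] (C ∩ Set.Ioo a b))
    (η : Set ℝ → ℝ) (hη : ∀ J : Set ℝ, IsCompOf C J → 0 < η J)
    (x y : ℂ) (hx : x ∈ Fset C η) (hy : y ∈ Fset C η) (hxy : x.re ≤ y.re) :
    dR C η x y = (μH[1] (C ∩ Set.Icc x.re y.re) : ℝ≥0∞).toReal := by
  have hcl := hCcpt.isClosed
  have hm := hcl.measurableSet
  rw [hausdorffMeasure_real]
  apply le_antisymm
  · rw [dR_rel C η (F_rel hy)]
    refine (upper hcl h0 h1 x (F_Icc hCsub hx).1 (F_Icc hCsub hy).2 hxy).trans ?_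
    rw [← dR_rel C η (F_rel hx), dR_self, zero_add]
  · rw [dR_eq]
    refine le_csInf ⟨_, chain_one C η x y⟩ ?_
    rintro s ⟨k, p, q, hp, hq, hr, rfl⟩
    have := chain_lower hm hCsub k p q hr
    rw [hp, hq, fC_sub hm hCsub hxy] at this
    linarith
end
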